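/- arXiv:2408.16543 — 3 statements merged into one kernel-verified Lean document; each statement's English description precedes it below -/
import Mathlib

section
/- Let p, q be probability measures on ℝ^d with p absolutely continuous with respect to q and dp/dq ≤ 1/μ for some μ > 0, and let α ∈ (0,1). Then |KKL_α(p||q) − KKL(p||q)| ≤ ( α(1 + 1/μ) + (α²/(1−α))(1 + 1/μ²) ) · |Tr(Σ_p log Σ_q)|. -/
open MeasureTheory RealInnerProductSpace
open scoped ENNReal

noncomputable section

/-- Rank-one operator `u v^*` : `f ↦ ⟪v, f⟫ • u`. -/
def rankOne {H : Type*} [NormedAddCommGroup H] [InnerProductSpace ℝ H] (u v : H) :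
    H →L[ℝ] H := (innerSL ℝ v).smulRight u

/-- Covariance operator `Σ_p = ∫ φ(x) ⊗ φ(x) dp(x)` of the measure `p` with respect to
the feature map `φ`. -/
def covOp {d : ℕ} {H : Type*} [NormedAddCommGroup H] [InnerProductSpace ℝ H]
    [CompleteSpace H] (φ : EuclideanSpace ℝ (Fin d) → H)
    (p : Measure (EuclideanSpace ℝ (Fin d))) : H →L[ℝ] H :=
  ∫ x, rankOne (φ x) (φ x) ∂p



lemma kk_log_int (a : ℝ) (ha : 0 < a) (ha1 : a ≤ 1) :
    IntegrableOn (fun s : ℝ => 1/(a+s) - 1/(1+s)) (Set.Ioi 0) ∧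
    ∫ s in Set.Ioi (0:ℝ), (1/(a+s) - 1/(1+s)) = - Real.log a := by
  have hd : ∀ x ∈ Set.Ici (0:ℝ), HasDerivAt (fun s => Real.log (a+s) - Real.log (1+s))
      (1/(a+x) - 1/(1+x)) x := by
    intro x hx
    have hx' : (0:ℝ) ≤ x := hx
    exact (((hasDerivAt_id x).const_add a).log (by simp; positivity)).sub
      (((hasDerivAt_id x).const_add 1).log (by simp; positivity))
  have hn : ∀ x ∈ Set.Ioi (0:ℝ), 0 ≤ 1/(a+x) - 1/(1+x) := by
    intro x hx
    have hx' : (0:ℝ) < x := hx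
    have : 1/(1+x) ≤ 1/(a+x) := one_div_le_one_div_of_le (by positivity) (by linarith)
    linarith
  have ht : Filter.Tendsto (fun s : ℝ => Real.log (a+s) - Real.log (1+s)) Filter.atTop (nhds 0) := by
    have h1 : Filter.Tendsto (fun s : ℝ => 1 + (a-1) * (1+s)⁻¹) Filter.atTop (nhds (1 + (a-1)*0)) := by
      refine Filter.Tendsto.const_add _ (Filter.Tendsto.const_mul _ ?_)
      exact tendsto_inv_atTop_zero.comp (Filter.tendsto_atTop_add_const_left _ _ Filter.tendsto_id)
    have h2 := (Real.continuousAt_log (x := 1 + (a-1)*0) (by simp)).tendsto.comp h1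
    simp only [mul_zero, add_zero, Real.log_one] at h2
    refine h2.congr' ?_
    filter_upwards [Filter.eventually_ge_atTop 0] with s hs
    rw [← Real.log_div (by positivity) (by positivity)]
    simp only [Function.comp]
    congr 1
    field_simp
    ring
  refine ⟨integrableOn_Ioi_deriv_of_nonneg' hd hn ht, ?_⟩
  rw [integral_Ioi_of_hasDerivAt_of_nonneg' hd hn ht]
  simp

lemma kk_sq_int (a : ℝ) (ha : 0 < a) :
    IntegrableOn (fun s : ℝ => a/(a+s)^2) (Set.Ioi 0) ∧
    ∫ s in Set.Ioi (0:ℝ), (a/(a+s)^2) = 1 := by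
  have hd : ∀ x ∈ Set.Ici (0:ℝ), HasDerivAt (fun s => -(a * (a+s)⁻¹)) (a/(a+x)^2) x := by
    intro x hx
    have hx' : (0:ℝ) ≤ x := hx
    have := ((((hasDerivAt_id x).const_add a).inv (by simp; positivity)).const_mul a).neg
    refine this.congr_deriv ?_
    simp
    field_simp
  have hn : ∀ x ∈ Set.Ioi (0:ℝ), 0 ≤ a/(a+x)^2 := by
    intro x hx
    positivity
  have ht : Filter.Tendsto (fun s : ℝ => -(a * (a+s)⁻¹)) Filter.atTop (nhds (-(a*0))) := by
    refine (Filter.Tendsto.const_mul _ ?_).neg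
    exact tendsto_inv_atTop_zero.comp (Filter.tendsto_atTop_add_const_left _ _ Filter.tendsto_id)
  refine ⟨integrableOn_Ioi_deriv_of_nonneg' hd hn ht, ?_⟩
  rw [integral_Ioi_of_hasDerivAt_of_nonneg' hd hn ht]
  simp [ha.ne']

/-- Interchange of sum and integral for nonnegative families with summable weights. -/
lemma kk_tonelli {X : Type*} (w : X → ℝ) (hw0 : ∀ x, 0 ≤ w x) (hw : Summable w)
    (F : X → ℝ → ℝ) (I : X → ℝ)
    (hF0 : ∀ x, w x ≠ 0 → ∀ s, 0 < s → 0 ≤ F x s)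
    (hFi : ∀ x, w x ≠ 0 → IntegrableOn (F x) (Set.Ioi 0) ∧ ∫ s in Set.Ioi (0:ℝ), F x s = I x)
    (hs : Summable (fun x => w x * I x)) (hps : ∀ s, 0 < s → Summable (fun x => w x * F x s)) :
    IntegrableOn (fun s => ∑' x, w x * F x s) (Set.Ioi 0) ∧
    ∫ s in Set.Ioi (0:ℝ), (∑' x, w x * F x s) = ∑' x, w x * I x := by
  have hc : (Function.support w).Countable := hw.countable_support
  have : Countable (Function.support w) := hc.to_subtype
  have e1 : ∀ s, ∑' x, w x * F x s = ∑' x : Function.support w, w x * F x s := by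
    intro s
    refine (tsum_subtype_eq_of_support_subset (f := fun x => w x * F x s) ?_).symm
    exact fun x hx => left_ne_zero_of_mul hx
  have e2 : ∑' x, w x * I x = ∑' x : Function.support w, w x * I x := by
    refine (tsum_subtype_eq_of_support_subset (f := fun x => w x * I x) ?_).symm
    exact fun x hx => left_ne_zero_of_mul hx
  simp only [e1, e2]
  have hint : ∀ x : Function.support w, Integrable (fun s => w x * F x s) (volume.restrict (Set.Ioi 0)) :=
    fun x => (hFi x x.2).1.const_mul _
  have hval : ∀ x : Function.support w, ∫ s in Set.Ioi (0:ℝ), w x * F x s = w x * I x := by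
    intro x
    rw [integral_const_mul, (hFi x x.2).2]
  have hnn : ∀ x : Function.support w, ∀ s, 0 < s → 0 ≤ w x * F x s :=
    fun x s hs => mul_nonneg (hw0 _) (hF0 x x.2 s hs)
  have hnorm : ∀ x : Function.support w, ∫ s in Set.Ioi (0:ℝ), ‖w x * F x s‖ = w x * I x := by
    intro x
    rw [← hval x]
    refine setIntegral_congr_fun measurableSet_Ioi (fun s hs => ?_)
    exact Real.norm_of_nonneg (hnn x s hs)
  have hsub : Summable (fun x : Function.support w => w x * I x) := hs.subtype _
  have hsum : Summable (fun x : Function.support w => ∫ s in Set.Ioi (0:ℝ), ‖w x * F x s‖) := by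
    simpa only [hnorm] using hsub
  have H := hasSum_integral_of_summable_integral_norm hint hsum
  simp only [hval] at H
  refine ⟨?_, H.tsum_eq.symm⟩
  -- integrability through lintegral
  have hm : AEStronglyMeasurable (fun s => ∑' x : Function.support w, w x * F x s)
      (volume.restrict (Set.Ioi 0)) := by
    have hm' : AEMeasurable (fun s => (∑' x : Function.support w, ENNReal.ofReal (w x * F x s)).toReal)
        (volume.restrict (Set.Ioi 0)) :=
      (AEMeasurable.tsum (fun x => (hint x).aemeasurable.ennreal_ofReal)).ennreal_toReal
    refine (hm'.congr ?_).aestronglyMeasurable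
    filter_upwards [ae_restrict_mem measurableSet_Ioi] with s hs'
    rw [← ENNReal.ofReal_tsum_of_nonneg (fun x => hnn x s hs') ((hps s hs').subtype _)]
    rw [ENNReal.toReal_ofReal (tsum_nonneg (fun x => hnn x s hs'))]
  refine ⟨hm, ?_⟩
  rw [hasFiniteIntegral_iff_ofReal]
  · have : ∫⁻ s in Set.Ioi (0:ℝ), ENNReal.ofReal (∑' x : Function.support w, w x * F x s)
        = ∑' x : Function.support w, ENNReal.ofReal (w x * I x) := by
      rw [setLIntegral_congr_fun (g := fun s => ∑' x : Function.support w, ENNReal.ofReal (w x * F x s)) measurableSet_Ioi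
        (fun s hs' => ENNReal.ofReal_tsum_of_nonneg (fun x => hnn x s hs') ((hps s hs').subtype _))]
      rw [lintegral_tsum (fun x => (hint x).aemeasurable.ennreal_ofReal)]
      refine tsum_congr fun x => ?_
      rw [← hval x, ofReal_integral_eq_lintegral_ofReal (hint x)]
      filter_upwards [ae_restrict_mem measurableSet_Ioi] with s hs' using hnn x s hs'
    rw [this, ← ENNReal.ofReal_tsum_of_nonneg _ hsub]
    · exact ENNReal.ofReal_lt_top
    · intro x
      rw [← hval x]
      exact setIntegral_nonneg measurableSet_Ioi (fun s hs' => hnn x s hs')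
  · filter_upwards [ae_restrict_mem measurableSet_Ioi] with s hs' using tsum_nonneg (fun x => hnn x s hs')

/-- Existence of resolvent vectors. -/
lemma kk_resolvent {H : Type*} [NormedAddCommGroup H] [InnerProductSpace ℝ H] [CompleteSpace H]
    (A : H →L[ℝ] H) (hA : ∀ v, 0 ≤ ⟪v, A v⟫) (s : ℝ) (hs : 0 < s) (v : H) :
    ∃ y, A y + s • y = v := by
  have hu : IsUnit (A + s • (1 : H →L[ℝ] H)) := by
    refine ContinuousLinearMap.isUnit_of_forall_le_norm_inner_map _ (c := s.toNNReal) (Real.toNNReal_pos.mpr hs) ?_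
    intro x
    have : ⟪(A + s • (1 : H →L[ℝ] H)) x, x⟫ = ⟪x, A x⟫ + s * ‖x‖^2 := by
      simp [inner_add_left, inner_smul_left, real_inner_comm]
    rw [this, Real.norm_of_nonneg (by have := hA x; positivity)]
    have := hA x
    rw [Real.coe_toNNReal _ hs.le]
    nlinarith
  obtain ⟨y, hy⟩ := (ContinuousLinearMap.isUnit_iff_bijective.mp hu).2 v
  exact ⟨y, by simpa using hy⟩

lemma kk_hasSum_congr {X : Type*} {u v : X → ℝ} {r : ℝ} (h : ∀ x, u x = v x) (hv : HasSum v r) :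
    HasSum u r := (funext h : u = v) ▸ hv

section resolvent
variable {H : Type*} [NormedAddCommGroup H] [InnerProductSpace ℝ H] {ι : Type*}

lemma kk_coord (A : H →L[ℝ] H) (hsym : ∀ u v, ⟪u, A v⟫ = ⟪A u, v⟫)
    (g : HilbertBasis ι ℝ H) (a : ι → ℝ) (hg : ∀ j, A (g j) = a j • g j) (j : ι) (v : H) :
    ⟪(g j : H), A v⟫ = a j * ⟪(g j : H), v⟫ := by
  rw [hsym, hg, real_inner_smul_left]

lemma kk_form (A : H →L[ℝ] H) (hsym : ∀ u v, ⟪u, A v⟫ = ⟪A u, v⟫)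
    (g : HilbertBasis ι ℝ H) (a : ι → ℝ) (hg : ∀ j, A (g j) = a j • g j) (v : H) :
    HasSum (fun j => a j * ⟪(g j : H), v⟫ ^ 2) ⟪v, A v⟫ := by
  refine kk_hasSum_congr (fun j => ?_) (g.hasSum_inner_mul_inner v (A v))
  rw [kk_coord A hsym g a hg, real_inner_comm]; ring

lemma kk_res_coord (A : H →L[ℝ] H) (hsym : ∀ u v, ⟪u, A v⟫ = ⟪A u, v⟫)
    (g : HilbertBasis ι ℝ H) (a : ι → ℝ) (hg : ∀ j, A (g j) = a j • g j) (ha : ∀ j, 0 ≤ a j)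
    (s : ℝ) (hs : 0 < s) (y v : H) (hy : A y + s • y = v) (j : ι) :
    ⟪(g j : H), y⟫ = ⟪(g j : H), v⟫ / (a j + s) := by
  have h1 : ⟪(g j : H), v⟫ = (a j + s) * ⟪(g j : H), y⟫ := by
    rw [← hy, inner_add_right, kk_coord A hsym g a hg, real_inner_smul_right]; ring
  have : 0 < a j + s := by have := ha j; positivity
  rw [h1]; field_simp

lemma kk_res_sum (A : H →L[ℝ] H) (hsym : ∀ u v, ⟪u, A v⟫ = ⟪A u, v⟫)
    (g : HilbertBasis ι ℝ H) (a : ι → ℝ) (hg : ∀ j, A (g j) = a j • g j) (ha : ∀ j, 0 ≤ a j)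
    (s : ℝ) (hs : 0 < s) (y v u : H) (hy : A y + s • y = v) :
    HasSum (fun j => ⟪u, (g j : H)⟫ * ⟪v, (g j : H)⟫ * (1 / (a j + s) - 1 / (1 + s)))
      (⟪u, y⟫ - ⟪u, v⟫ / (1 + s)) := by
  refine kk_hasSum_congr (fun j => ?_)
    ((g.hasSum_inner_mul_inner u y).sub ((g.hasSum_inner_mul_inner u v).div_const (1 + s)))
  rw [kk_res_coord A hsym g a hg ha s hs y v hy, real_inner_comm v]; ring

lemma kk_res_sq (A : H →L[ℝ] H) (hsym : ∀ u v, ⟪u, A v⟫ = ⟪A u, v⟫)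
    (g : HilbertBasis ι ℝ H) (a : ι → ℝ) (hg : ∀ j, A (g j) = a j • g j) (ha : ∀ j, 0 ≤ a j)
    (s : ℝ) (hs : 0 < s) (y v : H) (hy : A y + s • y = v) :
    HasSum (fun j => ⟪v, (g j : H)⟫ ^ 2 * (a j / (a j + s) ^ 2)) ⟪y, A y⟫ := by
  convert kk_form A hsym g a hg y using 2 with j
  rw [kk_res_coord A hsym g a hg ha s hs y v hy, real_inner_comm v]
  have : 0 < a j + s := by have := ha j; positivity
  field_simp

/-- variational bound: `2⟪v,w⟫ - ⟪w,(A+s)w⟫ ≤ ⟪v,(A+s)⁻¹v⟫`. -/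
lemma kk_var (A : H →L[ℝ] H) (hsym : ∀ u v, ⟪u, A v⟫ = ⟪A u, v⟫) (hA : ∀ v, 0 ≤ ⟪v, A v⟫)
    (s : ℝ) (hs : 0 < s) (y v w : H) (hy : A y + s • y = v) :
    2 * ⟪v, w⟫ - (⟪w, A w⟫ + s * ⟪w, w⟫) ≤ ⟪v, y⟫ := by
  have h1 := hA (w - y)
  have h2 : 0 ≤ ⟪w - y, w - y⟫ := real_inner_self_nonneg
  have e3 : ⟪v, w⟫ = ⟪y, A w⟫ + s * ⟪y, w⟫ := by
    rw [← hy, inner_add_left, real_inner_smul_left, hsym]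
  have e4 : ⟪v, y⟫ = ⟪y, A y⟫ + s * ⟪y, y⟫ := by
    rw [← hy, inner_add_left, real_inner_smul_left, hsym]
  have e5 : ⟪w, A y⟫ = ⟪y, A w⟫ := by rw [hsym, real_inner_comm]
  simp only [map_sub, inner_sub_left, inner_sub_right] at h1 h2
  rw [e3, e4]
  rw [e5] at h1
  rw [real_inner_comm w y] at h2
  have := mul_nonneg hs.le h2
  rw [real_inner_comm w y]
  nlinarith

lemma kk_quad (P Q : H →L[ℝ] H) (hPs : ∀ u v, ⟪u, P v⟫ = ⟪P u, v⟫)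
    (c : ℝ) (hc : 0 < c) (hPQ : ∀ v, ⟪v, P v⟫ ≤ c * ⟪v, Q v⟫)
    (f : HilbertBasis ι ℝ H) (lam : ι → ℝ) (hf : ∀ i, P (f i) = lam i • f i)
    (hlam : ∀ i, 0 ≤ lam i)
    (s : ℝ) (hs : 0 < s) (y : ι → H) (hy : ∀ i, Q (y i) + s • y i = f i) (F : Finset ι) (t : ι → ℝ) :
    ∑ i ∈ F, ∑ k ∈ F, lam i * lam k * ⟪(f i : H), y k⟫ * (t i * t k) ≤
      c * ∑ i ∈ F, lam i * t i ^ 2 := by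
  set w : H := ∑ k ∈ F, (lam k * t k) • y k with hw
  set X := ∑ i ∈ F, ∑ k ∈ F, lam i * lam k * ⟪(f i : H), y k⟫ * (t i * t k) with hX
  have e1 : X = ∑ i ∈ F, lam i * t i * ⟪(f i : H), w⟫ := by
    rw [hX]
    refine Finset.sum_congr rfl fun i _ => ?_
    rw [hw, inner_sum, Finset.mul_sum]
    refine Finset.sum_congr rfl fun k _ => ?_
    rw [real_inner_smul_right]; ring
  have e2 : Q w + s • w = ∑ k ∈ F, (lam k * t k) • (f k : H) := by
    rw [hw, map_sum, Finset.smul_sum, ← Finset.sum_add_distrib]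
    refine Finset.sum_congr rfl fun k _ => ?_
    rw [← hy k, smul_add, map_smul, smul_comm s]
  have e3 : X = ⟪w, Q w⟫ + s * ⟪w, w⟫ := by
    rw [← real_inner_smul_right, ← inner_add_right, e2, e1, inner_sum]
    refine Finset.sum_congr rfl fun k _ => ?_
    rw [real_inner_smul_right, real_inner_comm w]
  have h4 : ∑ i ∈ F, lam i * ⟪(f i : H), w⟫ ^ 2 ≤ ⟪w, P w⟫ :=
    sum_le_hasSum F (fun i _ => mul_nonneg (hlam i) (sq_nonneg _)) (kk_form P hPs f lam hf w)
  have h5 : 0 ≤ s * ⟪w, w⟫ := mul_nonneg hs.le real_inner_self_nonneg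
  have h6 : ∑ i ∈ F, lam i * ⟪(f i : H), w⟫ ^ 2 ≤ c * X := by
    have := hPQ w
    nlinarith
  have h7 : 0 ≤ ∑ i ∈ F, lam i * (c * t i - ⟪(f i : H), w⟫) ^ 2 :=
    Finset.sum_nonneg fun i _ => mul_nonneg (hlam i) (sq_nonneg _)
  have e8 : ∑ i ∈ F, lam i * (c * t i - ⟪(f i : H), w⟫) ^ 2 =
      c ^ 2 * (∑ i ∈ F, lam i * t i ^ 2) - 2 * c * X + ∑ i ∈ F, lam i * ⟪(f i : H), w⟫ ^ 2 := by
    rw [e1, Finset.mul_sum, Finset.mul_sum, ← Finset.sum_sub_distrib, ← Finset.sum_add_distrib]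
    refine Finset.sum_congr rfl fun k _ => ?_
    ring
  have h9 : 0 ≤ c * (c * (∑ i ∈ F, lam i * t i ^ 2) - X) := by nlinarith
  have := nonneg_of_mul_nonneg_right h9 hc
  linarith

lemma kk_fin (P Q : H →L[ℝ] H) (hPs : ∀ u v, ⟪u, P v⟫ = ⟪P u, v⟫)
    (hQs : ∀ u v, ⟪u, Q v⟫ = ⟪Q u, v⟫)
    (c : ℝ) (hc : 0 < c) (hPQ : ∀ v, ⟪v, P v⟫ ≤ c * ⟪v, Q v⟫)
    (f : HilbertBasis ι ℝ H) (lam : ι → ℝ) (hf : ∀ i, P (f i) = lam i • f i)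
    (hlam : ∀ i, 0 ≤ lam i) (hlam1 : ∀ i, lam i ≤ 1)
    (g : HilbertBasis ι ℝ H) (a : ι → ℝ) (hg : ∀ j, Q (g j) = a j • g j) (ha : ∀ j, 0 ≤ a j)
    (ha1 : ∀ j, a j ≤ 1)
    (s : ℝ) (hs : 0 < s) (y : ι → H) (hy : ∀ i, Q (y i) + s • y i = f i) (F : Finset ι) :
    ∑ i ∈ F, ∑ k ∈ F, lam i * lam k * ⟪(f i : H), y k⟫ ^ 2 ≤
      (1 + c) * ∑ i ∈ F, lam i * (⟪(f i : H), y i⟫ - 1 / (1 + s))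
        + 1 / (1 + s) ^ 2 * ∑ i ∈ F, lam i := by
  classical
  have he : ∀ j, 0 ≤ 1 / (a j + s) - 1 / (1 + s) := by
    intro j
    have : 1/(1+s) ≤ 1/(a j+s) :=
      one_div_le_one_div_of_le (by have := ha j; positivity) (by linarith [ha1 j])
    linarith
  have hff : ∀ i, ⟪(f i : H), (f i : H)⟫ = 1 := by
    intro i
    rw [real_inner_self_eq_norm_sq, f.orthonormal.1 i]; norm_num
  have hS : ∀ i k, HasSum (fun j => ⟪(f i : H), (g j : H)⟫ * ⟪(f k : H), (g j : H)⟫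
      * (1 / (a j + s) - 1 / (1 + s))) (⟪(f i : H), y k⟫ - ⟪(f i : H), (f k : H)⟫ / (1 + s)) :=
    fun i k => kk_res_sum Q hQs g a hg ha s hs (y k) (f k) (f i) (hy k)
  have hS1 : HasSum (fun j => ∑ i ∈ F, ∑ k ∈ F, lam i * lam k * ⟪(f i : H), y k⟫ *
      (⟪(f i : H), (g j : H)⟫ * ⟪(f k : H), (g j : H)⟫ * (1 / (a j + s) - 1 / (1 + s))))
      (∑ i ∈ F, ∑ k ∈ F, lam i * lam k * ⟪(f i : H), y k⟫ *
        (⟪(f i : H), y k⟫ - ⟪(f i : H), (f k : H)⟫ / (1 + s))) :=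
    hasSum_sum fun i _ => hasSum_sum fun k _ => (hS i k).mul_left _
  have hS2 : HasSum (fun j => c * ∑ i ∈ F, lam i *
      (⟪(f i : H), (g j : H)⟫ * ⟪(f i : H), (g j : H)⟫ * (1 / (a j + s) - 1 / (1 + s))))
      (c * ∑ i ∈ F, lam i * (⟪(f i : H), y i⟫ - ⟪(f i : H), (f i : H)⟫ / (1 + s))) :=
    (hasSum_sum fun i _ => (hS i i).mul_left _).mul_left _
  have hle := hasSum_le (fun j => ?_) hS1 hS2
  swap
  · have := mul_le_mul_of_nonneg_right (kk_quad P Q hPs c hc hPQ f lam hf hlam s hs y hy F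
      (fun i => ⟪(f i : H), (g j : H)⟫)) (he j)
    refine le_trans (le_of_eq ?_) (this.trans (le_of_eq ?_))
    · rw [Finset.sum_mul]
      refine Finset.sum_congr rfl fun i _ => ?_
      rw [Finset.sum_mul]
      refine Finset.sum_congr rfl fun k _ => ?_
      ring
    · rw [mul_assoc, Finset.sum_mul]
      congr 1
      refine Finset.sum_congr rfl fun i _ => ?_
      ring
  have e1 : ∑ i ∈ F, ∑ k ∈ F, lam i * lam k * ⟪(f i : H), y k⟫ *
        (⟪(f i : H), y k⟫ - ⟪(f i : H), (f k : H)⟫ / (1 + s)) =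
      ∑ i ∈ F, ∑ k ∈ F, lam i * lam k * ⟪(f i : H), y k⟫ ^ 2
       - ∑ i ∈ F, lam i ^ 2 * ⟪(f i : H), y i⟫ / (1 + s) := by
    rw [← Finset.sum_sub_distrib]
    refine Finset.sum_congr rfl fun i hi => ?_
    have : lam i ^ 2 * ⟪(f i : H), y i⟫ / (1 + s) =
        ∑ k ∈ F, lam i * lam k * ⟪(f i : H), y k⟫ * (⟪(f i : H), (f k : H)⟫ / (1 + s)) := by
      rw [Finset.sum_eq_single i]
      · rw [hff]; ring
      · intro k _ hk
        rw [f.orthonormal.2 hk.symm]; ring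
      · exact fun h => absurd hi h
    rw [this, ← Finset.sum_sub_distrib]
    refine Finset.sum_congr rfl fun k _ => ?_
    ring
  have hr : 0 < 1 / (1 + s) := by positivity
  have hr1 : 1 / (1 + s) ≤ 1 := by rw [div_le_one (by positivity)]; linarith
  have h2 : ∑ i ∈ F, lam i ^ 2 * ⟪(f i : H), y i⟫ / (1 + s) ≤
      ∑ i ∈ F, lam i * (⟪(f i : H), y i⟫ - 1 / (1 + s)) + 1 / (1 + s) ^ 2 * ∑ i ∈ F, lam i := by
    rw [Finset.mul_sum, ← Finset.sum_add_distrib]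
    refine Finset.sum_le_sum fun i _ => ?_
    have hE : 0 ≤ ⟪(f i : H), y i⟫ - 1 / (1 + s) := by
      have := (hS i i).nonneg (fun j => mul_nonneg (mul_self_nonneg _) (he j))
      rwa [hff] at this
    have e : lam i ^ 2 * ⟪(f i : H), y i⟫ / (1 + s) =
       (lam i * lam i) * ((⟪(f i : H), y i⟫ - 1 / (1 + s)) * (1 / (1 + s)))
        + 1 / (1 + s) ^ 2 * (lam i * lam i) := by field_simp; ring
    rw [e]
    have h3 : lam i * lam i ≤ lam i := by nlinarith [hlam i, hlam1 i]
    have h4 : (⟪(f i : H), y i⟫ - 1 / (1 + s)) * (1 / (1 + s)) ≤ ⟪(f i : H), y i⟫ - 1 / (1 + s) := by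
      nlinarith
    refine add_le_add ?_ (mul_le_mul_of_nonneg_left h3 (by positivity))
    exact mul_le_mul h3 h4 (by positivity) (hlam i)
  simp only [hff] at hle
  rw [e1] at hle
  linarith

lemma kk_trace (P Q : H →L[ℝ] H) (hPs : ∀ u v, ⟪u, P v⟫ = ⟪P u, v⟫)
    (hQs : ∀ u v, ⟪u, Q v⟫ = ⟪Q u, v⟫)
    (c : ℝ) (hc : 0 < c) (hPQ : ∀ v, ⟪v, P v⟫ ≤ c * ⟪v, Q v⟫)
    (f : HilbertBasis ι ℝ H) (lam : ι → ℝ) (hf : ∀ i, P (f i) = lam i • f i)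
    (hlam : ∀ i, 0 ≤ lam i) (hlam1 : ∀ i, lam i ≤ 1) (hsl : Summable lam)
    (g : HilbertBasis ι ℝ H) (a : ι → ℝ) (hg : ∀ j, Q (g j) = a j • g j) (ha : ∀ j, 0 ≤ a j)
    (ha1 : ∀ j, a j ≤ 1)
    (s : ℝ) (hs : 0 < s) (y : ι → H) (hy : ∀ i, Q (y i) + s • y i = f i)
    (hE : ∀ i, 0 ≤ ⟪(f i : H), y i⟫ - 1 / (1 + s))
    (hsE : Summable (fun i => lam i * (⟪(f i : H), y i⟫ - 1 / (1 + s)))) (F : Finset ι) :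
    ∑ i ∈ F, lam i * ⟪y i, P (y i)⟫ ≤
      (1 + c) * ∑' i, lam i * (⟪(f i : H), y i⟫ - 1 / (1 + s))
        + 1 / (1 + s) ^ 2 * ∑' i, lam i := by
  classical
  have hS : HasSum (fun k => ∑ i ∈ F, lam i * (lam k * ⟪(f k : H), y i⟫ ^ 2))
      (∑ i ∈ F, lam i * ⟪y i, P (y i)⟫) :=
    hasSum_sum fun i _ => (kk_form P hPs f lam hf (y i)).mul_left _
  refine hasSum_le_of_sum_le hS fun G => ?_
  have hnn : ∀ i k, 0 ≤ lam i * lam k * ⟪(f i : H), y k⟫ ^ 2 :=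
    fun i k => mul_nonneg (mul_nonneg (hlam i) (hlam k)) (sq_nonneg _)
  calc ∑ k ∈ G, ∑ i ∈ F, lam i * (lam k * ⟪(f k : H), y i⟫ ^ 2)
      = ∑ k ∈ G, ∑ i ∈ F, lam k * lam i * ⟪(f k : H), y i⟫ ^ 2 := by
        refine Finset.sum_congr rfl fun k _ => Finset.sum_congr rfl fun i _ => ?_
        ring
    _ ≤ ∑ k ∈ G, ∑ i ∈ F ∪ G, lam k * lam i * ⟪(f k : H), y i⟫ ^ 2 :=
        Finset.sum_le_sum fun k _ => Finset.sum_le_sum_of_subset_of_nonneg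
          Finset.subset_union_left fun i _ _ => hnn k i
    _ ≤ ∑ k ∈ F ∪ G, ∑ i ∈ F ∪ G, lam k * lam i * ⟪(f k : H), y i⟫ ^ 2 :=
        Finset.sum_le_sum_of_subset_of_nonneg Finset.subset_union_right
          fun k _ _ => Finset.sum_nonneg fun i _ => hnn k i
    _ ≤ _ := kk_fin P Q hPs hQs c hc hPQ f lam hf hlam hlam1 g a hg ha ha1 s hs y hy (F ∪ G)
    _ ≤ _ := by
        gcongr
        · exact hsE.sum_le_tsum _ fun i _ => mul_nonneg (hlam i) (hE i)
        · exact hsl.sum_le_tsum _ fun i _ => hlam i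

end resolvent

lemma kk_pair {ι : Type*} (lam : ι → ℝ) (hlam : ∀ i, 0 ≤ lam i) (W : ι → ι → ℝ)
    (hW : ∀ i j, 0 ≤ W i j) (b : ι → ℝ) (hb : ∀ j, 0 ≤ b j) (r : ι → ℝ)
    (hr : ∀ i, HasSum (fun j => W i j * b j) (r i)) (hs : Summable (fun i => lam i * r i)) :
    Summable (fun ij : ι × ι => lam ij.1 * W ij.1 ij.2 * b ij.2) ∧
    ∑' ij : ι × ι, lam ij.1 * W ij.1 ij.2 * b ij.2 = ∑' i, lam i * r i := by
  have h1 : ∀ i, HasSum (fun j => lam i * W i j * b j) (lam i * r i) := by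
    intro i
    simpa only [mul_assoc] using (hr i).mul_left (lam i)
  have hsum : Summable (fun ij : ι × ι => lam ij.1 * W ij.1 ij.2 * b ij.2) := by
    rw [summable_prod_of_nonneg]
    · refine ⟨fun i => (h1 i).summable, ?_⟩
      simpa only [(h1 _).tsum_eq] using hs
    · exact fun ij => mul_nonneg (mul_nonneg (hlam _) (hW _ _)) (hb _)
  refine ⟨hsum, ?_⟩
  rw [hsum.tsum_prod' fun i => (h1 i).summable]
  exact tsum_congr fun i => (h1 i).tsum_eq

section cov
variable {d : ℕ} {H : Type*} [NormedAddCommGroup H] [InnerProductSpace ℝ H] [CompleteSpace H]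

lemma kk_cov_apply (φ : EuclideanSpace ℝ (Fin d) → H) (hφc : Continuous φ) (h1 : ∀ x, ‖φ x‖ = 1)
    (p : Measure (EuclideanSpace ℝ (Fin d))) [IsProbabilityMeasure p] (u v : H) :
    ⟪u, covOp φ p v⟫ = ∫ x, ⟪φ x, u⟫ * ⟪φ x, v⟫ ∂p := by
  have hcont : Continuous (fun x => rankOne (φ x) (φ x)) := by
    unfold rankOne
    have h2 : Continuous (fun x => (innerSL ℝ (φ x) : H →L[ℝ] ℝ)) := (innerSL ℝ).continuous.comp hφc
    exact ((ContinuousLinearMap.smulRightL ℝ H H).continuous.comp h2).clm_apply hφc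
  have hint : Integrable (fun x => rankOne (φ x) (φ x)) p := by
    refine Integrable.of_bound hcont.aestronglyMeasurable 1 (Filter.Eventually.of_forall fun x => ?_)
    simp [rankOne, h1]
  have hint2 : Integrable (fun x => rankOne (φ x) (φ x) v) p := hint.apply_continuousLinearMap v
  unfold covOp
  rw [ContinuousLinearMap.integral_apply hint, ← integral_inner hint2]
  refine integral_congr_ae (Filter.Eventually.of_forall fun x => ?_)
  simp [rankOne, inner_smul_right, real_inner_comm, mul_comm]

lemma kk_int_sq (φ : EuclideanSpace ℝ (Fin d) → H) (hφc : Continuous φ) (h1 : ∀ x, ‖φ x‖ = 1)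
    (p : Measure (EuclideanSpace ℝ (Fin d))) [IsFiniteMeasure p] (v : H) :
    Integrable (fun x => ⟪φ x, v⟫ * ⟪φ x, v⟫) p := by
  refine Integrable.of_bound (by fun_prop) (‖v‖ * ‖v‖) (Filter.Eventually.of_forall fun x => ?_)
  have := abs_real_inner_le_norm (φ x) v
  rw [h1, one_mul] at this
  rw [norm_mul]
  exact mul_le_mul this this (norm_nonneg _) (norm_nonneg _)

lemma kk_cov_nonneg (φ : EuclideanSpace ℝ (Fin d) → H) (hφc : Continuous φ) (h1 : ∀ x, ‖φ x‖ = 1)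
    (p : Measure (EuclideanSpace ℝ (Fin d))) [IsProbabilityMeasure p] (v : H) :
    0 ≤ ⟪v, covOp φ p v⟫ := by
  rw [kk_cov_apply φ hφc h1]
  exact integral_nonneg fun x => mul_self_nonneg _

lemma kk_cov_le (φ : EuclideanSpace ℝ (Fin d) → H) (hφc : Continuous φ) (h1 : ∀ x, ‖φ x‖ = 1)
    (p : Measure (EuclideanSpace ℝ (Fin d))) [IsProbabilityMeasure p] (v : H) :
    ⟪v, covOp φ p v⟫ ≤ ‖v‖ ^ 2 := by
  rw [kk_cov_apply φ hφc h1]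
  have : ∫ x, ⟪φ x, v⟫ * ⟪φ x, v⟫ ∂p ≤ ∫ x, ‖v‖ ^ 2 ∂p := by
    refine integral_mono (kk_int_sq φ hφc h1 p v) (integrable_const _) fun x => ?_
    have := abs_real_inner_le_norm (φ x) v
    rw [h1, one_mul] at this
    have := abs_le.mp this
    simp only
    nlinarith
  simpa using this

lemma kk_cov_sym (φ : EuclideanSpace ℝ (Fin d) → H) (hφc : Continuous φ) (h1 : ∀ x, ‖φ x‖ = 1)
    (p : Measure (EuclideanSpace ℝ (Fin d))) [IsProbabilityMeasure p] (u v : H) :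
    ⟪u, covOp φ p v⟫ = ⟪covOp φ p u, v⟫ := by
  rw [real_inner_comm v, kk_cov_apply φ hφc h1, kk_cov_apply φ hφc h1]
  simp only [mul_comm]

lemma kk_cov_dom (φ : EuclideanSpace ℝ (Fin d) → H) (hφc : Continuous φ) (h1 : ∀ x, ‖φ x‖ = 1)
    (p q : Measure (EuclideanSpace ℝ (Fin d))) [IsProbabilityMeasure p] [IsProbabilityMeasure q]
    (c : ℝ) (hc : 0 < c) (hpq : p ≪ q) (hratio : ∀ᵐ x ∂q, p.rnDeriv q x ≤ ENNReal.ofReal c) (v : H) :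
    ⟪v, covOp φ p v⟫ ≤ c * ⟪v, covOp φ q v⟫ := by
  have hle : p ≤ ENNReal.ofReal c • q := by
    have : p.HaveLebesgueDecomposition q := Measure.haveLebesgueDecomposition_of_sigmaFinite p q
    calc p = q.withDensity (p.rnDeriv q) := (Measure.withDensity_rnDeriv_eq p q hpq).symm
      _ ≤ q.withDensity (fun _ => ENNReal.ofReal c) := withDensity_mono hratio
      _ = _ := withDensity_const _
  have hint : Integrable (fun x => ⟪φ x, v⟫ * ⟪φ x, v⟫) (ENNReal.ofReal c • q) :=
    (kk_int_sq φ hφc h1 q v).smul_measure ENNReal.ofReal_ne_top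
  have := integral_mono_measure hle
    (Filter.Eventually.of_forall fun x => mul_self_nonneg _) hint
  rw [integral_smul_measure, ENNReal.toReal_ofReal hc.le, smul_eq_mul] at this
  rw [kk_cov_apply φ hφc h1, kk_cov_apply φ hφc h1]
  exact this

lemma kk_cov_trace (φ : EuclideanSpace ℝ (Fin d) → H) (hφc : Continuous φ) (h1 : ∀ x, ‖φ x‖ = 1)
    (p : Measure (EuclideanSpace ℝ (Fin d))) [IsProbabilityMeasure p]
    {ι : Type*} (f : HilbertBasis ι ℝ H) (lam : ι → ℝ)
    (hf : ∀ i, covOp φ p (f i) = lam i • f i) : HasSum lam 1 := by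
  have hlam : ∀ i, lam i = ∫ x, ⟪φ x, (f i : H)⟫ * ⟪φ x, (f i : H)⟫ ∂p := by
    intro i
    rw [← kk_cov_apply φ hφc h1, hf, real_inner_smul_right, real_inner_self_eq_norm_sq,
      f.orthonormal.1 i]; simp
  have hpars : ∀ x, HasSum (fun i => ⟪φ x, (f i : H)⟫ * ⟪φ x, (f i : H)⟫) 1 := by
    intro x
    have := f.hasSum_inner_mul_inner (φ x) (φ x)
    rw [real_inner_self_eq_norm_sq, h1, one_pow] at this
    refine kk_hasSum_congr (fun i => ?_) this
    rw [real_inner_comm (φ x) (f i)]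
  set J : Set ι := ⋃ n : ℕ, Function.support
    (fun i => ⟪φ (TopologicalSpace.denseSeq _ n), (f i : H)⟫ * ⟪φ (TopologicalSpace.denseSeq _ n), (f i : H)⟫) with hJ
  have hJc : J.Countable := Set.countable_iUnion fun n => (hpars _).summable.countable_support
  have : Countable J := hJc.to_subtype
  have hJ0 : ∀ i ∉ J, ∀ x, ⟪φ x, (f i : H)⟫ = 0 := by
    intro i hi
    have hz : (fun x => ⟪φ x, (f i : H)⟫) = fun _ => 0 := by
      refine Continuous.ext_on (TopologicalSpace.denseRange_denseSeq _) (by fun_prop) (by fun_prop) ?_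
      rintro _ ⟨n, rfl⟩
      by_contra hne
      exact hi (Set.mem_iUnion.mpr ⟨n, mul_ne_zero hne hne⟩)
    exact fun x => congrFun hz x
  have hsubJ : ∀ x, HasSum (fun i : J => ⟪φ x, (f i : H)⟫ * ⟪φ x, (f i : H)⟫) 1 := by
    intro x
    refine (hasSum_subtype_iff_of_support_subset (f := fun i => ⟪φ x, (f i : H)⟫ * ⟪φ x, (f i : H)⟫) ?_).mpr (hpars x)
    intro i hi
    by_contra hn
    exact hi (by simp [hJ0 i hn x])
  have hl : ∑' i : J, ENNReal.ofReal (lam i) = 1 := by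
    have e : ∀ i : J, ENNReal.ofReal (lam i) =
        ∫⁻ x, ENNReal.ofReal (⟪φ x, (f i : H)⟫ * ⟪φ x, (f i : H)⟫) ∂p := by
      intro i
      rw [hlam, ofReal_integral_eq_lintegral_ofReal (kk_int_sq φ hφc h1 p _)]
      exact Filter.Eventually.of_forall fun x => mul_self_nonneg _
    simp only [e]
    rw [← lintegral_tsum (fun i => by fun_prop)]
    have e2 : ∀ x, ∑' i : J, ENNReal.ofReal (⟪φ x, (f i : H)⟫ * ⟪φ x, (f i : H)⟫) = 1 := by
      intro x
      rw [← ENNReal.ofReal_tsum_of_nonneg (fun i => mul_self_nonneg _) (hsubJ x).summable,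
        (hsubJ x).tsum_eq, ENNReal.ofReal_one]
    simp [e2]
  have hlam0 : ∀ i, 0 ≤ lam i := fun i => by
    rw [hlam]; exact integral_nonneg fun x => mul_self_nonneg _
  have hsJ : HasSum (fun i : J => lam i) 1 := by
    have := ENNReal.hasSum_toReal (f := fun i : J => ENNReal.ofReal (lam i)) (by rw [hl]; simp)
    rw [← ENNReal.tsum_toReal_eq (fun i : J => ENNReal.ofReal_ne_top (r := lam i)), hl,
      ENNReal.toReal_one] at this
    simpa only [ENNReal.toReal_ofReal (hlam0 _)] using this
  refine (hasSum_subtype_iff_of_support_subset (f := lam) ?_).mp hsJ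
  intro i hi
  by_contra hn
  exact hi (by rw [hlam]; simp [hJ0 i hn])

end cov

section assembly
variable {H : Type*} [NormedAddCommGroup H] [InnerProductSpace ℝ H] {ι : Type*}

lemma kk_eig_le (A : H →L[ℝ] H) (hA1 : ∀ v, ⟪v, A v⟫ ≤ ‖v‖ ^ 2)
    (g : HilbertBasis ι ℝ H) (a : ι → ℝ) (hg : ∀ j, A (g j) = a j • g j) (j : ι) : a j ≤ 1 := by
  have := hA1 (g j)
  rw [hg, real_inner_smul_right, real_inner_self_eq_norm_sq, g.orthonormal.1 j] at this
  simpa using this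

lemma kk_row (f g : HilbertBasis ι ℝ H) (i : ι) :
    HasSum (fun j => ⟪(f i : H), (g j : H)⟫ ^ 2) 1 := by
  have := g.hasSum_inner_mul_inner (f i) (f i)
  rw [real_inner_self_eq_norm_sq, f.orthonormal.1 i, one_pow] at this
  refine kk_hasSum_congr (fun j => ?_) this
  rw [real_inner_comm (f i : H) (g j)]; ring

lemma kk_ff (f : HilbertBasis ι ℝ H) (i : ι) : ⟪(f i : H), (f i : H)⟫ = 1 := by
  rw [real_inner_self_eq_norm_sq, f.orthonormal.1 i]; norm_num

lemma kk_e_nonneg (a s : ℝ) (ha : 0 ≤ a) (ha1 : a ≤ 1) (hs : 0 < s) :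
    0 ≤ 1 / (a + s) - 1 / (1 + s) := by
  have : 1/(1+s) ≤ 1/(a+s) := one_div_le_one_div_of_le (by positivity) (by linarith)
  linarith

lemma kk_tau (A : H →L[ℝ] H) (hsym : ∀ u v, ⟪u, A v⟫ = ⟪A u, v⟫)
    (f : HilbertBasis ι ℝ H) (lam : ι → ℝ) (hlam : ∀ i, 0 ≤ lam i) (hsl : Summable lam)
    (g : HilbertBasis ι ℝ H) (a : ι → ℝ) (hg : ∀ j, A (g j) = a j • g j) (ha : ∀ j, 0 ≤ a j)
    (ha1 : ∀ j, a j ≤ 1)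
    (s : ℝ) (hs : 0 < s) (y : ι → H) (hy : ∀ i, A (y i) + s • y i = f i) :
    (∀ i, 0 ≤ ⟪(f i : H), y i⟫ - 1 / (1 + s)) ∧
    Summable (fun i => lam i * (⟪(f i : H), y i⟫ - 1 / (1 + s))) ∧
    Summable (fun ij : ι × ι => lam ij.1 * ⟪(f ij.1 : H), (g ij.2 : H)⟫ ^ 2 *
      (1 / (a ij.2 + s) - 1 / (1 + s))) ∧
    ∑' ij : ι × ι, lam ij.1 * ⟪(f ij.1 : H), (g ij.2 : H)⟫ ^ 2 *
      (1 / (a ij.2 + s) - 1 / (1 + s)) = ∑' i, lam i * (⟪(f i : H), y i⟫ - 1 / (1 + s)) := by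
  have he := fun j => kk_e_nonneg (a j) s (ha j) (ha1 j) hs
  have hrow : ∀ i, HasSum (fun j => ⟪(f i : H), (g j : H)⟫ ^ 2 * (1 / (a j + s) - 1 / (1 + s)))
      (⟪(f i : H), y i⟫ - 1 / (1 + s)) := by
    intro i
    have := kk_res_sum A hsym g a hg ha s hs (y i) (f i) (f i) (hy i)
    rw [kk_ff] at this
    exact kk_hasSum_congr (fun j => by ring) this
  have h0 : ∀ i, 0 ≤ ⟪(f i : H), y i⟫ - 1 / (1 + s) := fun i =>
    (hrow i).nonneg fun j => mul_nonneg (sq_nonneg _) (he j)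
  have hb : ∀ i, ⟪(f i : H), y i⟫ - 1 / (1 + s) ≤ 1 * (1 / s) := by
    intro i
    refine hasSum_le (fun j => ?_) (hrow i) ((kk_row f g i).mul_right (1 / s))
    refine mul_le_mul_of_nonneg_left ?_ (sq_nonneg _)
    have h1 : 1 / (a j + s) ≤ 1 / s := one_div_le_one_div_of_le hs (by linarith [ha j])
    have : 0 ≤ 1 / (1 + s) := by positivity
    linarith
  have hsum : Summable (fun i => lam i * (⟪(f i : H), y i⟫ - 1 / (1 + s))) :=
    Summable.of_nonneg_of_le (fun i => mul_nonneg (hlam i) (h0 i))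
      (fun i => mul_le_mul_of_nonneg_left (hb i) (hlam i)) (hsl.mul_right _)
  obtain ⟨k1, k2⟩ := kk_pair lam hlam (fun i j => ⟪(f i : H), (g j : H)⟫ ^ 2)
    (fun _ _ => sq_nonneg _) (fun j => 1 / (a j + s) - 1 / (1 + s)) he _ hrow hsum
  exact ⟨h0, hsum, k1, k2⟩

lemma kk_omega (A : H →L[ℝ] H) (hsym : ∀ u v, ⟪u, A v⟫ = ⟪A u, v⟫)
    (f : HilbertBasis ι ℝ H) (lam : ι → ℝ) (hlam : ∀ i, 0 ≤ lam i) (hsl : Summable lam)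
    (g : HilbertBasis ι ℝ H) (a : ι → ℝ) (hg : ∀ j, A (g j) = a j • g j) (ha : ∀ j, 0 ≤ a j)
    (s : ℝ) (hs : 0 < s) (y : ι → H) (hy : ∀ i, A (y i) + s • y i = f i) :
    Summable (fun i => lam i * ⟪y i, A (y i)⟫) ∧
    Summable (fun ij : ι × ι => lam ij.1 * ⟪(f ij.1 : H), (g ij.2 : H)⟫ ^ 2 *
      (a ij.2 / (a ij.2 + s) ^ 2)) ∧
    ∑' ij : ι × ι, lam ij.1 * ⟪(f ij.1 : H), (g ij.2 : H)⟫ ^ 2 *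
      (a ij.2 / (a ij.2 + s) ^ 2) = ∑' i, lam i * ⟪y i, A (y i)⟫ := by
  have he : ∀ j, 0 ≤ a j / (a j + s) ^ 2 := fun j => div_nonneg (ha j) (sq_nonneg _)
  have hrow := fun i => kk_res_sq A hsym g a hg ha s hs (y i) (f i) (hy i)
  have h0 : ∀ i, 0 ≤ ⟪y i, A (y i)⟫ := fun i =>
    (hrow i).nonneg fun j => mul_nonneg (sq_nonneg _) (he j)
  have hb : ∀ i, ⟪y i, A (y i)⟫ ≤ 1 * (1 / s) := by
    intro i
    refine hasSum_le (fun j => ?_) (hrow i) ((kk_row f g i).mul_right (1 / s))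
    refine mul_le_mul_of_nonneg_left ?_ (sq_nonneg _)
    have := ha j
    rw [div_le_div_iff₀ (by positivity) hs]
    nlinarith
  have hsum : Summable (fun i => lam i * ⟪y i, A (y i)⟫) :=
    Summable.of_nonneg_of_le (fun i => mul_nonneg (hlam i) (h0 i))
      (fun i => mul_le_mul_of_nonneg_left (hb i) (hlam i)) (hsl.mul_right _)
  obtain ⟨k1, k2⟩ := kk_pair lam hlam (fun i j => ⟪(f i : H), (g j : H)⟫ ^ 2)
    (fun _ _ => sq_nonneg _) (fun j => a j / (a j + s) ^ 2) he _ hrow hsum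
  exact ⟨hsum, k1, k2⟩

/-- the two main inequalities. -/
lemma kk_main [CompleteSpace H] (P Q : H →L[ℝ] H) (hPs : ∀ u v, ⟪u, P v⟫ = ⟪P u, v⟫)
    (hQs : ∀ u v, ⟪u, Q v⟫ = ⟪Q u, v⟫)
    (hP0 : ∀ v, 0 ≤ ⟪v, P v⟫) (hQ0 : ∀ v, 0 ≤ ⟪v, Q v⟫)
    (hP1 : ∀ v, ⟪v, P v⟫ ≤ ‖v‖ ^ 2) (hQ1 : ∀ v, ⟪v, Q v⟫ ≤ ‖v‖ ^ 2)
    (c : ℝ) (hc : 0 < c) (hPQ : ∀ v, ⟪v, P v⟫ ≤ c * ⟪v, Q v⟫)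
    (α : ℝ) (hα0 : 0 < α) (hα1 : α < 1)
    (f : HilbertBasis ι ℝ H) (lam : ι → ℝ) (hf : ∀ i, P (f i) = lam i • f i)
    (hlam : ∀ i, 0 ≤ lam i) (hsl : Summable lam)
    (g : HilbertBasis ι ℝ H) (a : ι → ℝ) (hg : ∀ j, Q (g j) = a j • g j) (ha : ∀ j, 0 ≤ a j)
    (h : HilbertBasis ι ℝ H) (b : ι → ℝ) (hh : ∀ j, (α • P + (1 - α) • Q) (h j) = b j • h j)
    (hb : ∀ j, 0 ≤ b j)
    (hza : ∀ i j, lam i * ⟪(f i : H), (g j : H)⟫ ^ 2 ≠ 0 → 0 < a j)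
    (hzb : ∀ i j, lam i * ⟪(f i : H), (h j : H)⟫ ^ 2 ≠ 0 → 0 < b j)
    (hsE : Summable (fun i => lam i * -Real.log (lam i)))
    (hsT : Summable (fun ij : ι × ι => lam ij.1 * ⟪(f ij.1 : H), (g ij.2 : H)⟫ ^ 2 *
      -Real.log (a ij.2)))
    (hsS : Summable (fun ij : ι × ι => lam ij.1 * ⟪(f ij.1 : H), (h ij.2 : H)⟫ ^ 2 *
      -Real.log (b ij.2))) :
    (∑' ij : ι × ι, lam ij.1 * ⟪(f ij.1 : H), (g ij.2 : H)⟫ ^ 2 * -Real.log (a ij.2))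
      - (∑' ij : ι × ι, lam ij.1 * ⟪(f ij.1 : H), (h ij.2 : H)⟫ ^ 2 * -Real.log (b ij.2))
      ≤ α * (1 + c) * (∑' ij : ι × ι, lam ij.1 * ⟪(f ij.1 : H), (g ij.2 : H)⟫ ^ 2 *
        -Real.log (a ij.2)) ∧
    (∑' ij : ι × ι, lam ij.1 * ⟪(f ij.1 : H), (h ij.2 : H)⟫ ^ 2 * -Real.log (b ij.2))
      ≤ α * (∑' i, lam i * -Real.log (lam i)) +
       (1 - α) * (∑' ij : ι × ι, lam ij.1 * ⟪(f ij.1 : H), (g ij.2 : H)⟫ ^ 2 *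
        -Real.log (a ij.2)) := by
  set M : H →L[ℝ] H := α • P + (1 - α) • Q with hM
  have hMi : ∀ u v, ⟪u, M v⟫ = α * ⟪u, P v⟫ + (1 - α) * ⟪u, Q v⟫ := by
    intro u v
    simp [hM, inner_add_right, real_inner_smul_right]
  have hMs : ∀ u v, ⟪u, M v⟫ = ⟪M u, v⟫ := by
    intro u v
    rw [real_inner_comm v, hMi, hMi, hPs, hQs, real_inner_comm v, real_inner_comm v]
  have hM0 : ∀ v, 0 ≤ ⟪v, M v⟫ := by
    intro v
    rw [hMi]
    exact add_nonneg (mul_nonneg hα0.le (hP0 v)) (mul_nonneg (by linarith) (hQ0 v))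
  have hM1 : ∀ v, ⟪v, M v⟫ ≤ ‖v‖ ^ 2 := by
    intro v
    rw [hMi]
    nlinarith [hP1 v, hQ1 v]
  have hlam1 := kk_eig_le P hP1 f lam hf
  have ha1 := kk_eig_le Q hQ1 g a hg
  have hb1 := kk_eig_le M hM1 h b hh
  -- integrals
  have hW : ∀ (g' : HilbertBasis ι ℝ H),
      Summable (fun ij : ι × ι => lam ij.1 * ⟪(f ij.1 : H), (g' ij.2 : H)⟫ ^ 2) ∧
      ∑' ij : ι × ι, lam ij.1 * ⟪(f ij.1 : H), (g' ij.2 : H)⟫ ^ 2 = ∑' i, lam i := by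
    intro g'
    have := kk_pair lam hlam (fun i j => ⟪(f i : H), (g' j : H)⟫ ^ 2)
      (fun _ _ => sq_nonneg _) (fun j => 1) (fun _ => zero_le_one) (fun _ => 1)
      (fun i => by simpa using kk_row f g' i) (by simpa using hsl)
    simpa using this
  have hW0 : ∀ (g' : HilbertBasis ι ℝ H) (ij : ι × ι),
      0 ≤ lam ij.1 * ⟪(f ij.1 : H), (g' ij.2 : H)⟫ ^ 2 :=
    fun g' ij => mul_nonneg (hlam _) (sq_nonneg _)
  -- resolvents
  have hRQ : ∀ s : ℝ, 0 < s → ∃ y : ι → H, ∀ i, Q (y i) + s • y i = f i := by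
    intro s hs
    choose y hy using fun i => kk_resolvent Q hQ0 s hs (f i)
    exact ⟨y, hy⟩
  have hRM : ∀ s : ℝ, 0 < s → ∃ y : ι → H, ∀ i, M (y i) + s • y i = f i := by
    intro s hs
    choose y hy using fun i => kk_resolvent M hM0 s hs (f i)
    exact ⟨y, hy⟩
  obtain ⟨iT, vT⟩ := kk_tonelli _ (hW0 g) (hW g).1
    (fun ij s => 1 / (a ij.2 + s) - 1 / (1 + s)) (fun ij => -Real.log (a ij.2))
    (fun ij _ s hs => kk_e_nonneg _ s (ha _) (ha1 _) hs)
    (fun ij hn => kk_log_int _ (hza _ _ hn) (ha1 _)) hsT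
    (fun s hs => by
      obtain ⟨y, hy⟩ := hRQ s hs
      exact (kk_tau Q hQs f lam hlam hsl g a hg ha ha1 s hs y hy).2.2.1)
  obtain ⟨iS, vS⟩ := kk_tonelli _ (hW0 h) (hW h).1
    (fun ij s => 1 / (b ij.2 + s) - 1 / (1 + s)) (fun ij => -Real.log (b ij.2))
    (fun ij _ s hs => kk_e_nonneg _ s (hb _) (hb1 _) hs)
    (fun ij hn => kk_log_int _ (hzb _ _ hn) (hb1 _)) hsS
    (fun s hs => by
      obtain ⟨y, hy⟩ := hRM s hs
      exact (kk_tau M hMs f lam hlam hsl h b hh hb hb1 s hs y hy).2.2.1)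
  have hsl1 : Summable (fun x : ι × ι => lam x.1 * ⟪(f x.1 : H), (g x.2 : H)⟫ ^ 2 * (1 : ℝ)) := by
    simpa using (hW g).1
  obtain ⟨iW, vW⟩ := kk_tonelli _ (hW0 g) (hW g).1
    (fun ij s => a ij.2 / (a ij.2 + s) ^ 2) (fun ij => 1)
    (fun ij _ s hs => div_nonneg (ha _) (sq_nonneg _))
    (fun ij hn => kk_sq_int _ (hza _ _ hn)) hsl1
    (fun s hs => by
      obtain ⟨y, hy⟩ := hRQ s hs
      exact (kk_omega Q hQs f lam hlam hsl g a hg ha s hs y hy).2.1)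
  simp only [mul_one, (hW g).2] at vW
  have hpsE : ∀ s, 0 < s → Summable (fun i => lam i * (1 / (lam i + s) - 1 / (1 + s))) := by
    intro s hs
    refine Summable.of_nonneg_of_le
      (fun i => mul_nonneg (hlam i) (kk_e_nonneg _ s (hlam i) (hlam1 i) hs))
      (fun i => mul_le_mul_of_nonneg_left ?_ (hlam i)) (hsl.mul_right (1 / s))
    have h1 : 1 / (lam i + s) ≤ 1 / s := one_div_le_one_div_of_le hs (by linarith [hlam i])
    have : 0 ≤ 1 / (1 + s) := by positivity
    linarith
  obtain ⟨iE, vE⟩ := kk_tonelli lam hlam hsl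
    (fun i s => 1 / (lam i + s) - 1 / (1 + s)) (fun i => -Real.log (lam i))
    (fun i _ s hs => kk_e_nonneg _ s (hlam i) (hlam1 i) hs)
    (fun i hn => kk_log_int _ (lt_of_le_of_ne (hlam i) hn.symm) (hlam1 i)) hsE hpsE
  obtain ⟨i1, v1⟩ := kk_sq_int 1 one_pos
  constructor
  · -- first inequality
    have key : ∀ s ∈ Set.Ioi (0:ℝ),
        (∑' ij : ι × ι, lam ij.1 * ⟪(f ij.1 : H), (g ij.2 : H)⟫ ^ 2 * (1 / (a ij.2 + s) - 1 / (1 + s)))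
        - (∑' ij : ι × ι, lam ij.1 * ⟪(f ij.1 : H), (h ij.2 : H)⟫ ^ 2 * (1 / (b ij.2 + s) - 1 / (1 + s)))
        ≤ α * (1 + c) * (∑' ij : ι × ι, lam ij.1 * ⟪(f ij.1 : H), (g ij.2 : H)⟫ ^ 2 * (1 / (a ij.2 + s) - 1 / (1 + s)))
          + (α * (∑' i, lam i) * (1 / (1 + s) ^ 2)
          - α * (∑' ij : ι × ι, lam ij.1 * ⟪(f ij.1 : H), (g ij.2 : H)⟫ ^ 2 * (a ij.2 / (a ij.2 + s) ^ 2))) := by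
      intro s hs
      obtain ⟨y, hy⟩ := hRQ s hs
      obtain ⟨m, hm⟩ := hRM s hs
      obtain ⟨q0, q1, q2, q3⟩ := kk_tau Q hQs f lam hlam hsl g a hg ha ha1 s hs y hy
      obtain ⟨m0, m1, m2, m3⟩ := kk_tau M hMs f lam hlam hsl h b hh hb hb1 s hs m hm
      obtain ⟨w1, w2, w3⟩ := kk_omega Q hQs f lam hlam hsl g a hg ha s hs y hy
      rw [q3, m3, w3]
      have htr := kk_trace P Q hPs hQs c hc hPQ f lam hf hlam hlam1 hsl g a hg ha ha1 s hs y hy q0 q1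
      have hnn : ∀ i, 0 ≤ lam i * ⟪y i, P (y i)⟫ := fun i => mul_nonneg (hlam i) (hP0 _)
      have hsP : Summable (fun i => lam i * ⟪y i, P (y i)⟫) := summable_of_sum_le hnn htr
      have htP := Real.tsum_le_of_sum_le hnn htr
      have hi : ∀ i, lam i * (⟪(f i : H), y i⟫ - 1 / (1 + s)) - lam i * (⟪(f i : H), m i⟫ - 1 / (1 + s))
          ≤ α * (lam i * ⟪y i, P (y i)⟫ - lam i * ⟪y i, Q (y i)⟫) := by
        intro i
        have hv := kk_var M hMs hM0 s hs (m i) (f i) (y i) (hm i)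
        rw [hMi] at hv
        have e : ⟪(f i : H), y i⟫ = ⟪y i, Q (y i)⟫ + s * ⟪y i, y i⟫ := by
          rw [← real_inner_smul_right, ← inner_add_right, hy, real_inner_comm]
        have : ⟪(f i : H), y i⟫ - ⟪(f i : H), m i⟫ ≤ α * (⟪y i, P (y i)⟫ - ⟪y i, Q (y i)⟫) := by
          linarith
        have := mul_le_mul_of_nonneg_left this (hlam i)
        linarith
      have := (q1.sub m1).tsum_le_tsum hi ((hsP.sub w1).mul_left α)
      rw [q1.tsum_sub m1, tsum_mul_left, hsP.tsum_sub w1] at this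
      have := mul_le_mul_of_nonneg_left htP hα0.le
      linarith
    have i2 : IntegrableOn (fun s : ℝ => α * (∑' i, lam i) * (1 / (1 + s) ^ 2)) (Set.Ioi 0) :=
      i1.const_mul _
    have := setIntegral_mono_on (iT.sub iS)
      ((iT.const_mul (α * (1 + c))).add (i2.sub (iW.const_mul α))) measurableSet_Ioi key
    rw [integral_sub' iT iS, integral_add' (iT.const_mul (α * (1 + c))) (i2.sub (iW.const_mul α)),
      integral_sub' i2 (iW.const_mul α), integral_const_mul, integral_const_mul, integral_const_mul,
      vT, vS, vW, v1] at this
    linarith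
  · have key : ∀ s ∈ Set.Ioi (0:ℝ),
        (∑' ij : ι × ι, lam ij.1 * ⟪(f ij.1 : H), (h ij.2 : H)⟫ ^ 2 * (1 / (b ij.2 + s) - 1 / (1 + s)))
        ≤ α * (∑' i, lam i * (1 / (lam i + s) - 1 / (1 + s))) +
         (1 - α) * (∑' ij : ι × ι, lam ij.1 * ⟪(f ij.1 : H), (g ij.2 : H)⟫ ^ 2 * (1 / (a ij.2 + s) - 1 / (1 + s))) := by
      intro s hs
      have hs' : 0 < s := hs
      obtain ⟨y, hy⟩ := hRQ s hs
      obtain ⟨m, hm⟩ := hRM s hs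
      obtain ⟨q0, q1, q2, q3⟩ := kk_tau Q hQs f lam hlam hsl g a hg ha ha1 s hs y hy
      obtain ⟨m0, m1, m2, m3⟩ := kk_tau M hMs f lam hlam hsl h b hh hb hb1 s hs m hm
      rw [q3, m3]
      have hi : ∀ i, lam i * (⟪(f i : H), m i⟫ - 1 / (1 + s)) ≤
          α * (lam i * (1 / (lam i + s) - 1 / (1 + s))) +
          (1 - α) * (lam i * (⟪(f i : H), y i⟫ - 1 / (1 + s))) := by
        intro i
        have hp : 0 < lam i + s := by have := hlam i; positivity
        have hy' : P ((1 / (lam i + s)) • (f i : H)) + s • ((1 / (lam i + s)) • (f i : H)) = f i := by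
          rw [map_smul, hf, smul_smul, smul_smul, ← add_smul]
          have : 1 / (lam i + s) * lam i + s * (1 / (lam i + s)) = 1 := by field_simp
          rw [this, one_smul]
        have hv1 := kk_var P hPs hP0 s hs _ (f i) (m i) hy'
        rw [real_inner_smul_right, kk_ff, mul_one] at hv1
        have hv2 := kk_var Q hQs hQ0 s hs (y i) (f i) (m i) (hy i)
        have e : ⟪(f i : H), m i⟫ = ⟪m i, M (m i)⟫ + s * ⟪m i, m i⟫ := by
          rw [← real_inner_smul_right, ← inner_add_right, hm, real_inner_comm]
        rw [hMi] at e
        have hv1' := mul_le_mul_of_nonneg_left hv1 hα0.le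
        have hv2' := mul_le_mul_of_nonneg_left hv2 (by linarith : 0 ≤ 1 - α)
        have : ⟪(f i : H), m i⟫ ≤ α * (1 / (lam i + s)) + (1 - α) * ⟪(f i : H), y i⟫ := by
          linarith
        have := mul_le_mul_of_nonneg_left this (hlam i)
        linarith
      have := m1.tsum_le_tsum hi (((hpsE s hs).mul_left α).add (q1.mul_left (1 - α)))
      rwa [((hpsE s hs).mul_left α).tsum_add (q1.mul_left (1 - α)), tsum_mul_left,
        tsum_mul_left] at this
    have := setIntegral_mono_on iS ((iE.const_mul α).add (iT.const_mul (1 - α))) measurableSet_Ioi key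
    rwa [integral_add' (iE.const_mul α) (iT.const_mul (1 - α)), integral_const_mul,
      integral_const_mul, vE, vT, vS] at this

end assembly

section final
variable {H : Type*} [NormedAddCommGroup H] [InnerProductSpace ℝ H] {ι : Type*}

/-- a vanishing quadratic form kills all weights. -/
lemma kk_kill (P : H →L[ℝ] H) (hPs : ∀ u v, ⟪u, P v⟫ = ⟪P u, v⟫)
    (f : HilbertBasis ι ℝ H) (lam : ι → ℝ) (hf : ∀ i, P (f i) = lam i • f i)
    (hlam : ∀ i, 0 ≤ lam i) (v : H) (hv : ⟪v, P v⟫ ≤ 0) (i : ι) :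
    lam i * ⟪(f i : H), v⟫ ^ 2 = 0 := by
  have h0 : ∀ i, 0 ≤ lam i * ⟪(f i : H), v⟫ ^ 2 := fun i => mul_nonneg (hlam i) (sq_nonneg _)
  have := le_hasSum (kk_form P hPs f lam hf v) i (fun j _ => h0 j)
  exact le_antisymm (this.trans hv) (h0 i)

lemma kk_term (l a w : ℝ) (hl : 0 ≤ l) (hw : 0 ≤ w) (hz : l * w ≠ 0 → 0 < a) :
    l * Real.log (l / a) * w = l * w * -Real.log a - l * -Real.log l * w * 1 := by
  by_cases hlw : l * w = 0
  · rcases mul_eq_zero.mp hlw with h | h <;> simp [h]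
  · have ha := hz hlw
    have hl' : l ≠ 0 := fun h => hlw (by simp [h])
    rw [Real.log_div hl' ha.ne']
    ring

lemma kk_klein_term (l a w : ℝ) (hl : 0 ≤ l) (ha0 : 0 ≤ a) (hw : 0 ≤ w) (hz : l * w ≠ 0 → 0 < a) :
    l * w * 1 - a * w * 1 ≤ l * Real.log (l / a) * w := by
  by_cases hlw : l * w = 0
  · have : 0 ≤ a * w := mul_nonneg ha0 hw
    have e : l * Real.log (l / a) * w = 0 := by
      rcases mul_eq_zero.mp hlw with h | h <;> simp [h]
    rw [e]; linarith
  · have ha := hz hlw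
    have hl' : 0 < l := lt_of_le_of_ne hl fun h => hlw (by simp [← h])
    have h1 := Real.log_le_sub_one_of_pos (div_pos ha hl')
    have h2 : Real.log (l / a) = - Real.log (a / l) := by
      rw [← Real.log_inv, inv_div]
    have h3 : l * (1 - a / l) = l - a := by field_simp
    have h4 : l - a ≤ l * Real.log (l / a) := by
      rw [← h3, h2]
      exact mul_le_mul_of_nonneg_left (by linarith) hl
    have := mul_le_mul_of_nonneg_right h4 hw
    linarith

lemma kk_arith (α μ T S E : ℝ) (hα0 : 0 < α) (hα1 : α < 1) (hμ : 0 < μ) (hT0 : 0 ≤ T)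
    (m1 : T - S ≤ α * (1 + 1 / μ) * T) (m2 : S ≤ α * E + (1 - α) * T) (hE : E ≤ T) :
    |S - E - (T - E)| ≤ (α * (1 + 1 / μ) + α ^ 2 / (1 - α) * (1 + 1 / μ ^ 2)) * T := by
  have hα2 : 0 < 1 - α := by linarith
  have r1 : 0 ≤ α ^ 2 / (1 - α) * (1 + 1 / μ ^ 2) * T := by positivity
  have r2 : 0 ≤ α * (1 / μ) * T := by positivity
  have r3 : α * E ≤ α * T := mul_le_mul_of_nonneg_left hE hα0.le
  have r4 : 0 ≤ α * T := by positivity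
  rw [abs_le]
  constructor
  · linarith
  · linarith

end final


set_option maxHeartbeats 800000

/-- **Skewness bound for the regularized kernel KL divergence.**  If `p ≪ q` with
`dp/dq ≤ 1/μ` and `α ∈ (0,1)`, then
`|KKL_α(p‖q) - KKL(p‖q)| ≤ (α(1 + 1/μ) + (α²/(1-α))(1 + 1/μ²)) |Tr(Σ_p log Σ_q)|`.
Here the three quantities are expressed through spectral decompositions
`(lam i, f i)` of `Σ_p`, `(gamq j, gq j)` of `Σ_q`, and `(eta j, h j)` of
`αΣ_p + (1-α)Σ_q`:
`KKL(p‖q) = ∑_{i,j} lam i log(lam i / gamq j) ⟪f i, gq j⟫²`,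
`KKL_α(p‖q) = ∑_{i,j} lam i log(lam i / eta j) ⟪f i, h j⟫²`, and
`Tr(Σ_p log Σ_q) = ∑_{i,j} lam i log(gamq j) ⟪f i, gq j⟫²`. -/
theorem kkl_alpha_skew_bound {d : ℕ} {H : Type*} [NormedAddCommGroup H]
    [InnerProductSpace ℝ H] [CompleteSpace H]
    (k : EuclideanSpace ℝ (Fin d) → EuclideanSpace ℝ (Fin d) → ℝ)
    (φ : EuclideanSpace ℝ (Fin d) → H) (hφc : Continuous φ)
    (hk : ∀ x y, k x y = ⟪φ x, φ y⟫) (hk1 : ∀ x, k x x = 1)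
    (p q : Measure (EuclideanSpace ℝ (Fin d)))
    [IsProbabilityMeasure p] [IsProbabilityMeasure q]
    (μ : ℝ) (hμ : 0 < μ)
    (hpq : p ≪ q) (hratio : ∀ᵐ x ∂q, p.rnDeriv q x ≤ ENNReal.ofReal (1 / μ))
    (α : ℝ) (hα : α ∈ Set.Ioo (0 : ℝ) 1)
    {ι : Type*} (f : HilbertBasis ι ℝ H) (lam : ι → ℝ)
    (hf : ∀ i, covOp φ p (f i) = lam i • f i) (hlam : ∀ i, 0 ≤ lam i)
    (gq : HilbertBasis ι ℝ H) (gamq : ι → ℝ)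
    (hgq : ∀ j, covOp φ q (gq j) = gamq j • gq j) (hgamq : ∀ j, 0 ≤ gamq j)
    (h : HilbertBasis ι ℝ H) (eta : ι → ℝ)
    (hh : ∀ j, (α • covOp φ p + (1 - α) • covOp φ q) (h j) = eta j • h j)
    (heta : ∀ j, 0 ≤ eta j)
    (hsumKKL : Summable (fun ij : ι × ι =>
      lam ij.1 * Real.log (lam ij.1 / gamq ij.2) * ⟪(f ij.1 : H), (gq ij.2 : H)⟫ ^ 2))
    (hsumKKLa : Summable (fun ij : ι × ι =>
      lam ij.1 * Real.log (lam ij.1 / eta ij.2) * ⟪(f ij.1 : H), (h ij.2 : H)⟫ ^ 2))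
    (hsumCross : Summable (fun ij : ι × ι =>
      lam ij.1 * Real.log (gamq ij.2) * ⟪(f ij.1 : H), (gq ij.2 : H)⟫ ^ 2)) :
    |(∑' ij : ι × ι,
        lam ij.1 * Real.log (lam ij.1 / eta ij.2) * ⟪(f ij.1 : H), (h ij.2 : H)⟫ ^ 2)
      - ∑' ij : ι × ι,
        lam ij.1 * Real.log (lam ij.1 / gamq ij.2) * ⟪(f ij.1 : H), (gq ij.2 : H)⟫ ^ 2|
      ≤ (α * (1 + 1 / μ) + α ^ 2 / (1 - α) * (1 + 1 / μ ^ 2))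
          * |∑' ij : ι × ι,
              lam ij.1 * Real.log (gamq ij.2) * ⟪(f ij.1 : H), (gq ij.2 : H)⟫ ^ 2| := by
  obtain ⟨hα0, hα1⟩ := hα
  have h1 : ∀ x, ‖φ x‖ = 1 := by
    intro x
    have := hk x x
    rw [hk1, real_inner_self_eq_norm_sq] at this
    have h0 := norm_nonneg (φ x)
    nlinarith
  have hc : 0 < 1 / μ := by positivity
  have hPs := kk_cov_sym φ hφc h1 p
  have hQs := kk_cov_sym φ hφc h1 q
  have hP0 := kk_cov_nonneg φ hφc h1 p
  have hQ0 := kk_cov_nonneg φ hφc h1 q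
  have hP1 := kk_cov_le φ hφc h1 p
  have hQ1 := kk_cov_le φ hφc h1 q
  have hPQ := kk_cov_dom φ hφc h1 p q (1 / μ) hc hpq hratio
  have htl := kk_cov_trace φ hφc h1 p f lam hf
  have htg := kk_cov_trace φ hφc h1 q gq gamq hgq
  have hlam1 := kk_eig_le _ hP1 f lam hf
  have hgam1 := kk_eig_le _ hQ1 gq gamq hgq
  have hza : ∀ i j, lam i * ⟪(f i : H), (gq j : H)⟫ ^ 2 ≠ 0 → 0 < gamq j := by
    intro i j hn
    refine lt_of_le_of_ne (hgamq j) fun h0 => hn ?_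
    refine kk_kill _ hPs f lam hf hlam _ ((hPQ _).trans ?_) i
    rw [hgq, ← h0]; simp
  have hzb : ∀ i j, lam i * ⟪(f i : H), (h j : H)⟫ ^ 2 ≠ 0 → 0 < eta j := by
    intro i j hn
    refine lt_of_le_of_ne (heta j) fun h0 => hn ?_
    refine kk_kill _ hPs f lam hf hlam _ ?_ i
    have e : ⟪(h j : H), (α • covOp φ p + (1 - α) • covOp φ q) (h j)⟫ = 0 := by
      rw [hh, ← h0]; simp
    have e2 : ⟪(h j : H), (α • covOp φ p + (1 - α) • covOp φ q) (h j)⟫ =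
        α * ⟪(h j : H), covOp φ p (h j)⟫ + (1 - α) * ⟪(h j : H), covOp φ q (h j)⟫ := by
      simp [inner_add_right, real_inner_smul_right]
    have e3 := mul_nonneg (by linarith : 0 ≤ 1 - α) (hQ0 (h j))
    have e4 : α * ⟪(h j : H), covOp φ p (h j)⟫ ≤ 0 := by linarith
    exact nonpos_of_mul_nonpos_right e4 hα0
  have tg : ∀ ij : ι × ι,
      lam ij.1 * Real.log (lam ij.1 / gamq ij.2) * ⟪(f ij.1 : H), (gq ij.2 : H)⟫ ^ 2 =
      lam ij.1 * ⟪(f ij.1 : H), (gq ij.2 : H)⟫ ^ 2 * -Real.log (gamq ij.2) -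
      lam ij.1 * -Real.log (lam ij.1) * ⟪(f ij.1 : H), (gq ij.2 : H)⟫ ^ 2 * 1 :=
    fun ij => kk_term _ _ _ (hlam _) (sq_nonneg _) (hza _ _)
  have th : ∀ ij : ι × ι,
      lam ij.1 * Real.log (lam ij.1 / eta ij.2) * ⟪(f ij.1 : H), (h ij.2 : H)⟫ ^ 2 =
      lam ij.1 * ⟪(f ij.1 : H), (h ij.2 : H)⟫ ^ 2 * -Real.log (eta ij.2) -
      lam ij.1 * -Real.log (lam ij.1) * ⟪(f ij.1 : H), (h ij.2 : H)⟫ ^ 2 * 1 :=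
    fun ij => kk_term _ _ _ (hlam _) (sq_nonneg _) (hzb _ _)
  have tc : ∀ ij : ι × ι,
      lam ij.1 * Real.log (gamq ij.2) * ⟪(f ij.1 : H), (gq ij.2 : H)⟫ ^ 2 =
      -(lam ij.1 * ⟪(f ij.1 : H), (gq ij.2 : H)⟫ ^ 2 * -Real.log (gamq ij.2)) :=
    fun ij => by ring
  have hl0 : ∀ i, 0 ≤ lam i * -Real.log (lam i) := fun i =>
    mul_nonneg (hlam i) (neg_nonneg.mpr (Real.log_nonpos (hlam i) (hlam1 i)))
  have hsT : Summable (fun ij : ι × ι => lam ij.1 * ⟪(f ij.1 : H), (gq ij.2 : H)⟫ ^ 2 *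
      -Real.log (gamq ij.2)) := by
    refine hsumCross.neg.congr fun ij => ?_
    rw [tc, neg_neg]
  have hsEg : Summable (fun ij : ι × ι =>
      lam ij.1 * -Real.log (lam ij.1) * ⟪(f ij.1 : H), (gq ij.2 : H)⟫ ^ 2 * 1) := by
    refine (hsT.sub hsumKKL).congr fun ij => ?_
    rw [tg]; ring
  have hsE : Summable (fun i => lam i * -Real.log (lam i)) := by
    have := ((summable_prod_of_nonneg (fun ij : ι × ι => by
      exact mul_nonneg (mul_nonneg (hl0 _) (sq_nonneg _)) zero_le_one)).mp hsEg).2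
    refine this.congr fun i => ?_
    have hr := ((kk_row f gq i).mul_left (lam i * -Real.log (lam i))).mul_right 1
    rw [hr.tsum_eq]; ring
  have hEp := fun g' : HilbertBasis ι ℝ H => kk_pair (fun i => lam i * -Real.log (lam i)) hl0
    (fun i j => ⟪(f i : H), (g' j : H)⟫ ^ 2)
    (fun _ _ => sq_nonneg _) (fun _ => 1) (fun _ => zero_le_one) (fun _ => 1)
    (fun i => by simpa using kk_row f g' i) (by simpa using hsE)
  have hsS : Summable (fun ij : ι × ι => lam ij.1 * ⟪(f ij.1 : H), (h ij.2 : H)⟫ ^ 2 *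
      -Real.log (eta ij.2)) := by
    refine (hsumKKLa.add (hEp h).1).congr fun ij => ?_
    rw [th]; ring
  obtain ⟨m1, m2⟩ := kk_main (covOp φ p) (covOp φ q) hPs hQs hP0 hQ0 hP1 hQ1 (1 / μ) hc hPQ α hα0 hα1
    f lam hf hlam htl.summable gq gamq hgq hgamq h eta hh heta hza hzb hsE hsT hsS
  -- Klein inequality
  have hklein : 0 ≤ ∑' ij : ι × ι,
      lam ij.1 * Real.log (lam ij.1 / gamq ij.2) * ⟪(f ij.1 : H), (gq ij.2 : H)⟫ ^ 2 := by
    obtain ⟨s1, t1⟩ := kk_pair lam hlam (fun i j => ⟪(f i : H), (gq j : H)⟫ ^ 2)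
      (fun _ _ => sq_nonneg _) (fun _ => 1) (fun _ => zero_le_one) (fun _ => 1)
      (fun i => by simpa using kk_row f gq i) (by simpa using htl.summable)
    obtain ⟨s2, t2⟩ := kk_pair gamq hgamq (fun j i => ⟪(f i : H), (gq j : H)⟫ ^ 2)
      (fun _ _ => sq_nonneg _) (fun _ => 1) (fun _ => zero_le_one) (fun _ => 1)
      (fun j => by simpa [real_inner_comm] using kk_row gq f j) (by simpa using htg.summable)
    have s3 : Summable (fun ij : ι × ι => gamq ij.2 * ⟪(f ij.1 : H), (gq ij.2 : H)⟫ ^ 2 * 1) :=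
      s2.prod_symm
    have t3 : ∑' ij : ι × ι, gamq ij.2 * ⟪(f ij.1 : H), (gq ij.2 : H)⟫ ^ 2 * 1 = 1 := by
      have := (Equiv.prodComm ι ι).tsum_eq
        (fun ij : ι × ι => gamq ij.1 * ⟪(f ij.2 : H), (gq ij.1 : H)⟫ ^ 2 * 1)
      refine Eq.trans this (t2.trans ?_)
      simpa using htg.tsum_eq
    have t1' : ∑' ij : ι × ι, lam ij.1 * ⟪(f ij.1 : H), (gq ij.2 : H)⟫ ^ 2 * 1 = 1 := by
      refine t1.trans ?_
      simpa using htl.tsum_eq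
    have hi : ∀ ij : ι × ι, lam ij.1 * ⟪(f ij.1 : H), (gq ij.2 : H)⟫ ^ 2 * 1 -
        gamq ij.2 * ⟪(f ij.1 : H), (gq ij.2 : H)⟫ ^ 2 * 1 ≤
        lam ij.1 * Real.log (lam ij.1 / gamq ij.2) * ⟪(f ij.1 : H), (gq ij.2 : H)⟫ ^ 2 := by
      intro ij
      exact kk_klein_term (lam ij.1) (gamq ij.2) (⟪(f ij.1 : H), (gq ij.2 : H)⟫ ^ 2)
        (hlam ij.1) (hgamq ij.2) (sq_nonneg _) (hza ij.1 ij.2)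
    have hs := (s1.sub s3).tsum_le_tsum hi hsumKKL
    have he := s1.tsum_sub s3
    rw [t3] at he
    have he2 := he.trans (congrArg (fun z : ℝ => z - 1) t1')
    rw [sub_self] at he2
    exact he2.symm.le.trans hs
  have hT0 : 0 ≤ ∑' ij : ι × ι, lam ij.1 * ⟪(f ij.1 : H), (gq ij.2 : H)⟫ ^ 2 *
      -Real.log (gamq ij.2) := tsum_nonneg fun ij => mul_nonneg (mul_nonneg (hlam _) (sq_nonneg _))
        (neg_nonneg.mpr (Real.log_nonpos (hgamq _) (hgam1 _)))
  have eg : ∑' ij : ι × ι,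
      lam ij.1 * Real.log (lam ij.1 / gamq ij.2) * ⟪(f ij.1 : H), (gq ij.2 : H)⟫ ^ 2 =
      (∑' ij : ι × ι, lam ij.1 * ⟪(f ij.1 : H), (gq ij.2 : H)⟫ ^ 2 * -Real.log (gamq ij.2)) -
      ∑' i, lam i * -Real.log (lam i) := by
    rw [tsum_congr tg]
    refine (hsT.tsum_sub hsEg).trans (congrArg _ ((hEp gq).2.trans ?_))
    simp only [mul_one]
  have eh : ∑' ij : ι × ι,
      lam ij.1 * Real.log (lam ij.1 / eta ij.2) * ⟪(f ij.1 : H), (h ij.2 : H)⟫ ^ 2 =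
      (∑' ij : ι × ι, lam ij.1 * ⟪(f ij.1 : H), (h ij.2 : H)⟫ ^ 2 * -Real.log (eta ij.2)) -
      ∑' i, lam i * -Real.log (lam i) := by
    rw [tsum_congr th]
    refine (hsS.tsum_sub (hEp h).1).trans (congrArg _ ((hEp h).2.trans ?_))
    simp only [mul_one]
  have ec : ∑' ij : ι × ι,
      lam ij.1 * Real.log (gamq ij.2) * ⟪(f ij.1 : H), (gq ij.2 : H)⟫ ^ 2 =
      -∑' ij : ι × ι, lam ij.1 * ⟪(f ij.1 : H), (gq ij.2 : H)⟫ ^ 2 * -Real.log (gamq ij.2) := by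
    rw [tsum_congr tc, tsum_neg]
  rw [eg] at hklein
  rw [eg, eh, ec, abs_neg, abs_of_nonneg hT0]
  exact kk_arith α μ _ _ _ hα0 hα1 hμ hT0 m1 m2 (sub_nonneg.mp hklein)
end
end

section
/- Let Σ_p and Σ_q be positive self-adjoint trace-class operators on a Hilbert space H with μ Σ_p ≼ Σ_q for some μ > 0 (in the sense of the Loewner order on self-adjoint operators). Then for every β > 0, |Tr( Σ_p (Σ_q + βI)^{-1} (Σ_q − Σ_p) (Σ_q + βI)^{-1} )| ≤ (1 + 1/μ) · Tr( Σ_p (Σ_q + βI)^{-1} ). -/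
open MeasureTheory RealInnerProductSpace

noncomputable section

/-- Trace of an operator computed along a Hilbert basis. -/
def trB {H : Type*} [NormedAddCommGroup H] [InnerProductSpace ℝ H] [CompleteSpace H]
    {ι : Type*} (b : HilbertBasis ι ℝ H) (A : H →L[ℝ] H) : ℝ :=
  ∑' i, ⟪b i, A (b i)⟫

universe u

open ContinuousLinearMap in
theorem exists_factor {H : Type u} [NormedAddCommGroup H] [InnerProductSpace ℝ H]
    [CompleteSpace H] (S : H →L[ℝ] H) (hsa : IsSelfAdjoint S) (hpos : ∀ x : H, 0 ≤ ⟪x, S x⟫) :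
    ∃ (K : Type u) (_ : NormedAddCommGroup K) (_ : InnerProductSpace ℝ K) (_ : CompleteSpace K)
      (J : H →L[ℝ] K), J.adjoint ∘L J = S := by
  let M : Matrix Unit Unit (H →L[ℝ] H) := Matrix.of fun _ _ => S
  have hM : M.PosSemidef := by
    have ht := (RKHS.posSemidef_tfae (K := M)).out 0 2
    refine ht.mpr ⟨?_, ?_⟩
    · ext i j : 2
      simp [M, hsa.star_eq]
    · intro v
      rw [Finsupp.sum_fintype _ _ (by simp)]
      simp only [Finset.univ_unique, Finset.sum_singleton]
      rw [Finsupp.sum_fintype _ _ (by simp)]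
      simpa [M, real_inner_comm] using hpos (v ())
  have : Fact M.PosSemidef := ⟨hM⟩
  refine ⟨RKHS.OfKernel M, inferInstance, inferInstance, inferInstance,
    RKHS.kerFun (RKHS.OfKernel M) (), ?_⟩
  rw [← RKHS.kernel_apply, RKHS.OfKernel.kernel_ofKernel]
  rfl

section cyc
open ContinuousLinearMap

variable {H : Type*} [NormedAddCommGroup H] [InnerProductSpace ℝ H] [CompleteSpace H]
  {K : Type*} [NormedAddCommGroup K] [InnerProductSpace ℝ K] [CompleteSpace K]
  {ι κ : Type*}

theorem hasSum_inner_sq (b : HilbertBasis ι ℝ H) (x : H) :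
    HasSum (fun i => ⟪x, b i⟫ ^ 2) (‖x‖ ^ 2) := by
  have := b.hasSum_inner_mul_inner x x
  rw [real_inner_self_eq_norm_sq] at this
  refine this.congr_fun ?_ |> id
  intro i
  rw [real_inner_comm x (b i), sq]

theorem summable_hs (b : HilbertBasis ι ℝ H) (J : H →L[ℝ] K) (c : HilbertBasis κ ℝ K)
    (h : Summable fun i => ‖J (b i)‖ ^ 2) :
    Summable (fun p : ι × κ => ⟪J (b p.1), c p.2⟫ ^ 2) := by
  rw [summable_prod_of_nonneg (fun p => sq_nonneg _)]
  refine ⟨fun i => (hasSum_inner_sq c (J (b i))).summable, ?_⟩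
  refine h.congr fun i => ?_
  exact (hasSum_inner_sq c (J (b i))).tsum_eq.symm

theorem summable_adj (b : HilbertBasis ι ℝ H) (J : H →L[ℝ] K) (c : HilbertBasis κ ℝ K)
    (h : Summable fun i => ‖J (b i)‖ ^ 2) :
    Summable (fun k => ‖J.adjoint (c k)‖ ^ 2) := by
  have h1 := (summable_hs b J c h).prod_symm.prod
  refine h1.congr fun k => ?_
  rw [← (hasSum_inner_sq b (J.adjoint (c k))).tsum_eq]
  refine tsum_congr fun i => ?_
  simp only [Prod.swap]
  rw [adjoint_inner_left, real_inner_comm]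

theorem trace_cyc (b : HilbertBasis ι ℝ H) (J : H →L[ℝ] K) (c : HilbertBasis κ ℝ K)
    (h : Summable fun i => ‖J (b i)‖ ^ 2) (A : H →L[ℝ] H) :
    HasSum (fun k => ⟪J.adjoint (c k), A (J.adjoint (c k))⟫)
      (trB b ((J.adjoint ∘L J) ∘L A)) := by
  have hg : Summable (fun p : ι × κ => ⟪c p.2, J (A (b p.1))⟫ ^ 2) := by
    have h3 : Summable (fun k => ‖A.adjoint (J.adjoint (c k))‖ ^ 2) := by
      refine Summable.of_nonneg_of_le (fun k => by positivity) (fun k => ?_)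
        ((summable_adj b J c h).mul_left (‖A.adjoint‖ ^ 2))
      rw [← mul_pow]
      exact pow_le_pow_left₀ (norm_nonneg _) (le_opNorm _ _) 2
    have h4 : Summable (fun p : κ × ι => ⟪c p.1, J (A (b p.2))⟫ ^ 2) := by
      rw [summable_prod_of_nonneg (fun p => sq_nonneg _)]
      have h5 : ∀ k, HasSum (fun i => ⟪c k, J (A (b i))⟫ ^ 2)
          (‖A.adjoint (J.adjoint (c k))‖ ^ 2) := by
        intro k
        have := hasSum_inner_sq b (A.adjoint (J.adjoint (c k)))
        simpa only [adjoint_inner_left] using this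
      exact ⟨fun k => (h5 k).summable, h3.congr fun k => (h5 k).tsum_eq.symm⟩
    exact h4.prod_symm
  have hf := summable_hs b J c h
  have hfg : Summable (fun p : ι × κ => ⟪J (b p.1), c p.2⟫ * ⟪c p.2, J (A (b p.1))⟫) := by
    refine Summable.of_norm_bounded (hf.add hg) fun p => ?_
    rw [Real.norm_eq_abs, abs_le]
    constructor <;>
      nlinarith [sq_nonneg (⟪J (b p.1), c p.2⟫ + ⟪c p.2, J (A (b p.1))⟫),
        sq_nonneg (⟪J (b p.1), c p.2⟫ - ⟪c p.2, J (A (b p.1))⟫),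
        sq_nonneg (⟪J (b p.1), c p.2⟫), sq_nonneg (⟪c p.2, J (A (b p.1))⟫)]
  have e1 : trB b ((J.adjoint ∘L J) ∘L A)
      = ∑' p : ι × κ, ⟪J (b p.1), c p.2⟫ * ⟪c p.2, J (A (b p.1))⟫ := by
    rw [hfg.tsum_prod]
    refine tsum_congr fun i => ?_
    refine Eq.trans ?_ (c.tsum_inner_mul_inner (J (b i)) (J (A (b i)))).symm
    simp [adjoint_inner_right]
  rw [e1]
  have hs := hfg.prod_symm.hasSum
  have e2 := (Equiv.prodComm κ ι).tsum_eq
    (fun p : ι × κ => ⟪J (b p.1), c p.2⟫ * ⟪c p.2, J (A (b p.1))⟫)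
  rw [← e2]
  refine hs.prod_fiberwise fun k => ?_
  have := b.hasSum_inner_mul_inner (A.adjoint (J.adjoint (c k))) (J.adjoint (c k))
  rw [adjoint_inner_left, real_inner_comm] at this
  rw [real_inner_comm]
  simp only [adjoint_inner_left, adjoint_inner_right] at this
  rw [adjoint_inner_right]
  refine this.congr_fun fun i => ?_
  exact mul_comm _ _

end cyc

/-- Let `Sp, Sq` be positive self-adjoint trace-class operators on a Hilbert space `H`
with `μ Sp ≼ Sq` in the Loewner order, `μ > 0`. Then for every `β > 0`, with
`R = (Sq + βI)⁻¹`,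
`|Tr(Sp R (Sq - Sp) R)| ≤ (1 + 1/μ) Tr(Sp R)`. -/
theorem trace_resolvent_bound {H : Type*} [NormedAddCommGroup H] [InnerProductSpace ℝ H]
    [CompleteSpace H] {ι : Type*} (b : HilbertBasis ι ℝ H)
    (Sp Sq : H →L[ℝ] H)
    (hpsa : IsSelfAdjoint Sp) (hqsa : IsSelfAdjoint Sq)
    (hppos : ∀ x : H, 0 ≤ ⟪x, Sp x⟫) (hqpos : ∀ x : H, 0 ≤ ⟪x, Sq x⟫)
    (hptc : Summable fun i => ⟪b i, Sp (b i)⟫)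
    (hqtc : Summable fun i => ⟪b i, Sq (b i)⟫)
    (μ : ℝ) (hμ : 0 < μ) (hLoewner : ∀ x : H, μ * ⟪x, Sp x⟫ ≤ ⟪x, Sq x⟫)
    (β : ℝ) (hβ : 0 < β)
    (R : H →L[ℝ] H) (hR : R ∘L (Sq + β • 1) = 1) (hR' : (Sq + β • 1) ∘L R = 1) :
    |trB b (Sp ∘L (R ∘L ((Sq - Sp) ∘L R)))| ≤ (1 + 1 / μ) * trB b (Sp ∘L R) := by
  obtain ⟨K, _, _, _, J, hJ⟩ := exists_factor Sp hpsa hppos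
  obtain ⟨w, c, -⟩ := exists_hilbertBasis ℝ K
  have hsum : Summable fun i => ‖J (b i)‖ ^ 2 := by
    refine hptc.congr fun i => ?_
    rw [← hJ, ContinuousLinearMap.comp_apply, ContinuousLinearMap.adjoint_inner_right,
      real_inner_self_eq_norm_sq]
  have h1 := trace_cyc b J c hsum (R ∘L ((Sq - Sp) ∘L R))
  have h2 := trace_cyc b J c hsum R
  rw [hJ] at h1 h2
  have hqR : ∀ x, Sq (R x) + β • R x = x := fun x => by
    simpa using congrArg (fun T : H →L[ℝ] H => T x) hR'
  have hRq : ∀ x, R (Sq x + β • x) = x := fun x => by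
    simpa using congrArg (fun T : H →L[ℝ] H => T x) hR
  have hsymm : ∀ x y, ⟪Sq x, y⟫ = ⟪x, Sq y⟫ := fun x y => hqsa.isSymmetric x y
  have hRs : ∀ x y, ⟪x, R y⟫ = ⟪R x, y⟫ := by
    intro x y
    conv_lhs => rw [← hqR x]
    conv_rhs => rw [← hqR y]
    rw [inner_add_left, inner_add_right, hsymm, real_inner_smul_left, real_inner_smul_right]
  have key : ∀ v, |⟪v, (R ∘L ((Sq - Sp) ∘L R)) v⟫| ≤ (1 + 1 / μ) * ⟪v, R v⟫ := by
    intro v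
    simp only [ContinuousLinearMap.comp_apply, sub_apply]
    rw [hRs, inner_sub_right]
    have e : ⟪v, R v⟫ = ⟪R v, Sq (R v)⟫ + β * ⟪R v, R v⟫ := by
      conv_lhs => rw [← hqR v, hRq, real_inner_comm]
      rw [inner_add_right, real_inner_smul_right]
    have a1 := hppos (R v)
    have a2 := hqpos (R v)
    have a3 := hLoewner (R v)
    have a4 : 0 ≤ β * ⟪R v, R v⟫ := mul_nonneg hβ.le real_inner_self_nonneg
    have a5 : ⟪R v, Sp (R v)⟫ ≤ 1 / μ * ⟪R v, Sq (R v)⟫ := by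
      rw [one_div, ← div_eq_inv_mul, le_div_iff₀ hμ]; linarith
    have a6 : 0 ≤ 1 / μ * (β * ⟪R v, R v⟫) := by positivity
    have a7 : 0 ≤ 1 / μ * ⟪R v, Sq (R v)⟫ := by positivity
    rw [e, abs_le]
    constructor <;> linarith
  have h3 := h2.mul_left (1 + 1 / μ)
  rw [abs_le]
  constructor
  · exact hasSum_le (fun k => (abs_le.mp (key _)).1) h3.neg h1
  · exact hasSum_le (fun k => (abs_le.mp (key _)).2) h1 h3
end
end

section
/- Assume p ≪ q with dp/dq ≤ 1/μ for some 0 < μ ≤ 1 and α ≤ 1/2. Let Γ = αΣ_p + (1−α)Σ_q, let Γ̂ = αΣ_{p̂} + (1−α)Σ_{q̂} be its empirical counterpart built from n i.i.d. samples of p and m i.i.d. samples of q, let β > 0, D = (Γ + βI)^{-1/2}(Γ̂ − Γ)(Γ + βI)^{-1/2}, and C(β) = sup_{x∈ℝ^d} ⟨φ(x), (Σ_p + βI)^{-1} φ(x)⟩_H. Then for every 0 < u < 1, P( λ_max(D) > u ) ≤ (2/μ) C(β) ( 1 + (48/(u⁴ (m∧n))) (C(β)/μ + u/6)² ) exp(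 − (m∧n) u² / (8 (C(β)/μ + u/6)) ), where λ_max(D) denotes the maximal eigenvalue of (D²)^{1/2}. -/
open MeasureTheory RealInnerProductSpace
open scoped ENNReal

noncomputable section

/-- The empirical covariance operator `(1/n) ∑ᵢ φ(x_i) ⊗ φ(x_i)`. -/
def empCov {d n : ℕ} {H : Type*} [NormedAddCommGroup H] [InnerProductSpace ℝ H]
    (φ : EuclideanSpace ℝ (Fin d) → H) (xs : Fin n → EuclideanSpace ℝ (Fin d)) :
    H →L[ℝ] H :=
  (n : ℝ)⁻¹ • ∑ i, rankOne (φ (xs i)) (φ (xs i))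

set_option linter.all false

namespace LMC

section matrices
open Matrix
variable {ι : Type*} [Fintype ι] [DecidableEq ι]

lemma trace_cs (A B : Matrix ι ι ℝ) :
    (A * B).trace ^ 2 ≤ (A * Aᴴ).trace * (B * Bᴴ).trace := by
  have h := Finset.sum_mul_sq_le_sq_mul_sq (Finset.univ : Finset (ι × ι))
    (fun x => A x.1 x.2) (fun x => B x.2 x.1)
  have e1 : (A * B).trace = ∑ x : ι × ι, A x.1 x.2 * B x.2 x.1 := by
    simp [Matrix.trace, Matrix.mul_apply, Fintype.sum_prod_type]
  have e2 : (A * Aᴴ).trace = ∑ x : ι × ι, A x.1 x.2 ^ 2 := by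
    simp [Matrix.trace, Matrix.mul_apply, Fintype.sum_prod_type, sq]
  have e3 : (B * Bᴴ).trace = ∑ x : ι × ι, B x.2 x.1 ^ 2 := by
    rw [Fintype.sum_prod_type_right]
    simp [Matrix.trace, Matrix.mul_apply, sq]
  rw [e1, e2, e3]; exact h

lemma trace_mul_pow_comm (A B : Matrix ι ι ℝ) (k : ℕ) :
    ((A * B) ^ k).trace = ((B * A) ^ k).trace := by
  cases k with
  | zero => simp
  | succ k =>
    have h : ∀ k : ℕ, (A * B) ^ k * A = A * (B * A) ^ k := by
      intro k
      induction k with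
      | zero => simp
      | succ k ih =>
        calc (A * B) ^ (k+1) * A = (A * B) ^ k * A * (B * A) := by
              rw [pow_succ]; simp only [mul_assoc]
          _ = _ := by rw [ih, pow_succ, mul_assoc]
    have : (A * B) ^ (k+1) = A * ((B * A) ^ k * B) := by
      rw [pow_succ, ← mul_assoc, h, mul_assoc]
    rw [this, Matrix.trace_mul_comm, pow_succ, mul_assoc]

lemma trace_pow_nonneg (M : Matrix ι ι ℝ) (k : ℕ) : 0 ≤ ((M * Mᴴ) ^ k).trace :=
  ((posSemidef_self_mul_conjTranspose M).pow k).trace_nonneg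

lemma trace_pow_main (k : ℕ) :
    (∀ M : Matrix ι ι ℝ, |(M ^ (2 * 2 ^ k)).trace| ≤ ((M * Mᴴ) ^ (2 ^ k)).trace) ∧
    (∀ A B : Matrix ι ι ℝ, A.IsHermitian → B.IsHermitian →
      ((A * B) ^ (2 ^ k)).trace ^ 2 ≤ (A ^ (2 * 2 ^ k)).trace * (B ^ (2 * 2 ^ k)).trace) := by
  induction k with
  | zero =>
    refine ⟨fun M => ?_, fun A B hA hB => ?_⟩
    · have := trace_cs M M
      simp only [pow_zero, mul_one, pow_one, sq M]
      exact abs_le_of_sq_le_sq (by nlinarith) (by simpa using trace_pow_nonneg M 1)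
    · have := trace_cs A B
      rw [hA.eq, hB.eq] at this
      simpa [sq A, sq B] using this
  | succ k ih =>
    obtain ⟨ihC, ihQ⟩ := ih
    refine ⟨fun M => ?_, fun A B hA hB => ?_⟩
    · have h1 := ihC (M ^ 2)
      have h2 := ihQ (Mᴴ * M) (M * Mᴴ) (isHermitian_conjTranspose_mul_self M)
        (isHermitian_mul_conjTranspose_self M)
      have h3 : ((M ^ 2 * (M ^ 2)ᴴ) ^ 2 ^ k).trace = ((Mᴴ * M * (M * Mᴴ)) ^ 2 ^ k).trace := by
        rw [show M ^ 2 * (M ^ 2)ᴴ = (M * (M * Mᴴ)) * Mᴴ by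
          simp [sq, mul_assoc], trace_mul_pow_comm]
        simp [mul_assoc]
      rw [← pow_mul] at h1
      rw [show 2 * 2 ^ (k+1) = 2 * (2 * 2 ^ k) by ring, show 2 ^ (k+1) = 2 * 2 ^ k by ring]
      rw [trace_mul_pow_comm Mᴴ M, ← sq] at h2
      refine h1.trans ?_
      rw [h3]
      exact le_of_sq_le_sq h2 (trace_pow_nonneg _ _) 
    · have h1 := ihC (A * B)
      have h2 := ihQ (A ^ 2) (B ^ 2) (hA.pow 2) (hB.pow 2)
      have h3 : ((A * B * (A * B)ᴴ) ^ 2 ^ k).trace = ((A ^ 2 * B ^ 2) ^ 2 ^ k).trace := by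
        rw [show A * B * (A * B)ᴴ = (A * B ^ 2) * A by
          rw [conjTranspose_mul, hA.eq, hB.eq]; simp only [sq, mul_assoc], trace_mul_pow_comm]
        simp [mul_assoc, sq]
      rw [← pow_mul, ← pow_mul] at h2
      rw [show 2 * 2 ^ (k+1) = 2 * (2 * 2 ^ k) by ring, show 2 ^ (k+1) = 2 * 2 ^ k by ring]
      refine le_trans ?_ h2
      rw [← h3]
      exact sq_le_sq' (by linarith [neg_abs_le ((A * B) ^ (2 * 2 ^ k)).trace]) ((le_abs_self _).trans h1)

lemma trace_mul_pow_le (k : ℕ) : ∀ A B : Matrix ι ι ℝ, A.IsHermitian → B.IsHermitian →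
    ((A * B) ^ (2 ^ k)).trace ≤ (A ^ (2 ^ k) * B ^ (2 ^ k)).trace := by
  induction k with
  | zero => intro A B _ _; simp
  | succ k ih =>
    intro A B hA hB
    have h1 := (trace_pow_main k).1 (A * B)
    have h2 := ih (A ^ 2) (B ^ 2) (hA.pow 2) (hB.pow 2)
    have h3 : ((A * B * (A * B)ᴴ) ^ 2 ^ k).trace = ((A ^ 2 * B ^ 2) ^ 2 ^ k).trace := by
      rw [show A * B * (A * B)ᴴ = (A * B ^ 2) * A by
        rw [conjTranspose_mul, hA.eq, hB.eq]; simp only [sq, mul_assoc], trace_mul_pow_comm]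
      simp [mul_assoc, sq]
    rw [← pow_mul, ← pow_mul] at h2
    rw [show 2 ^ (k+1) = 2 * 2 ^ k by ring]
    exact ((le_abs_self _).trans h1).trans (h3.le.trans h2)

section trotter
variable {𝔸 : Type*} [NormedRing 𝔸] [NormedAlgebra ℝ 𝔸] [CompleteSpace 𝔸] 

lemma norm_pow_sub_pow_le (X Y : 𝔸) (c : ℝ) (hc : 1 ≤ c) (hX : ‖X‖ ≤ c) (hY : ‖Y‖ ≤ c) (n : ℕ) :
    ‖X ^ n - Y ^ n‖ ≤ n * c ^ n * ‖X - Y‖ := by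
  induction n with
  | zero => simp
  | succ n ih =>
    have e : X ^ (n+1) - Y ^ (n+1) = (X ^ n - Y ^ n) * X + Y ^ n * (X - Y) := by
      rw [pow_succ, pow_succ]; noncomm_ring
    have hYn : ‖Y ^ n * (X - Y)‖ ≤ c ^ n * ‖X - Y‖ := by
      rcases Nat.eq_zero_or_pos n with rfl | hn
      · simp
      · refine (norm_mul_le _ _).trans ?_
        gcongr
        exact (norm_pow_le' _ hn).trans (by gcongr)
    rw [e]
    have hc0 : 0 ≤ c := by linarith
    calc _ ≤ ‖(X ^ n - Y ^ n) * X‖ + ‖Y ^ n * (X - Y)‖ := norm_add_le _ _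
      _ ≤ (n * c ^ n * ‖X - Y‖) * c + c ^ n * ‖X - Y‖ := by
        gcongr
        exact (norm_mul_le _ _).trans (by gcongr)
      _ ≤ (n * c ^ n * ‖X - Y‖) * c + c ^ (n+1) * ‖X - Y‖ := by
        gcongr <;> omega
      _ = _ := by push_cast; ring

open Filter Topology NormedSpace in
lemma lie_trotter (A B : 𝔸) (hone : ‖(1:𝔸)‖ = 1) :
    Tendsto (fun n : ℕ => (exp ((n:ℝ)⁻¹ • A) * exp ((n:ℝ)⁻¹ • B)) ^ n) atTop (𝓝 (exp (A + B))) := by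
  haveI : NormOneClass 𝔸 := ⟨hone⟩
  have hd : HasDerivAt (fun t : ℝ => exp (t • A) * exp (t • B) - exp (t • (A + B))) 0 0 := by
    have h1 := (hasDerivAt_exp_smul_const A (0:ℝ)).mul (hasDerivAt_exp_smul_const B (0:ℝ))
    have h2 := h1.sub (hasDerivAt_exp_smul_const (A + B) (0:ℝ))
    have e0 : (0:𝔸) = exp ((0:ℝ) • A) * A * exp ((0:ℝ) • B) + exp ((0:ℝ) • A) * (exp ((0:ℝ) • B) * B) - exp ((0:ℝ) • (A+B)) * (A+B) := by
      simp
    rw [e0]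
    exact h2
  have hlim : Tendsto (fun n : ℕ => (n:ℝ) • (exp ((n:ℝ)⁻¹ • A) * exp ((n:ℝ)⁻¹ • B) - exp ((n:ℝ)⁻¹ • (A + B))))
      atTop (𝓝 0) := by
    have h := hd.tendsto_slope_zero
    have hn : Tendsto (fun n : ℕ => ((n:ℝ))⁻¹) atTop (𝓝[≠] 0) := by
      refine tendsto_nhdsWithin_iff.2 ⟨tendsto_inv_atTop_nhds_zero_nat, ?_⟩
      filter_upwards [eventually_gt_atTop 0] with n hn
      simp; omega
    have := h.comp hn
    simpa [Function.comp_def] using this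
  have hexp : ∀ X : 𝔸, ‖exp X‖ ≤ Real.exp ‖X‖ := by
    intro X
    rw [NormedSpace.exp_eq_tsum ℝ, Real.exp_eq_exp_ℝ, NormedSpace.exp_eq_tsum ℝ]
    refine (norm_tsum_le_tsum_norm (NormedSpace.norm_expSeries_summable' (𝕂 := ℝ) X)).trans ?_
    refine Summable.tsum_le_tsum (fun n => ?_) (NormedSpace.norm_expSeries_summable' (𝕂 := ℝ) X)
      (NormedSpace.expSeries_summable' (𝕂 := ℝ) ‖X‖)
    rw [norm_smul, smul_eq_mul, Real.norm_of_nonneg (by positivity)]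
    gcongr
    exact norm_pow_le _ _
  set a := ‖A‖ + ‖B‖
  have key : ∀ n : ℕ, 0 < n → ‖(exp ((n:ℝ)⁻¹ • A) * exp ((n:ℝ)⁻¹ • B)) ^ n - exp (A + B)‖ ≤
      Real.exp a * ‖(n:ℝ) • (exp ((n:ℝ)⁻¹ • A) * exp ((n:ℝ)⁻¹ • B) - exp ((n:ℝ)⁻¹ • (A + B)))‖ := by
    intro n hn
    have hn' : (n:ℝ) ≠ 0 := by positivity
    have e : exp (A + B) = exp ((n:ℝ)⁻¹ • (A + B)) ^ n := by
      letI : NormedAlgebra ℚ 𝔸 := NormedAlgebra.restrictScalars ℚ ℝ 𝔸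
      rw [← NormedSpace.exp_nsmul, ← Nat.cast_smul_eq_nsmul ℝ, smul_smul, mul_inv_cancel₀ hn', one_smul]
    rw [e]
    have := norm_pow_sub_pow_le (exp ((n:ℝ)⁻¹ • A) * exp ((n:ℝ)⁻¹ • B)) (exp ((n:ℝ)⁻¹ • (A + B)))
      (Real.exp ((n:ℝ)⁻¹ * a)) (Real.one_le_exp (by positivity)) ?_ ?_ n
    · refine this.trans (le_of_eq ?_)
      rw [← Real.exp_nat_mul, norm_smul, Real.norm_natCast, ← mul_assoc (n:ℝ), mul_inv_cancel₀ hn']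
      ring_nf
    · refine (norm_mul_le _ _).trans ?_
      rw [mul_add, Real.exp_add]
      gcongr
      · exact (hexp _).trans (by rw [norm_smul]; simp)
      · exact (hexp _).trans (by rw [norm_smul]; simp)
    · refine (hexp _).trans ?_
      rw [norm_smul]
      simp only [norm_inv, RCLike.norm_natCast]
      gcongr
      exact norm_add_le _ _
  rw [tendsto_iff_norm_sub_tendsto_zero]
  refine squeeze_zero' (Eventually.of_forall fun _ => norm_nonneg _)
    ((eventually_gt_atTop 0).mono fun n hn => key n hn) ?_
  simpa using hlim.norm.const_mul (Real.exp a)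
end trotter

section
open Filter Topology NormedSpace

open scoped Matrix.Norms.Operator in
lemma lie_trotter_matrix [Nonempty ι] (A B : Matrix ι ι ℝ) :
    Tendsto (fun n : ℕ => (exp ((n:ℝ)⁻¹ • A) * exp ((n:ℝ)⁻¹ • B)) ^ n) atTop (𝓝 (exp (A + B))) := by
  have hone : ‖(1 : Matrix ι ι ℝ)‖ = 1 := by
    have : NormOneClass (Matrix ι ι ℝ) := Matrix.linfty_opNormOneClass
    exact norm_one
  exact lie_trotter A B hone

open scoped Matrix.Norms.Operator in
lemma continuous_matrix_exp' : Continuous (exp : Matrix ι ι ℝ → Matrix ι ι ℝ) := by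
  letI : NormedAlgebra ℚ (Matrix ι ι ℝ) := NormedAlgebra.restrictScalars ℚ ℝ _
  exact NormedSpace.exp_continuous
end
section
open Filter Topology NormedSpace
lemma continuous_matrix_exp : Continuous (exp : Matrix ι ι ℝ → Matrix ι ι ℝ) := by
  exact continuous_matrix_exp'

lemma golden_thompson (A B : Matrix ι ι ℝ) (hA : A.IsHermitian) (hB : B.IsHermitian) :
    (exp (A + B)).trace ≤ (exp A * exp B).trace := by
  cases isEmpty_or_nonempty ι with
  | inl h => simp [Matrix.trace]
  | inr h =>
  have h0 : Tendsto (fun n : ℕ => (exp ((n:ℝ)⁻¹ • A) * exp ((n:ℝ)⁻¹ • B)) ^ n) atTop (𝓝 (exp (A + B))) := by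
    exact lie_trotter_matrix A B
  have h1 := h0.comp (tendsto_pow_atTop_atTop_of_one_lt (r := 2) (by norm_num))
  have h2 : Tendsto (fun M : Matrix ι ι ℝ => M.trace) (𝓝 (exp (A + B))) (𝓝 (exp (A+B)).trace) :=
    (Continuous.matrix_trace continuous_id).tendsto _
  refine le_of_tendsto (h2.comp h1) (Eventually.of_forall fun k => ?_)
  simp only [Function.comp]
  have hs : ∀ (c : ℝ) (M : Matrix ι ι ℝ), M.IsHermitian → (c • M).IsHermitian := fun c M hM => by
    simp [Matrix.IsHermitian] at hM ⊢; rw [hM]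
  have hp : ∀ M : Matrix ι ι ℝ, exp (((2 ^ k : ℕ):ℝ)⁻¹ • M) ^ (2 ^ k) = exp M := fun M => by
    rw [← Matrix.exp_nsmul, ← Nat.cast_smul_eq_nsmul ℝ,
      smul_smul, mul_inv_cancel₀ (by positivity), one_smul]
  refine (trace_mul_pow_le k _ _ ?_ ?_).trans (le_of_eq ?_)
  · exact (hs _ _ hA).exp
  · exact (hs _ _ hB).exp
  · rw [hp, hp]
end

section spectral
open NormedSpace

lemma spec (A : Matrix ι ι ℝ) (hA : A.IsHermitian) : ∃ (U : Matrix ι ι ℝ) (l : ι → ℝ),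
    Uᴴ * U = 1 ∧ U * Uᴴ = 1 ∧ A = U * diagonal l * Uᴴ ∧
    exp A = U * diagonal (fun i => Real.exp (l i)) * Uᴴ := by
  have hU1 : (hA.eigenvectorUnitary : Matrix ι ι ℝ)ᴴ * (hA.eigenvectorUnitary : Matrix ι ι ℝ) = 1 :=
    Unitary.coe_star_mul_self hA.eigenvectorUnitary
  have hU2 : (hA.eigenvectorUnitary : Matrix ι ι ℝ) * (hA.eigenvectorUnitary : Matrix ι ι ℝ)ᴴ = 1 :=
    Unitary.coe_mul_star_self hA.eigenvectorUnitary
  have hsp : A = (hA.eigenvectorUnitary : Matrix ι ι ℝ) * diagonal hA.eigenvalues *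
      (hA.eigenvectorUnitary : Matrix ι ι ℝ)ᴴ := by
    have := hA.spectral_theorem
    rw [Unitary.conjStarAlgAut_apply] at this
    exact this
  refine ⟨hA.eigenvectorUnitary, hA.eigenvalues, hU1, hU2, hsp, ?_⟩
  have hinv : (hA.eigenvectorUnitary : Matrix ι ι ℝ)⁻¹ = (hA.eigenvectorUnitary : Matrix ι ι ℝ)ᴴ :=
    Matrix.inv_eq_right_inv hU2
  have hunit : IsUnit (hA.eigenvectorUnitary : Matrix ι ι ℝ) :=
    IsUnit.of_mul_eq_one _ hU2
  conv_lhs => rw [hsp, ← hinv, Matrix.exp_conj _ _ hunit, Matrix.exp_diagonal, hinv]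
  congr 3
  ext i
  rw [Pi.exp_def, Real.exp_eq_exp_ℝ]

lemma psd_conj_diag (U : Matrix ι ι ℝ) (l : ι → ℝ) (hl : ∀ i, 0 ≤ l i) :
    (U * diagonal l * Uᴴ).PosSemidef :=
  (PosSemidef.diagonal (d := l) hl).mul_mul_conjTranspose_same U

lemma exp_psd (A : Matrix ι ι ℝ) (hA : A.IsHermitian) : (exp A).PosSemidef := by
  obtain ⟨U, l, h1, h2, h3, h4⟩ := spec A hA
  rw [h4]; exact psd_conj_diag _ _ fun i => (Real.exp_pos _).le

lemma psi_psd (A : Matrix ι ι ℝ) (hA : A.IsHermitian) : (exp A - A - 1).PosSemidef := by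
  obtain ⟨U, l, h1, h2, h3, h4⟩ := spec A hA
  have : exp A - A - 1 = U * diagonal (fun i => Real.exp (l i) - l i - 1) * Uᴴ := by
    have e : diagonal (fun i => Real.exp (l i) - l i - 1) =
      diagonal (fun i => Real.exp (l i)) - diagonal l - (1 : Matrix ι ι ℝ) := by
      rw [← diagonal_one, diagonal_sub, diagonal_sub]
    rw [e, mul_sub, mul_sub, sub_mul, sub_mul, mul_one, h2, ← h3, ← h4]
  rw [this]
  exact psd_conj_diag _ _ fun i => by linarith [Real.add_one_le_exp (l i)]

lemma quad_conj_diag (U : Matrix ι ι ℝ) (l : ι → ℝ) (c : ι → ℝ) :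
    c ⬝ᵥ ((U * diagonal l * Uᴴ) *ᵥ c) = ∑ i, l i * ((Uᴴ *ᵥ c) i) ^ 2 := by
  rw [← Matrix.mulVec_mulVec, ← Matrix.mulVec_mulVec, Matrix.dotProduct_mulVec,
    ← Matrix.mulVec_transpose]
  simp [dotProduct, Matrix.mulVec_diagonal]
  refine Finset.sum_congr rfl fun i _ => by ring

lemma quad_one (U : Matrix ι ι ℝ) (h2 : U * Uᴴ = 1) (c : ι → ℝ) :
    c ⬝ᵥ c = ∑ i, ((Uᴴ *ᵥ c) i) ^ 2 := by
  have := quad_conj_diag U (fun _ => 1) c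
  rw [diagonal_one, mul_one, h2, Matrix.one_mulVec] at this
  simpa using this

lemma exp_le_quad (Z : Matrix ι ι ℝ) (hZ : Z.IsHermitian)
    (hb : ∀ c : ι → ℝ, |c ⬝ᵥ (Z *ᵥ c)| ≤ c ⬝ᵥ c) : (1 + Z + Z * Z - exp Z).PosSemidef := by
  obtain ⟨U, l, h1, h2, h3, h4⟩ := spec Z hZ
  have hl : ∀ i, |l i| ≤ 1 := by
    intro i
    have h := hb (U *ᵥ (Pi.single i 1))
    rw [quad_one U h2]at h
    rw [h3, quad_conj_diag, Matrix.mulVec_mulVec, h1, Matrix.one_mulVec] at h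
    simpa [Pi.single_apply] using h
  have : 1 + Z + Z * Z - exp Z = U * diagonal (fun i => 1 + l i + l i * l i - Real.exp (l i)) * Uᴴ := by
    have e : diagonal (fun i => 1 + l i + l i * l i - Real.exp (l i)) =
      (1 : Matrix ι ι ℝ) + diagonal l + diagonal l * diagonal l - diagonal (fun i => Real.exp (l i)) := by
      rw [← diagonal_one, diagonal_mul_diagonal, diagonal_add, diagonal_add, diagonal_sub]
    have e2 : Z * Z = U * (diagonal l * diagonal l) * Uᴴ := by
      rw [h3]
      calc _ = U * diagonal l * (Uᴴ * U) * diagonal l * Uᴴ := by simp only [mul_assoc]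
        _ = _ := by rw [h1]; simp only [mul_assoc, mul_one]
    rw [e, mul_sub, mul_add, mul_add, sub_mul, add_mul, add_mul, mul_one, h2, ← h3, ← h4, e2]
  rw [this]
  refine psd_conj_diag _ _ fun i => ?_
  have := (abs_le.1 (Real.abs_exp_sub_one_sub_id_le (hl i))).2
  nlinarith

lemma trace_mul_psd {P Q : Matrix ι ι ℝ} (hP : P.PosSemidef) (hQ : Q.PosSemidef) :
    0 ≤ (P * Q).trace := by
  obtain ⟨U, l, h1, h2, h3, h4⟩ := spec P hP.isHermitian
  have hl : ∀ i, 0 ≤ l i := by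
    intro i
    have h := hP.dotProduct_mulVec_nonneg (U *ᵥ (Pi.single i 1))
    rw [star_trivial, h3, quad_conj_diag, Matrix.mulVec_mulVec, h1, Matrix.one_mulVec] at h
    simpa [Pi.single_apply] using h
  have e : (P * Q).trace = (diagonal l * (Uᴴ * Q * U)).trace := by
    rw [h3, mul_assoc, mul_assoc, Matrix.trace_mul_comm]
    simp only [mul_assoc]
  rw [e, Matrix.trace]
  refine Finset.sum_nonneg fun i _ => ?_
  rw [Matrix.diag_apply, Matrix.diagonal_mul]
  exact mul_nonneg (hl i) (hQ.conjTranspose_mul_mul_same U).diag_nonneg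

/-- trace of `e^A - A - 1` -/
def FF (A : Matrix ι ι ℝ) : ℝ := (exp A - A - 1).trace

lemma FF_zero : FF (0 : Matrix ι ι ℝ) = 0 := by
  simp [FF]

lemma FF_nonneg (A : Matrix ι ι ℝ) (hA : A.IsHermitian) : 0 ≤ FF A := (psi_psd A hA).trace_nonneg

lemma FF_continuous : Continuous (FF : Matrix ι ι ℝ → ℝ) := by
  unfold FF
  exact Continuous.matrix_trace ((continuous_matrix_exp.sub continuous_id).sub continuous_const)

lemma psi_mono {s t : ℝ} (hs : 0 ≤ s) (hst : s ≤ t) :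
    Real.exp s - s - 1 ≤ Real.exp t - t - 1 := by
  have h1 := Real.add_one_le_exp (t - s)
  have h2 : Real.exp t = Real.exp s * Real.exp (t - s) := by rw [← Real.exp_add]; ring_nf
  have h3 := Real.one_le_exp hs
  rw [h2]; nlinarith [Real.exp_pos s]

lemma FF_ge (A : Matrix ι ι ℝ) (hA : A.IsHermitian) (t : ℝ) (ht : 0 ≤ t) (c : ι → ℝ)
    (hc : t * (c ⬝ᵥ c) < c ⬝ᵥ (A *ᵥ c)) : Real.exp t - t - 1 ≤ FF A := by
  obtain ⟨U, l, h1, h2, h3, h4⟩ := spec A hA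
  have hi : ∃ i, t < l i := by
    by_contra! hcon
    rw [quad_one U h2, h3, quad_conj_diag, Finset.mul_sum] at hc
    exact absurd hc (not_lt.2 (Finset.sum_le_sum fun i _ =>
      mul_le_mul_of_nonneg_right (hcon i) (sq_nonneg _)))
  obtain ⟨i, hi⟩ := hi
  have e : FF A = ∑ i, (Real.exp (l i) - l i - 1) := by
    have e0 : FF A = (U * diagonal (fun i => Real.exp (l i) - l i - 1) * Uᴴ).trace := by
      have e : diagonal (fun i => Real.exp (l i) - l i - 1) =
        diagonal (fun i => Real.exp (l i)) - diagonal l - (1 : Matrix ι ι ℝ) := by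
        rw [← diagonal_one, diagonal_sub, diagonal_sub]
      rw [e, mul_sub, mul_sub, sub_mul, sub_mul, mul_one, h2, ← h3, ← h4]; rfl
    rw [e0, Matrix.trace_mul_comm, ← mul_assoc, h1, one_mul, Matrix.trace_diagonal]
  rw [e]
  refine (psi_mono ht hi.le).trans ?_
  exact Finset.single_le_sum (f := fun i => Real.exp (l i) - l i - 1)
    (fun j _ => by linarith [Real.add_one_le_exp (l j)]) (Finset.mem_univ i)

/-- key pointwise bound -/
lemma FF_add_le (A Z : Matrix ι ι ℝ) (hA : A.IsHermitian) (hZ : Z.IsHermitian)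
    (hb : ∀ c : ι → ℝ, |c ⬝ᵥ (Z *ᵥ c)| ≤ c ⬝ᵥ c) :
    FF (A + Z) ≤ FF A + (exp A * Z).trace + (exp A * (Z * Z)).trace - Z.trace := by
  have h1 := golden_thompson A Z hA hZ
  have h2 := trace_mul_psd (exp_psd A hA) (exp_le_quad Z hZ hb)
  rw [mul_sub, mul_add, mul_add, trace_sub, trace_add, trace_add, mul_one] at h2
  simp only [FF, trace_sub, trace_add]
  linarith

lemma trace_exp_mul_le (A V : Matrix ι ι ℝ) (hA : A.IsHermitian) (v : ℝ)
    (hV : (v • 1 - V).PosSemidef) :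
    (exp A * V).trace ≤ v * FF A + (A * V).trace + V.trace := by
  have h := trace_mul_psd (psi_psd A hA) hV
  rw [mul_sub, trace_sub, mul_smul_comm, mul_one, trace_smul, smul_eq_mul] at h
  have e : ((exp A - A - 1) * V).trace = (exp A * V).trace - (A * V).trace - V.trace := by
    rw [sub_mul, sub_mul, one_mul, trace_sub, trace_sub]
  rw [e] at h
  simp only [FF]
  linarith
end spectral

section prob
open NormedSpace

variable {X : Type} [TopologicalSpace X] [SecondCountableTopology X] [MeasurableSpace X] [BorelSpace X]

lemma integrable_comp {Ω : Type*} [TopologicalSpace Ω] [MeasurableSpace Ω] [OpensMeasurableSpace Ω]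
    (P : Measure Ω) [IsFiniteMeasure P] (G : Matrix ι ι ℝ → ℝ) (hG : Continuous G)
    (Y : Ω → Matrix ι ι ℝ) (hY : Continuous Y) (b : ℝ) (hb : ∀ x i j, |Y x i j| ≤ b) :
    Integrable (fun x => G (Y x)) P := by
  have hK : IsCompact {M : Matrix ι ι ℝ | ∀ i j, M i j ∈ Set.Icc (-b) b} := by
    have := isCompact_univ_pi (X := fun _ : ι => ι → ℝ) (s := fun _ => Set.univ.pi fun _ : ι => Set.Icc (-b) b)
      (fun i => isCompact_univ_pi (fun j => isCompact_Icc))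
    have e : {M : Matrix ι ι ℝ | ∀ i j, M i j ∈ Set.Icc (-b) b} =
        (Set.univ.pi fun _ => Set.univ.pi fun _ : ι => Set.Icc (-b) b : Set (ι → ι → ℝ)) := by
      apply Set.ext
      intro M
      exact ⟨fun h i _ j _ => h i j, fun h i j => h i trivial j trivial⟩
    rw [e]
    exact this
  obtain ⟨c, hc⟩ := (hK.image hG).isBounded.exists_norm_le
  refine Integrable.of_bound ((hG.comp hY).aestronglyMeasurable) c (Filter.Eventually.of_forall fun x => ?_)
  exact hc _ ⟨Y x, fun i j => abs_le.1 (hb x i j), rfl⟩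

/-- Hypotheses on a random matrix summand. -/
structure Good (ν : Measure X) (Z : X → Matrix ι ι ℝ) (V : Matrix ι ι ℝ) (v τ : ℝ) : Prop where
  cont : Continuous Z
  bdd : ∃ b : ℝ, ∀ x i j, |Z x i j| ≤ b
  herm : ∀ x, (Z x).IsHermitian
  small : ∀ x (c : ι → ℝ), |c ⬝ᵥ (Z x *ᵥ c)| ≤ c ⬝ᵥ c
  mean : ∀ i j, ∫ x, Z x i j ∂ν = 0
  var : ∀ i j, ∫ x, (Z x * Z x) i j ∂ν = V i j
  vpsd : (v • 1 - V).PosSemidef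
  vtr : V.trace ≤ τ * v
  vnn : 0 ≤ v

/-- the controlling functional -/
def GG (τ c : ℝ) (L : Matrix ι ι ℝ) (A : Matrix ι ι ℝ) : ℝ := c * (FF A + τ) - τ + (A * L).trace

lemma GG_continuous (τ c : ℝ) (L : Matrix ι ι ℝ) : Continuous (GG τ c L) := by
  unfold GG
  have := Continuous.matrix_trace ((continuous_id (X := Matrix ι ι ℝ)).matrix_mul (continuous_const (y := L)))
  exact ((continuous_const.mul (FF_continuous.add continuous_const)).sub continuous_const).add this

variable {ν : Measure X} [IsProbabilityMeasure ν] {Z : X → Matrix ι ι ℝ} {V : Matrix ι ι ℝ} {v τ : ℝ}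

lemma integral_trace_mul (M : Matrix ι ι ℝ) {Y : X → Matrix ι ι ℝ} {W : Matrix ι ι ℝ}
    (hint : ∀ i j, Integrable (fun x => Y x i j) ν) (hm : ∀ i j, ∫ x, Y x i j ∂ν = W i j) :
    ∫ x, (M * Y x).trace ∂ν = (M * W).trace := by
  have e : ∀ N : Matrix ι ι ℝ, (M * N).trace = ∑ i, ∑ j, M i j * N j i := fun N => by
    simp only [Matrix.trace, Matrix.diag_apply, Matrix.mul_apply]
  have h2 : ∀ i, Integrable (fun x => ∑ j, M i j * Y x j i) ν := fun i =>
    integrable_finsetSum _ fun j _ => (hint j i).const_mul (M i j)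
  calc ∫ x, (M * Y x).trace ∂ν = ∫ x, ∑ i, ∑ j, M i j * Y x j i ∂ν :=
        integral_congr_ae (Filter.Eventually.of_forall fun x => e (Y x))
    _ = ∑ i, ∫ x, ∑ j, M i j * Y x j i ∂ν := integral_finsetSum _ fun i _ => h2 i
    _ = ∑ i, ∑ j, ∫ x, M i j * Y x j i ∂ν := Finset.sum_congr rfl fun i _ =>
        integral_finsetSum _ fun j _ => (hint j i).const_mul (M i j)
    _ = ∑ i, ∑ j, M i j * W j i := Finset.sum_congr rfl fun i _ => Finset.sum_congr rfl fun j _ => by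
        rw [integral_const_mul, hm]
    _ = _ := (e W).symm

lemma Good.int (h : Good ν Z V v τ) (G : Matrix ι ι ℝ → ℝ) (hG : Continuous G) :
    Integrable (fun x => G (Z x)) ν := by
  obtain ⟨b, hb⟩ := h.bdd
  exact integrable_comp ν G hG Z h.cont b hb

lemma step (h : Good ν Z V v τ) (c : ℝ) (hc : 0 ≤ c) (L A : Matrix ι ι ℝ) (hA : A.IsHermitian) :
    ∫ x, GG τ c L (A + Z x) ∂ν ≤ GG τ (c * (1 + v)) (L + c • V) A := by
  have i1 : ∀ i j, Integrable (fun x => Z x i j) ν := fun i j =>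
    h.int (fun M => M i j) (continuous_id.matrix_elem i j)
  have i2 : ∀ i j, Integrable (fun x => (Z x * Z x) i j) ν := fun i j =>
    h.int (fun M => (M * M) i j) ((continuous_id.matrix_mul continuous_id).matrix_elem i j)
  have t1 : ∀ M : Matrix ι ι ℝ, ∫ x, (M * Z x).trace ∂ν = 0 := fun M => by
    rw [integral_trace_mul M (W := 0) i1 (fun i j => h.mean i j)]; simp
  have t2 : ∀ M : Matrix ι ι ℝ, ∫ x, (M * (Z x * Z x)).trace ∂ν = (M * V).trace := fun M =>
    integral_trace_mul M i2 h.var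
  have j1 : ∀ M : Matrix ι ι ℝ, Integrable (fun x => (M * Z x).trace) ν := fun M =>
    h.int (fun N => (M * N).trace) (Continuous.matrix_trace (continuous_const.matrix_mul continuous_id))
  have j2 : ∀ M : Matrix ι ι ℝ, Integrable (fun x => (M * (Z x * Z x)).trace) ν := fun M =>
    h.int (fun N => (M * (N * N)).trace) (Continuous.matrix_trace
      (continuous_const.matrix_mul (continuous_id.matrix_mul continuous_id)))
  have jG : Integrable (fun x => GG τ c L (A + Z x)) ν :=
    h.int (fun N => GG τ c L (A + N)) ((GG_continuous τ c L).comp (continuous_const.add continuous_id))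
  set K : ℝ := c * (FF A + τ) - τ + (A * L).trace with hK
  have pt : ∀ x, GG τ c L (A + Z x) ≤
      K + c * (exp A * Z x).trace + c * (exp A * (Z x * Z x)).trace - c * (1 * Z x).trace + (L * Z x).trace := by
    intro x
    have := mul_le_mul_of_nonneg_left (FF_add_le A (Z x) hA (h.herm x) (h.small x)) hc
    rw [GG, add_mul, trace_add, Matrix.trace_mul_comm (Z x) L, one_mul]
    nlinarith
  refine (integral_mono jG ?_ pt).trans ?_
  · exact (((((integrable_const K).add ((j1 _).const_mul c)).add ((j2 _).const_mul c)).sub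
      ((j1 _).const_mul c)).add (j1 _))
  · rw [integral_add ?_ (j1 _), integral_sub ?_ ((j1 _).const_mul c), integral_add ?_ ((j2 _).const_mul c),
      integral_add (integrable_const K) ((j1 _).const_mul c), integral_const_mul, integral_const_mul,
      integral_const_mul, t1, t1, t1, t2]
    · have := mul_le_mul_of_nonneg_left (trace_exp_mul_le A V hA v h.vpsd) hc
      have h3 := mul_le_mul_of_nonneg_left h.vtr hc
      simp only [integral_const, probReal_univ, one_smul]
      rw [GG, Matrix.mul_add A, mul_smul_comm, trace_add, trace_smul, smul_eq_mul, hK]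
      nlinarith
    · exact (integrable_const K).add ((j1 _).const_mul c)
    · exact ((integrable_const K).add ((j1 _).const_mul c)).add ((j2 _).const_mul c)
    · exact (((integrable_const K).add ((j1 _).const_mul c)).add ((j2 _).const_mul c)).sub
        ((j1 _).const_mul c)

lemma Good.sum_herm (h : Good ν Z V v τ) {n : ℕ} (xs : Fin n → X) : (∑ i, Z (xs i)).IsHermitian := by
  rw [Matrix.IsHermitian, Matrix.conjTranspose_sum]
  exact Finset.sum_congr rfl fun i _ => h.herm _

lemma Good.sum_cont (h : Good ν Z V v τ) (n : ℕ) : Continuous (fun xs : Fin n → X => ∑ i, Z (xs i)) :=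
  continuous_finsetSum _ fun i _ => h.cont.comp (continuous_apply i)

lemma Good.sum_bdd (h : Good ν Z V v τ) (n : ℕ) :
    ∃ b : ℝ, ∀ (xs : Fin n → X) i j, |(∑ k, Z (xs k)) i j| ≤ b := by
  obtain ⟨b, hb⟩ := h.bdd
  refine ⟨∑ _k : Fin n, b, fun xs i j => ?_⟩
  rw [Matrix.sum_apply]
  exact (Finset.abs_sum_le_sum_abs _ _).trans (Finset.sum_le_sum fun k _ => hb _ _ _)

lemma iterate (h : Good ν Z V v τ) (n : ℕ) : ∀ (c : ℝ) (hc : 0 ≤ c) (L : Matrix ι ι ℝ),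
    ∃ L' : Matrix ι ι ℝ, ∀ A : Matrix ι ι ℝ, A.IsHermitian →
      ∫ xs : Fin n → X, GG τ c L (A + ∑ i, Z (xs i)) ∂(Measure.pi fun _ => ν) ≤
        GG τ (c * (1 + v) ^ n) L' A := by
  induction n with
  | zero =>
    intro c hc L
    refine ⟨L, fun A hA => ?_⟩
    simp
  | succ n ih =>
    intro c hc L
    obtain ⟨L', hL'⟩ := ih c hc L
    have hv := h.vnn
    refine ⟨L' + (c * (1 + v) ^ n) • V, fun A hA => ?_⟩
    have mp := (measurePreserving_piFinSuccAbove (fun _ : Fin (n+1) => ν) 0).symm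
    rw [← mp.integral_comp']
    simp only [MeasurableEquiv.piFinSuccAbove_symm_apply, Fin.insertNthEquiv,
        Fin.sum_univ_succ, Fin.insertNth_zero', Equiv.coe_fn_mk, Fin.cons_zero, Fin.cons_succ]
    have hint : Integrable (fun x : X × (Fin n → X) => GG τ c L (A + (Z x.1 + ∑ i, Z (x.2 i))))
        (ν.prod (Measure.pi fun _ => ν)) := by
      obtain ⟨b, hb⟩ := h.bdd
      obtain ⟨b', hb'⟩ := h.sum_bdd n
      refine integrable_comp _ (fun M => GG τ c L (A + M)) ((GG_continuous τ c L).comp (continuous_const.add continuous_id))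
        (fun x : X × (Fin n → X) => Z x.1 + ∑ i, Z (x.2 i))
        ((h.cont.comp continuous_fst).add ((h.sum_cont n).comp continuous_snd)) (b + b') fun x i j => ?_
      exact (abs_add_le _ _).trans (add_le_add (hb _ _ _) (hb' _ _ _))
    refine (integral_prod _ hint).trans_le ?_
    have := step h (c * (1 + v) ^ n) (by positivity) L' A hA
    rw [mul_assoc, ← pow_succ] at this
    refine le_trans (integral_mono hint.integral_prod_left ?_ fun x => ?_) this
    · exact h.int (fun N => GG τ (c * (1 + v) ^ n) L' (A + N)) ((GG_continuous _ _ _).comp (continuous_const.add continuous_id))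
    · have := hL' (A + Z x) (hA.add (h.herm x))
      simpa only [add_assoc] using this

lemma two_sample {ν' : Measure X} [IsProbabilityMeasure ν'] {Z' : X → Matrix ι ι ℝ} {V' : Matrix ι ι ℝ} {v' : ℝ}
    (h : Good ν Z V v τ) (h' : Good ν' Z' V' v' τ) (n m : ℕ) :
    Integrable (fun ω : (Fin n → X) × (Fin m → X) => FF (∑ i, Z (ω.1 i) + ∑ j, Z' (ω.2 j)))
      ((Measure.pi fun _ => ν).prod (Measure.pi fun _ => ν')) ∧
    ∫ ω : (Fin n → X) × (Fin m → X), FF (∑ i, Z (ω.1 i) + ∑ j, Z' (ω.2 j))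
      ∂((Measure.pi fun _ => ν).prod (Measure.pi fun _ => ν')) ≤
      ((1 + v) ^ n * (1 + v') ^ m - 1) * τ := by
  have hint : Integrable (fun ω : (Fin n → X) × (Fin m → X) => FF (∑ i, Z (ω.1 i) + ∑ j, Z' (ω.2 j)))
      ((Measure.pi fun _ => ν).prod (Measure.pi fun _ => ν')) := by
    obtain ⟨b, hb⟩ := h.sum_bdd n
    obtain ⟨b', hb'⟩ := h'.sum_bdd m
    refine integrable_comp _ FF FF_continuous _
      (((h.sum_cont n).comp continuous_fst).add ((h'.sum_cont m).comp continuous_snd)) (b + b') fun x i j => ?_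
    exact (abs_add_le _ _).trans (add_le_add (hb _ _ _) (hb' _ _ _))
  refine ⟨hint, ?_⟩
  rw [integral_prod _ hint]
  obtain ⟨L', hL'⟩ := iterate h' m 1 zero_le_one 0
  have hv' := h'.vnn
  obtain ⟨L, hL⟩ := iterate h n (1 * (1 + v') ^ m) (by positivity) L'
  have h1 := hL 0 (by simp [Matrix.IsHermitian])
  have e : ∀ A : Matrix ι ι ℝ, GG τ 1 0 A = FF A := fun A => by simp [GG]
  simp only [e] at hL'
  have h2 : GG τ (1 * (1 + v') ^ m * (1 + v) ^ n) L 0 = ((1 + v) ^ n * (1 + v') ^ m - 1) * τ := by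
    simp [GG, FF_zero]; ring
  rw [h2] at h1
  refine le_trans (integral_mono hint.integral_prod_left ?_ fun x => ?_) h1
  · obtain ⟨b, hb⟩ := h.sum_bdd n
    exact integrable_comp _ (fun M => GG τ (1 * (1 + v') ^ m) L' (0 + M))
      ((GG_continuous _ _ _).comp (continuous_const.add continuous_id)) _ (h.sum_cont n) b hb
  · have := hL' (∑ i, Z (x i)) (h.sum_herm x)
    simpa only [zero_add] using this
end prob

section findim
variable {X : Type} [TopologicalSpace X] [SecondCountableTopology X] [MeasurableSpace X] [BorelSpace X]
  {ν : Measure X} [IsProbabilityMeasure ν]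

lemma integrable_comp_vec (z : X → ι → ℝ) (hz : Continuous z) (K : ℝ) (hK : ∀ x, z x ⬝ᵥ z x ≤ K)
    (g : (ι → ℝ) → ℝ) (hg : Continuous g) : Integrable (fun x => g (z x)) ν := by
  have hb : ∀ x i, z x i ∈ Set.Icc (-√K) (√K) := by
    intro x i
    rw [Set.mem_Icc, ← abs_le]
    apply Real.abs_le_sqrt
    refine le_trans ?_ (hK x)
    rw [sq]
    exact Finset.single_le_sum (f := fun i => z x i * z x i) (fun j _ => mul_self_nonneg _) (Finset.mem_univ i)
  have hc := isCompact_univ_pi (fun _ : ι => isCompact_Icc (a := -√K) (b := √K))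
  obtain ⟨c, hc⟩ := (hc.image hg).isBounded.exists_norm_le
  refine Integrable.of_bound ((hg.comp hz).aestronglyMeasurable) c (Filter.Eventually.of_forall fun x => ?_)
  exact hc _ ⟨z x, fun i _ => hb x i, rfl⟩

/-- second moment matrix -/
def mom (ν : Measure X) (z : X → ι → ℝ) : Matrix ι ι ℝ := Matrix.of fun i j => ∫ x, z x i * z x j ∂ν

/-- the summand -/
def ZZ (ν : Measure X) (z : X → ι → ℝ) (w : ℝ) (x : X) : Matrix ι ι ℝ :=
  w • (vecMulVec (z x) (z x) - mom ν z)

lemma trace_vv (c d : ι → ℝ) (Y : Matrix ι ι ℝ) : (vecMulVec c d * Y).trace = d ⬝ᵥ (Y *ᵥ c) := by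
  rw [Matrix.vecMulVec_mul, Matrix.trace_vecMulVec, Matrix.dotProduct_mulVec, dotProduct_comm]

lemma mom_quad (z : X → ι → ℝ) (hz : Continuous z) (K : ℝ) (hK : ∀ x, z x ⬝ᵥ z x ≤ K) (c d : ι → ℝ) :
    c ⬝ᵥ (mom ν z *ᵥ d) = ∫ x, (c ⬝ᵥ z x) * (z x ⬝ᵥ d) ∂ν := by
  rw [← trace_vv, ← integral_trace_mul (ν := ν) _ (Y := fun x => vecMulVec (z x) (z x)) (W := mom ν z)]
  · refine integral_congr_ae (Filter.Eventually.of_forall fun x => ?_)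
    simp only
    rw [trace_vv, Matrix.vecMulVec_mulVec]
    simp [dotProduct_smul]
    ring
  · intro i j
    exact integrable_comp_vec z hz K hK (fun y => y i * y j) (by fun_prop)
  · intro i j
    rfl

lemma mom_herm (z : X → ι → ℝ) : (mom ν z).IsHermitian := by
  ext i j
  simp [mom, mul_comm]

lemma ZZ_herm (z : X → ι → ℝ) (w : ℝ) (x : X) : (ZZ ν z w x).IsHermitian := by
  ext i j
  have := congrFun (congrFun (mom_herm (ν := ν) z) i) j
  simp [ZZ, vecMulVec_apply] at this ⊢
  rw [this, mul_comm (z x j)]; simp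

lemma cs_vec (a b : ι → ℝ) : (a ⬝ᵥ b) ^ 2 ≤ (a ⬝ᵥ a) * (b ⬝ᵥ b) := by
  have := Finset.sum_mul_sq_le_sq_mul_sq Finset.univ a b
  simpa [dotProduct, sq] using this

lemma dot_self_nonneg (a : ι → ℝ) : 0 ≤ a ⬝ᵥ a := Finset.sum_nonneg fun _ _ => mul_self_nonneg _

lemma good_ZZ (z : X → ι → ℝ) (hz : Continuous z) (K : ℝ) (hK0 : 0 ≤ K) (hK : ∀ x, z x ⬝ᵥ z x ≤ K)
    (w a : ℝ) (hw : |w| * K ≤ 1) (ha : 0 < a) (ha1 : a ≤ 1)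
    (hM : ∀ c : ι → ℝ, a * (c ⬝ᵥ (mom ν z *ᵥ c)) ≤ c ⬝ᵥ c) :
    Good ν (ZZ ν z w) (Matrix.of fun i j => ∫ x, (ZZ ν z w x * ZZ ν z w x) i j ∂ν) (w ^ 2 * K / a) K := by
  have hint := fun g hg => integrable_comp_vec (ν := ν) z hz K hK g hg
  have hcont : Continuous (ZZ ν z w) := by
    unfold ZZ
    exact ((hz.matrix_vecMulVec hz).sub continuous_const).const_smul w
  have hq0 : ∀ c, 0 ≤ c ⬝ᵥ (mom ν z *ᵥ c) := fun c => by
    rw [mom_quad z hz K hK]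
    refine integral_nonneg fun x => ?_
    simp only [Pi.zero_apply]
    rw [dotProduct_comm (z x) c]; exact mul_self_nonneg _
  have hzc : ∀ x c, (c ⬝ᵥ z x) ^ 2 ≤ K * (c ⬝ᵥ c) := fun x c => by
    have := cs_vec c (z x)
    nlinarith [hK x, dot_self_nonneg c]
  have hq1 : ∀ c, c ⬝ᵥ (mom ν z *ᵥ c) ≤ K * (c ⬝ᵥ c) := fun c => by
    rw [mom_quad z hz K hK]
    have : ∫ x, (c ⬝ᵥ z x) * (z x ⬝ᵥ c) ∂ν ≤ ∫ x, K * (c ⬝ᵥ c) ∂ν := by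
      refine integral_mono (hint (fun y => (c ⬝ᵥ y) * (y ⬝ᵥ c)) (by fun_prop)) (integrable_const _) fun x => ?_
      simp only
      rw [dotProduct_comm (z x) c, ← sq]; exact hzc x c
    simpa using this
  have hquad : ∀ x c, c ⬝ᵥ (ZZ ν z w x *ᵥ c) = w * ((c ⬝ᵥ z x) ^ 2 - c ⬝ᵥ (mom ν z *ᵥ c)) := fun x c => by
    rw [ZZ, Matrix.smul_mulVec, Matrix.sub_mulVec, Matrix.vecMulVec_mulVec, dotProduct_smul, dotProduct_sub]
    simp [dotProduct_smul, dotProduct_comm (z x) c, sq]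
  have hZZint : ∀ i j, Integrable (fun x => (ZZ ν z w x * ZZ ν z w x) i j) ν := fun i j => by
    refine hint (fun y => ((w • (vecMulVec y y - mom ν z)) * (w • (vecMulVec y y - mom ν z))) i j) ?_
    have : Continuous fun y : ι → ℝ => w • (vecMulVec y y - mom ν z) :=
      ((continuous_id.matrix_vecMulVec continuous_id).sub continuous_const).const_smul w
    exact (this.matrix_mul this).matrix_elem i j
  set V : Matrix ι ι ℝ := Matrix.of fun i j => ∫ x, (ZZ ν z w x * ZZ ν z w x) i j ∂ν with hV
  have hVq : ∀ c, c ⬝ᵥ (V *ᵥ c) ≤ w ^ 2 * K * (c ⬝ᵥ (mom ν z *ᵥ c)) := by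
    intro c
    have e1 : c ⬝ᵥ (V *ᵥ c) = ∫ x, c ⬝ᵥ ((ZZ ν z w x * ZZ ν z w x) *ᵥ c) ∂ν := by
      rw [← trace_vv, ← integral_trace_mul (ν := ν) _ (Y := fun x => ZZ ν z w x * ZZ ν z w x) (W := V) hZZint
        (fun i j => rfl)]
      simp only [trace_vv]
    set d := mom ν z *ᵥ c with hd
    have e2 : ∀ x, c ⬝ᵥ ((ZZ ν z w x * ZZ ν z w x) *ᵥ c) =
        w ^ 2 * ((c ⬝ᵥ z x) ^ 2 * (z x ⬝ᵥ z x) - 2 * ((c ⬝ᵥ z x) * (z x ⬝ᵥ d)) + d ⬝ᵥ d) := by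
      intro x
      have hZc : ZZ ν z w x *ᵥ c = w • ((c ⬝ᵥ z x) • z x - d) := by
        rw [ZZ, Matrix.smul_mulVec, Matrix.sub_mulVec, Matrix.vecMulVec_mulVec]
        simp [dotProduct_comm (z x) c, hd]
      rw [← Matrix.mulVec_mulVec, Matrix.dotProduct_mulVec, ← Matrix.mulVec_transpose]
      have : (ZZ ν z w x)ᵀ = ZZ ν z w x := by
        have := ZZ_herm (ν := ν) z w x
        rwa [Matrix.IsHermitian, Matrix.conjTranspose_eq_transpose_of_trivial] at this
      rw [this, hZc]
      simp only [dotProduct_smul, smul_dotProduct, dotProduct_sub, sub_dotProduct, smul_eq_mul,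
        dotProduct_comm d (z x)]
      ring
    have i1 : Integrable (fun x => (c ⬝ᵥ z x) * (z x ⬝ᵥ d)) ν := hint (fun y => (c ⬝ᵥ y) * (y ⬝ᵥ d)) (by fun_prop)
    have i2 : Integrable (fun x => (c ⬝ᵥ z x) * (z x ⬝ᵥ c)) ν := hint (fun y => (c ⬝ᵥ y) * (y ⬝ᵥ c)) (by fun_prop)
    have e3 : d ⬝ᵥ d = ∫ x, (c ⬝ᵥ z x) * (z x ⬝ᵥ d) ∂ν := by
      rw [← mom_quad z hz K hK]
      conv_lhs => rw [hd]
      rw [Matrix.dotProduct_mulVec c, ← Matrix.mulVec_transpose]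
      have : (mom ν z)ᵀ = mom ν z := by
        have := mom_herm (ν := ν) z
        rwa [Matrix.IsHermitian, Matrix.conjTranspose_eq_transpose_of_trivial] at this
      rw [this]
    rw [e1]
    simp only [e2]
    have hle : ∫ x, w ^ 2 * ((c ⬝ᵥ z x) ^ 2 * (z x ⬝ᵥ z x) - 2 * ((c ⬝ᵥ z x) * (z x ⬝ᵥ d)) + d ⬝ᵥ d) ∂ν ≤
        ∫ x, w ^ 2 * (K * ((c ⬝ᵥ z x) * (z x ⬝ᵥ c)) - 2 * ((c ⬝ᵥ z x) * (z x ⬝ᵥ d)) + d ⬝ᵥ d) ∂ν := by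
      refine integral_mono ?_ ?_ fun x => ?_
      · exact hint (fun y => w ^ 2 * ((c ⬝ᵥ y) ^ 2 * (y ⬝ᵥ y) - 2 * ((c ⬝ᵥ y) * (y ⬝ᵥ d)) + d ⬝ᵥ d)) (by fun_prop)
      · exact hint (fun y => w ^ 2 * (K * ((c ⬝ᵥ y) * (y ⬝ᵥ c)) - 2 * ((c ⬝ᵥ y) * (y ⬝ᵥ d)) + d ⬝ᵥ d)) (by fun_prop)
      · simp only
        rw [dotProduct_comm (z x) c, ← sq]
        have := mul_le_mul_of_nonneg_left (hK x) (sq_nonneg (c ⬝ᵥ z x))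
        refine mul_le_mul_of_nonneg_left ?_ (sq_nonneg w)
        linarith
    refine hle.trans ?_
    have i3 : Integrable (fun x => K * ((c ⬝ᵥ z x) * (z x ⬝ᵥ c)) - 2 * ((c ⬝ᵥ z x) * (z x ⬝ᵥ d))) ν :=
      (i2.const_mul K).sub (i1.const_mul 2)
    have e4 : c ⬝ᵥ d = ∫ x, (c ⬝ᵥ z x) * (z x ⬝ᵥ c) ∂ν := by
      rw [hd]; exact mom_quad z hz K hK c c
    rw [integral_const_mul, integral_add i3 (integrable_const _),
      integral_sub (i2.const_mul K) (i1.const_mul 2), integral_const_mul, integral_const_mul, ← e3, ← e4]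
    simp only [integral_const, probReal_univ, one_smul]
    have : 0 ≤ w ^ 2 * (d ⬝ᵥ d) := mul_nonneg (sq_nonneg _) (dot_self_nonneg d)
    nlinarith
  have hVherm : V.IsHermitian := by
    ext i j
    simp only [hV, Matrix.conjTranspose_apply, Matrix.of_apply, star_trivial]
    refine integral_congr_ae (Filter.Eventually.of_forall fun x => ?_)
    have h := ZZ_herm (ν := ν) z w x
    have h2 : (ZZ ν z w x * ZZ ν z w x).IsHermitian := by
      rw [Matrix.IsHermitian, Matrix.conjTranspose_mul, h.eq]
    have := congrFun (congrFun h2 i) j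
    simpa using this
  have hwK : 0 ≤ w ^ 2 * K := by positivity
  refine ⟨hcont, ?_, ZZ_herm z w, ?_, ?_, fun i j => rfl, ?_, ?_, by positivity⟩
  · have hsq : ∀ x i, |z x i| ≤ √K := by
      intro x i
      apply Real.abs_le_sqrt
      refine le_trans ?_ (hK x)
      rw [sq]
      exact Finset.single_le_sum (f := fun i => z x i * z x i) (fun j _ => mul_self_nonneg _) (Finset.mem_univ i)
    refine ⟨|w| * (√K * √K + ∑ i, ∑ j, |mom ν z i j|), fun x i j => ?_⟩
    have : ZZ ν z w x i j = w * (z x i * z x j - mom ν z i j) := by simp [ZZ, vecMulVec_apply]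
    rw [this, abs_mul]
    gcongr
    refine (abs_sub _ _).trans ?_
    rw [abs_mul]
    have h1 : |mom ν z i j| ≤ ∑ j, |mom ν z i j| :=
      Finset.single_le_sum (f := fun j => |mom ν z i j|) (fun _ _ => abs_nonneg _) (Finset.mem_univ j)
    have h2 : ∑ j, |mom ν z i j| ≤ ∑ i, ∑ j, |mom ν z i j| :=
      Finset.single_le_sum (f := fun i => ∑ j, |mom ν z i j|) (fun _ _ => Finset.sum_nonneg fun _ _ => abs_nonneg _) (Finset.mem_univ i)
    gcongr
    · exact hsq x i
    · exact hsq x j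
    · exact h1.trans h2
  · intro x c
    rw [hquad, abs_mul]
    have : |(c ⬝ᵥ z x) ^ 2 - c ⬝ᵥ (mom ν z *ᵥ c)| ≤ K * (c ⬝ᵥ c) := by
      rw [abs_le]
      constructor <;> nlinarith [hzc x c, hq0 c, hq1 c, sq_nonneg (c ⬝ᵥ z x)]
    calc _ ≤ |w| * (K * (c ⬝ᵥ c)) := by gcongr
      _ = (|w| * K) * (c ⬝ᵥ c) := by ring
      _ ≤ 1 * (c ⬝ᵥ c) := mul_le_mul_of_nonneg_right hw (dot_self_nonneg c)
      _ = _ := one_mul _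
  · intro i j
    have : ∀ x, ZZ ν z w x i j = w * (z x i * z x j - mom ν z i j) := fun x => by simp [ZZ, vecMulVec_apply]
    simp only [this]
    rw [integral_const_mul, integral_sub (hint (fun y => y i * y j) (by fun_prop)) (integrable_const _)]
    simp [mom]
  · refine PosSemidef.of_dotProduct_mulVec_nonneg ?_ fun c => ?_
    · refine Matrix.IsHermitian.sub ?_ hVherm
      rw [Matrix.IsHermitian, Matrix.conjTranspose_smul]; simp
    · rw [star_trivial, Matrix.sub_mulVec, dotProduct_sub, Matrix.smul_mulVec, Matrix.one_mulVec, dotProduct_smul,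
        smul_eq_mul]
      have h1 := hVq c
      have h2 : w ^ 2 * K * (c ⬝ᵥ (mom ν z *ᵥ c)) ≤ w ^ 2 * K / a * (c ⬝ᵥ c) := by
        calc _ = w ^ 2 * K / a * (a * (c ⬝ᵥ (mom ν z *ᵥ c))) := by field_simp
          _ ≤ _ := mul_le_mul_of_nonneg_left (hM c) (by positivity)
      linarith
  · have h1 : V.trace ≤ ∑ i, w ^ 2 * K * mom ν z i i := by
      refine Finset.sum_le_sum fun i _ => ?_
      have := hVq (Pi.single i 1)
      simpa using this
    have h2 : ∑ i, mom ν z i i ≤ K := by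
      have : ∑ i, mom ν z i i = ∫ x, z x ⬝ᵥ z x ∂ν := by
        simp only [dotProduct]
        rw [integral_finsetSum _ (fun i _ => hint (fun y => y i * y i) (by fun_prop))]
        rfl
      rw [this]
      have : ∫ x, z x ⬝ᵥ z x ∂ν ≤ ∫ x, K ∂ν := integral_mono (hint (fun y => y ⬝ᵥ y) (by fun_prop)) (integrable_const _) hK
      simpa using this
    rw [← Finset.mul_sum] at h1
    have h3 : w ^ 2 * K ≤ w ^ 2 * K / a := by
      rw [le_div_iff₀ ha]; nlinarith
    nlinarith
end findim

section tail
variable {X : Type} [TopologicalSpace X] [SecondCountableTopology X] [MeasurableSpace X] [BorelSpace X]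

lemma ZZ_quad (ν : Measure X) (z : X → ι → ℝ) (w : ℝ) (x : X) (c : ι → ℝ) :
    c ⬝ᵥ (ZZ ν z w x *ᵥ c) = w * ((c ⬝ᵥ z x) ^ 2 - c ⬝ᵥ (mom ν z *ᵥ c)) := by
  rw [ZZ, Matrix.smul_mulVec, Matrix.sub_mulVec, Matrix.vecMulVec_mulVec, dotProduct_smul, dotProduct_sub]
  simp [dotProduct_smul, dotProduct_comm (z x) c, sq]

lemma one_add_pow_le (v : ℝ) (hv : 0 ≤ v) (n : ℕ) : (1 + v) ^ n ≤ Real.exp (n * v) := by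
  rw [Real.exp_nat_mul]
  gcongr
  linarith [Real.add_one_le_exp v]

lemma markov_scalar (y : ℝ) (hy : 0 < y) :
    (Real.exp y - 1) / (Real.exp (2 * y) - 2 * y - 1) ≤ 1 / (Real.exp y - 1) := by
  have h1 : y + 1 < Real.exp y := Real.add_one_lt_exp hy.ne'
  have h2 : Real.exp (2 * y) = Real.exp y ^ 2 := by rw [← Real.exp_nat_mul]; norm_num
  have h3 : 2 * y + 1 < Real.exp (2 * y) := Real.add_one_lt_exp (by positivity)
  rw [div_le_div_iff₀ (by linarith) (by linarith), h2]
  nlinarith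

variable (p q : Measure X) [IsProbabilityMeasure p] [IsProbabilityMeasure q]

lemma tail_one (z : X → ι → ℝ) (hz : Continuous z) (K : ℝ) (hK0 : 0 < K) (hK : ∀ x, z x ⬝ᵥ z x ≤ K)
    (α : ℝ) (hα : 0 < α) (hα1 : α < 1)
    (hM : ∀ c : ι → ℝ, α * (c ⬝ᵥ (mom p z *ᵥ c)) + (1 - α) * (c ⬝ᵥ (mom q z *ᵥ c)) ≤ c ⬝ᵥ c)
    (n m N : ℕ) (hN : 0 < N) (hn : N ≤ n) (hm : N ≤ m) (u : ℝ) (hu : 0 < u) (hu1 : u < 1)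
    (s : ℝ) (hs : s = 1 ∨ s = -1) :
    ((Measure.pi fun _ : Fin n => p).prod (Measure.pi fun _ : Fin m => q))
      {ω | ∃ c : ι → ℝ, u * (c ⬝ᵥ c) <
        s * (α * ((n : ℝ)⁻¹ * ∑ i, (c ⬝ᵥ z (ω.1 i)) ^ 2 - c ⬝ᵥ (mom p z *ᵥ c)) +
          (1 - α) * ((m : ℝ)⁻¹ * ∑ j, (c ⬝ᵥ z (ω.2 j)) ^ 2 - c ⬝ᵥ (mom q z *ᵥ c)))} ≤
      ENNReal.ofReal (K / (Real.exp (N * u ^ 2 / (4 * K)) - 1)) := by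
  set y := N * u ^ 2 / (4 * K) with hy
  have hN' : (0 : ℝ) < N := by exact_mod_cast hN
  have hn' : (N : ℝ) ≤ n := by exact_mod_cast hn
  have hm' : (N : ℝ) ≤ m := by exact_mod_cast hm
  have hnp : (0 : ℝ) < n := by linarith
  have hmp : (0 : ℝ) < m := by linarith
  have hy0 : 0 < y := by positivity
  set θ := u * N / (2 * K) with hθ
  have hθ0 : 0 < θ := by positivity
  have hθK : θ * K = u * N / 2 := by rw [hθ]; field_simp
  have hθu : θ * u = 2 * y := by rw [hθ, hy]; field_simp; ring
  have hs2 : s ^ 2 = 1 := by rcases hs with h | h <;> rw [h] <;> norm_num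
  have hsa : |s| = 1 := by rcases hs with h | h <;> rw [h] <;> norm_num
  have hq0 : ∀ (ν : Measure X) [IsProbabilityMeasure ν] c, 0 ≤ c ⬝ᵥ (mom ν z *ᵥ c) := fun ν _ c => by
    rw [mom_quad z hz K hK]
    refine integral_nonneg fun x => ?_
    simp only [Pi.zero_apply]
    rw [dotProduct_comm (z x) c]; exact mul_self_nonneg _
  have hw : ∀ (a r : ℝ), 0 < a → a ≤ 1 → N ≤ r → |s * (θ * a / r)| * K ≤ 1 := by
    intro a r ha ha1 hr
    have hr0 : 0 < r := by linarith
    rw [abs_mul, hsa, one_mul, abs_of_nonneg (by positivity), div_mul_eq_mul_div, div_le_one hr0]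
    have : θ * a * K = a * (u * N / 2) := by rw [← hθK]; ring
    rw [this]
    have : a * (u * N / 2) ≤ 1 * (u * N / 2) := by gcongr
    nlinarith
  have gp := good_ZZ (ν := p) z hz K hK0.le hK (s * (θ * α / n)) α (hw α n hα hα1.le hn') hα hα1.le
    (fun c => by nlinarith [hM c, hq0 q c])
  have gq := good_ZZ (ν := q) z hz K hK0.le hK (s * (θ * (1 - α) / m)) (1 - α)
    (hw (1 - α) m (by linarith) (by linarith) hm') (by linarith) (by linarith)
    (fun c => by nlinarith [hM c, hq0 p c])
  obtain ⟨hint, hle⟩ := two_sample gp gq n m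
  set P := (Measure.pi fun _ : Fin n => p).prod (Measure.pi fun _ : Fin m => q) with hP
  set F : (Fin n → X) × (Fin m → X) → ℝ := fun ω =>
    FF (∑ i, ZZ p z (s * (θ * α / n)) (ω.1 i) + ∑ j, ZZ q z (s * (θ * (1 - α) / m)) (ω.2 j)) with hF
  have hherm : ∀ ω : (Fin n → X) × (Fin m → X),
      (∑ i, ZZ p z (s * (θ * α / n)) (ω.1 i) + ∑ j, ZZ q z (s * (θ * (1 - α) / m)) (ω.2 j)).IsHermitian := by
    intro ω
    exact (gp.sum_herm _).add (gq.sum_herm _)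
  have hF0 : 0 ≤ᵐ[P] F := Filter.Eventually.of_forall fun ω => FF_nonneg _ (hherm ω)
  have hE : 0 < Real.exp (2 * y) - 2 * y - 1 := by
    linarith [Real.add_one_lt_exp (show 2 * y ≠ 0 by positivity)]
  have hexp : 1 < Real.exp y := by simpa using hy0
  have hvv : ((1 + (s * (θ * α / n)) ^ 2 * K / α) ^ n * (1 + (s * (θ * (1 - α) / m)) ^ 2 * K / (1 - α)) ^ m - 1) * K
      ≤ (Real.exp y - 1) * K := by
    have h1a : 0 < 1 - α := by linarith
    have hb : ∀ (a : ℝ) (r : ℕ), 0 < a → (N : ℝ) ≤ r →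
        (1 + (s * (θ * a / r)) ^ 2 * K / a) ^ r ≤ Real.exp (a * y) := by
      intro a r ha hr
      have hr0 : (0 : ℝ) < r := by linarith
      refine (one_add_pow_le _ (by positivity) r).trans (Real.exp_le_exp.2 ?_)
      have : (r : ℝ) * ((s * (θ * a / r)) ^ 2 * K / a) = a * (θ * (θ * K)) / r := by
        rw [mul_pow, hs2]; field_simp
      rw [this, hθK, div_le_iff₀ hr0]
      have : a * (θ * (u * N / 2)) = a * y * N := by
        have : θ * (u * N / 2) = (θ * u) * N / 2 := by ring
        rw [this, hθu]; ring
      rw [this]; gcongr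
    gcongr
    calc _ ≤ Real.exp (α * y) * Real.exp ((1 - α) * y) := by
          gcongr
          · exact hb α n hα hn'
          · exact hb (1 - α) m h1a hm'
      _ = Real.exp y := by rw [← Real.exp_add]; congr 1; ring
  have hmk := mul_meas_ge_le_integral_of_nonneg hF0 hint (Real.exp (2 * y) - 2 * y - 1)
  have hreal : P.real {x | Real.exp (2 * y) - 2 * y - 1 ≤ F x} ≤ K / (Real.exp y - 1) := by
    have h1 : P.real {x | Real.exp (2 * y) - 2 * y - 1 ≤ F x} ≤ ((Real.exp y - 1) * K) / (Real.exp (2 * y) - 2 * y - 1) := by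
      rw [le_div_iff₀ hE, mul_comm]
      exact hmk.trans (hle.trans hvv)
    refine h1.trans ?_
    have := mul_le_mul_of_nonneg_left (markov_scalar y hy0) hK0.le
    calc _ = K * ((Real.exp y - 1) / (Real.exp (2 * y) - 2 * y - 1)) := by ring
      _ ≤ _ := this
      _ = _ := by ring
  calc P _ ≤ P {x | Real.exp (2 * y) - 2 * y - 1 ≤ F x} := by
        refine measure_mono ?_
        rintro ω ⟨c, hc⟩
        refine FF_ge _ (hherm ω) (2 * y) (by positivity) c ?_
        rw [Matrix.add_mulVec, dotProduct_add, Matrix.sum_mulVec, Matrix.sum_mulVec, dotProduct_sum, dotProduct_sum]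
        simp only [ZZ_quad]
        rw [← Finset.mul_sum, ← Finset.mul_sum, Finset.sum_sub_distrib, Finset.sum_sub_distrib]
        simp only [Finset.sum_const, Finset.card_univ, Fintype.card_fin, nsmul_eq_mul]
        rw [← hθu]
        have := mul_lt_mul_of_pos_left hc hθ0
        refine lt_of_eq_of_lt (by ring) (lt_of_lt_of_eq this ?_)
        field_simp
    _ = ENNReal.ofReal (P.real {x | Real.exp (2 * y) - 2 * y - 1 ≤ F x}) := by
        rw [ofReal_measureReal]
    _ ≤ _ := ENNReal.ofReal_le_ofReal hreal

lemma final_scalar (K u : ℝ) (N : ℕ) (hK : 0 < K) (hN : 0 < N) (hu : 0 < u) (hu1 : u < 1) :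
    K / (Real.exp (N * u ^ 2 / (4 * K)) - 1) + K / (Real.exp (N * u ^ 2 / (4 * K)) - 1) ≤
      2 * K * (1 + 48 / (u ^ 4 * N) * (K + u / 6) ^ 2) * Real.exp (-(N * u ^ 2 / (8 * (K + u / 6)))) := by
  have hN' : (0 : ℝ) < N := by exact_mod_cast hN
  set y := N * u ^ 2 / (4 * K) with hy
  have hy0 : 0 < y := by positivity
  have hexp : y + 1 < Real.exp y := Real.add_one_lt_exp hy0.ne'
  have h1 : 1 / (Real.exp y - 1) ≤ (1 + 1 / y) * Real.exp (-(y / 2)) := by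
    rw [div_le_iff₀ (by linarith), Real.exp_neg]
    have e : Real.exp y = Real.exp (y / 2) ^ 2 := by rw [← Real.exp_nat_mul]; congr 1; push_cast; ring
    have e0 : 1 ≤ Real.exp (y / 2) := Real.one_le_exp (by positivity)
    have e1 : Real.exp y ≤ (1 + 1 / y) * (Real.exp y - 1) := by
      have : 1 / y * y = 1 := by field_simp
      have : 0 < 1 / y := by positivity
      nlinarith
    have e2 : Real.exp (y / 2) ≤ (1 + 1 / y) * (Real.exp y - 1) := by
      refine le_trans ?_ e1
      rw [e]; nlinarith
    calc (1 : ℝ) = Real.exp (y / 2) * (Real.exp (y / 2))⁻¹ := by field_simp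
      _ ≤ ((1 + 1 / y) * (Real.exp y - 1)) * (Real.exp (y / 2))⁻¹ := by gcongr
      _ = _ := by ring
  have h2 : 1 / y ≤ 48 / (u ^ 4 * N) * (K + u / 6) ^ 2 := by
    have : 1 / y = 4 * K * u ^ 2 / (u ^ 4 * N) := by rw [hy]; field_simp
    rw [this, div_mul_eq_mul_div]
    refine div_le_div_of_nonneg_right ?_ (by positivity)
    have : K * u ^ 2 ≤ K * u := by
      refine mul_le_mul_of_nonneg_left ?_ hK.le
      nlinarith
    nlinarith [sq_nonneg (K - u / 6), mul_pos hK hu]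
  have h3 : Real.exp (-(y / 2)) ≤ Real.exp (-(N * u ^ 2 / (8 * (K + u / 6)))) := by
    apply Real.exp_le_exp.2
    have : y / 2 = N * u ^ 2 / (8 * K) := by rw [hy]; field_simp; norm_num
    rw [this, neg_le_neg_iff]
    gcongr
    linarith
  calc _ = 2 * K * (1 / (Real.exp y - 1)) := by ring
    _ ≤ 2 * K * ((1 + 1 / y) * Real.exp (-(y / 2))) := by gcongr
    _ ≤ 2 * K * ((1 + 48 / (u ^ 4 * N) * (K + u / 6) ^ 2) * Real.exp (-(N * u ^ 2 / (8 * (K + u / 6))))) := by gcongr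
    _ = _ := by ring

lemma tail_two (z : X → ι → ℝ) (hz : Continuous z) (K : ℝ) (hK0 : 0 < K) (hK : ∀ x, z x ⬝ᵥ z x ≤ K)
    (α : ℝ) (hα : 0 < α) (hα1 : α < 1)
    (hM : ∀ c : ι → ℝ, α * (c ⬝ᵥ (mom p z *ᵥ c)) + (1 - α) * (c ⬝ᵥ (mom q z *ᵥ c)) ≤ c ⬝ᵥ c)
    (n m N : ℕ) (hN : 0 < N) (hn : N ≤ n) (hm : N ≤ m) (u : ℝ) (hu : 0 < u) (hu1 : u < 1) :
    ((Measure.pi fun _ : Fin n => p).prod (Measure.pi fun _ : Fin m => q))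
      {ω | ∃ c : ι → ℝ, u * (c ⬝ᵥ c) <
        |α * ((n : ℝ)⁻¹ * ∑ i, (c ⬝ᵥ z (ω.1 i)) ^ 2 - c ⬝ᵥ (mom p z *ᵥ c)) +
          (1 - α) * ((m : ℝ)⁻¹ * ∑ j, (c ⬝ᵥ z (ω.2 j)) ^ 2 - c ⬝ᵥ (mom q z *ᵥ c))|} ≤
      ENNReal.ofReal (2 * K * (1 + 48 / (u ^ 4 * N) * (K + u / 6) ^ 2) *
        Real.exp (-(N * u ^ 2 / (8 * (K + u / 6))))) := by
  have t1 := tail_one p q z hz K hK0 hK α hα hα1 hM n m N hN hn hm u hu hu1 1 (Or.inl rfl)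
  have t2 := tail_one p q z hz K hK0 hK α hα hα1 hM n m N hN hn hm u hu hu1 (-1) (Or.inr rfl)
  have hy : 0 < N * u ^ 2 / (4 * K) := by
    have hN' : (0 : ℝ) < N := by exact_mod_cast hN
    positivity
  have hx : 0 ≤ K / (Real.exp (N * u ^ 2 / (4 * K)) - 1) := by
    apply div_nonneg hK0.le
    linarith [Real.add_one_le_exp (N * u ^ 2 / (4 * K))]
  refine le_trans ?_ (ENNReal.ofReal_le_ofReal (final_scalar K u N hK0 hN hu hu1))
  rw [ENNReal.ofReal_add hx hx]
  refine le_trans (le_trans (measure_mono ?_) (measure_union_le _ _)) (add_le_add t1 t2)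
  rintro ω ⟨c, hc⟩
  rcases lt_abs.1 hc with h | h
  · exact Or.inl ⟨c, by rw [one_mul]; exact h⟩
  · exact Or.inr ⟨c, by rw [neg_one_mul]; exact h⟩
end tail

section red
variable {X : Type} [TopologicalSpace X] [SecondCountableTopology X] [MeasurableSpace X] [BorelSpace X] [Nonempty X]
variable (p q : Measure X) [IsProbabilityMeasure p] [IsProbabilityMeasure q]
variable {H : Type*} [NormedAddCommGroup H] [InnerProductSpace ℝ H] [CompleteSpace H]

lemma tail_sub (ζ : X → H) (hζ : Continuous ζ) (K : ℝ) (hK0 : 0 < K) (hK : ∀ x, ‖ζ x‖ ^ 2 ≤ K)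
    (α : ℝ) (hα : 0 < α) (hα1 : α < 1)
    (hM : ∀ v : H, α * (∫ x, ⟪v, ζ x⟫ ^ 2 ∂p) + (1 - α) * (∫ x, ⟪v, ζ x⟫ ^ 2 ∂q) ≤ ‖v‖ ^ 2)
    (n m N : ℕ) (hN : 0 < N) (hn : N ≤ n) (hm : N ≤ m) (u : ℝ) (hu : 0 < u) (hu1 : u < 1)
    (U : Submodule ℝ H) [FiniteDimensional ℝ U] :
    ((Measure.pi fun _ : Fin n => p).prod (Measure.pi fun _ : Fin m => q))
      {ω | ∃ v ∈ U, u * ‖v‖ ^ 2 <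
        |α * ((n : ℝ)⁻¹ * ∑ i, ⟪v, ζ (ω.1 i)⟫ ^ 2 - ∫ x, ⟪v, ζ x⟫ ^ 2 ∂p) +
          (1 - α) * ((m : ℝ)⁻¹ * ∑ j, ⟪v, ζ (ω.2 j)⟫ ^ 2 - ∫ x, ⟪v, ζ x⟫ ^ 2 ∂q)|} ≤
      ENNReal.ofReal (2 * K * (1 + 48 / (u ^ 4 * N) * (K + u / 6) ^ 2) *
        Real.exp (-(N * u ^ 2 / (8 * (K + u / 6))))) := by
  set b := stdOrthonormalBasis ℝ U with hb
  set e : Fin (Module.finrank ℝ U) → H := fun i => (b i : H) with he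
  have hon : Orthonormal ℝ e := b.orthonormal.comp_linearIsometry U.subtypeₗᵢ
  set z : X → Fin (Module.finrank ℝ U) → ℝ := fun x i => ⟪e i, ζ x⟫ with hzdef
  have hz : Continuous z := continuous_pi fun i => continuous_const.inner hζ
  have hzK : ∀ x, z x ⬝ᵥ z x ≤ K := by
    intro x
    refine le_trans ?_ (hK x)
    have := hon.sum_inner_products_le (x := ζ x) (s := Finset.univ)
    simpa [dotProduct, hzdef, sq] using this
  have hcz : ∀ (c : Fin (Module.finrank ℝ U) → ℝ) x, c ⬝ᵥ z x = ⟪∑ i, c i • e i, ζ x⟫ := by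
    intro c x
    simp [dotProduct, sum_inner, inner_smul_left, hzdef]
  have hcc : ∀ c : Fin (Module.finrank ℝ U) → ℝ, c ⬝ᵥ c = ‖∑ i, c i • e i‖ ^ 2 := by
    intro c
    rw [← real_inner_self_eq_norm_sq, hon.inner_sum]
    simp [dotProduct]
  have hmom : ∀ (ν : Measure X) [IsProbabilityMeasure ν] (c : Fin (Module.finrank ℝ U) → ℝ),
      c ⬝ᵥ (mom ν z *ᵥ c) = ∫ x, ⟪∑ i, c i • e i, ζ x⟫ ^ 2 ∂ν := by
    intro ν _ c
    rw [mom_quad z hz K hzK]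
    refine integral_congr_ae (Filter.Eventually.of_forall fun x => ?_)
    simp only
    rw [dotProduct_comm (z x) c, hcz, sq]
  have ht := tail_two p q z hz K hK0 hzK α hα hα1 (fun c => by rw [hmom, hmom, hcc]; exact hM _) n m N hN hn hm u hu hu1
  refine le_trans (measure_mono ?_) ht
  rintro ω ⟨v, hv, hlt⟩
  have hvs : v = ∑ i, (b.repr ⟨v, hv⟩ i) • e i := by
    have := congrArg (Subtype.val) (b.sum_repr ⟨v, hv⟩)
    simpa [he] using this.symm
  refine ⟨fun i => b.repr ⟨v, hv⟩ i, ?_⟩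
  simp only [hmom, hcz, hcc]
  rw [← hvs]
  exact hlt

lemma tail_all (ζ : X → H) (hζ : Continuous ζ) (K : ℝ) (hK0 : 0 < K) (hK : ∀ x, ‖ζ x‖ ^ 2 ≤ K)
    (α : ℝ) (hα : 0 < α) (hα1 : α < 1)
    (hM : ∀ v : H, α * (∫ x, ⟪v, ζ x⟫ ^ 2 ∂p) + (1 - α) * (∫ x, ⟪v, ζ x⟫ ^ 2 ∂q) ≤ ‖v‖ ^ 2)
    (n m N : ℕ) (hN : 0 < N) (hn : N ≤ n) (hm : N ≤ m) (u : ℝ) (hu : 0 < u) (hu1 : u < 1)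
    (Q : (Fin n → X) × (Fin m → X) → H → ℝ) (hQc : ∀ ω, Continuous (Q ω))
    (hQ : ∀ ω v, Q ω v = α * ((n : ℝ)⁻¹ * ∑ i, ⟪v, ζ (ω.1 i)⟫ ^ 2 - ∫ x, ⟪v, ζ x⟫ ^ 2 ∂p) +
          (1 - α) * ((m : ℝ)⁻¹ * ∑ j, ⟪v, ζ (ω.2 j)⟫ ^ 2 - ∫ x, ⟪v, ζ x⟫ ^ 2 ∂q)) :
    ((Measure.pi fun _ : Fin n => p).prod (Measure.pi fun _ : Fin m => q))
      {ω | ∃ v, u * ‖v‖ ^ 2 < |Q ω v|} ≤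
      ENNReal.ofReal (2 * K * (1 + 48 / (u ^ 4 * N) * (K + u / 6) ^ 2) *
        Real.exp (-(N * u ^ 2 / (8 * (K + u / 6))))) := by
  set xs := TopologicalSpace.denseSeq X with hxs
  set U : ℕ → Submodule ℝ H := fun k => Submodule.span ℝ ((fun j => ζ (xs j)) '' Set.Iio k) with hU
  have hUm : Monotone U := fun k l hkl => Submodule.span_mono (Set.image_mono (Set.Iio_subset_Iio hkl))
  have hUf : ∀ k, FiniteDimensional ℝ (U k) := fun k =>
    FiniteDimensional.span_of_finite ℝ ((Set.finite_Iio k).image _)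
  set E : ℕ → Set ((Fin n → X) × (Fin m → X)) := fun k => {ω | ∃ v ∈ U k, u * ‖v‖ ^ 2 < |Q ω v|} with hE
  have hEm : Monotone E := by
    rintro k l hkl ω ⟨v, hv, h⟩
    exact ⟨v, hUm hkl hv, h⟩
  have hsub : {ω | ∃ v, u * ‖v‖ ^ 2 < |Q ω v|} ⊆ ⋃ k, E k := by
    rintro ω ⟨v, hv⟩
    set W := (⨆ k, U k).topologicalClosure with hW
    have hWc : IsClosed (W : Set H) := Submodule.isClosed_topologicalClosure _
    haveI : CompleteSpace W := hWc.completeSpace_coe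
    have hζW : ∀ x, ζ x ∈ W := by
      intro x
      have h1 : ∀ j, ζ (xs j) ∈ W := fun j => by
        apply Submodule.le_topologicalClosure
        apply Submodule.mem_iSup_of_mem (j + 1)
        exact Submodule.subset_span ⟨j, Set.mem_Iio.2 (Nat.lt_succ_self j), rfl⟩
      have h2 : IsClosed (ζ ⁻¹' (W : Set H)) := hWc.preimage hζ
      have h3 : closure (Set.range xs) ⊆ ζ ⁻¹' (W : Set H) := by
        apply closure_minimal _ h2
        rintro _ ⟨j, rfl⟩
        exact h1 j
      rw [(TopologicalSpace.denseRange_denseSeq X).closure_range] at h3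
      exact h3 (Set.mem_univ x)
    set v' : H := W.starProjection v with hv'
    have hin : ∀ x, ⟪v', ζ x⟫ = ⟪v, ζ x⟫ := by
      intro x
      have := Submodule.starProjection_inner_eq_zero (K := W) v (ζ x) (hζW x)
      rw [inner_sub_left] at this
      linarith
    have hQv : Q ω v' = Q ω v := by
      rw [hQ, hQ]; simp only [hin]
    have hnorm : ‖v'‖ ≤ ‖v‖ := W.norm_starProjection_apply_le v
    have hv2 : u * ‖v'‖ ^ 2 < |Q ω v'| := by
      rw [hQv]
      refine lt_of_le_of_lt ?_ hv
      gcongr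
    have hop : IsOpen {w : H | u * ‖w‖ ^ 2 < |Q ω w|} :=
      isOpen_lt (by fun_prop) ((hQc ω).abs)
    have hmem : v' ∈ closure ((⨆ k, U k : Submodule ℝ H) : Set H) := by
      have : v' ∈ W := W.starProjection_apply_mem v
      rw [hW] at this
      exact this
    obtain ⟨w, hw1, hw2⟩ := mem_closure_iff.1 hmem _ hop hv2
    obtain ⟨k, hk⟩ := (Submodule.mem_iSup_of_directed U (hUm.directed_le)).1 hw2
    exact Set.mem_iUnion.2 ⟨k, w, hk, hw1⟩
  refine (measure_mono hsub).trans ?_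
  rw [hEm.measure_iUnion]
  refine iSup_le fun k => ?_
  haveI := hUf k
  have := tail_sub p q ζ hζ K hK0 hK α hα hα1 hM n m N hN hn hm u hu hu1 (U k)
  simp only [hE, hQ]
  exact this
end red

end matrices

section oper
variable {d : ℕ} {H : Type*} [NormedAddCommGroup H] [InnerProductSpace ℝ H] [CompleteSpace H]
  (φ : EuclideanSpace ℝ (Fin d) → H) (hφc : Continuous φ) (hφ1 : ∀ x, ‖φ x‖ = 1)
  (p q : Measure (EuclideanSpace ℝ (Fin d))) [IsProbabilityMeasure p] [IsProbabilityMeasure q]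

lemma rankOne_apply (a b w : H) : rankOne a b w = ⟪b, w⟫ • a := by
  simp [rankOne]

lemma inner_rankOne (a v w : H) : ⟪v, rankOne a a w⟫ = ⟪v, a⟫ * ⟪a, w⟫ := by
  rw [rankOne_apply, inner_smul_right, mul_comm]

lemma rankOne_int (hφc : Continuous φ) (hφ1 : ∀ x, ‖φ x‖ = 1) :
    Integrable (fun x => rankOne (φ x) (φ x)) p := by
  have hc : Continuous fun x => rankOne (φ x) (φ x) := by
    have : (fun x => rankOne (φ x) (φ x)) =
        fun x => ContinuousLinearMap.smulRightL ℝ H H (innerSL ℝ (φ x)) (φ x) := rfl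
    rw [this]
    exact ((ContinuousLinearMap.smulRightL ℝ H H).continuous.comp ((innerSL ℝ).continuous.comp hφc)).clm_apply hφc
  refine Integrable.of_bound hc.aestronglyMeasurable 1 (Filter.Eventually.of_forall fun x => ?_)
  refine ContinuousLinearMap.opNorm_le_bound _ zero_le_one fun w => ?_
  rw [rankOne_apply, norm_smul, hφ1, mul_one]
  refine (norm_inner_le_norm _ _).trans ?_
  rw [hφ1]

lemma inner_cov (hφc : Continuous φ) (hφ1 : ∀ x, ‖φ x‖ = 1) (v w : H) :
    ⟪v, covOp φ p w⟫ = ∫ x, ⟪v, φ x⟫ * ⟪φ x, w⟫ ∂p := by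
  have h := ((innerSL ℝ v).comp (ContinuousLinearMap.apply ℝ H w)).integral_comp_comm (rankOne_int φ p hφc hφ1)
  simp only [ContinuousLinearMap.comp_apply, ContinuousLinearMap.apply_apply, innerSL_apply_apply, inner_rankOne] at h
  rw [h, covOp]

lemma inner_emp {n : ℕ} (xs : Fin n → EuclideanSpace ℝ (Fin d)) (v w : H) :
    ⟪v, empCov φ xs w⟫ = (n : ℝ)⁻¹ * ∑ i, ⟪v, φ (xs i)⟫ * ⟪φ (xs i), w⟫ := by
  simp [empCov, inner_smul_right, inner_sum, inner_rankOne]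

lemma sq_int (hφc : Continuous φ) (hφ1 : ∀ x, ‖φ x‖ = 1) (v w : H) :
    Integrable (fun x => ⟪v, φ x⟫ * ⟪φ x, w⟫) p := by
  refine Integrable.of_bound (by fun_prop) (‖v‖ * ‖w‖) (Filter.Eventually.of_forall fun x => ?_)
  rw [norm_mul]
  have h1 := norm_inner_le_norm (𝕜 := ℝ) v (φ x)
  have h2 := norm_inner_le_norm (𝕜 := ℝ) (φ x) w
  rw [hφ1] at h1 h2
  gcongr <;> linarith

lemma cov_symm (hφc : Continuous φ) (hφ1 : ∀ x, ‖φ x‖ = 1) (v w : H) :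
    ⟪covOp φ p v, w⟫ = ⟪v, covOp φ p w⟫ := by
  rw [real_inner_comm, inner_cov φ p hφc hφ1, inner_cov φ p hφc hφ1]
  refine integral_congr_ae (Filter.Eventually.of_forall fun x => ?_)
  simp only
  rw [real_inner_comm, real_inner_comm v, mul_comm]

lemma emp_symm {n : ℕ} (xs : Fin n → EuclideanSpace ℝ (Fin d)) (v w : H) :
    ⟪empCov φ xs v, w⟫ = ⟪v, empCov φ xs w⟫ := by
  rw [real_inner_comm, inner_emp, inner_emp]
  congr 1
  refine Finset.sum_congr rfl fun i _ => ?_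
  rw [real_inner_comm, real_inner_comm v, mul_comm]

lemma cov_nonneg (hφc : Continuous φ) (hφ1 : ∀ x, ‖φ x‖ = 1) (v : H) : 0 ≤ ⟪v, covOp φ p v⟫ := by
  rw [inner_cov φ p hφc hφ1]
  refine integral_nonneg fun x => ?_
  simp only [Pi.zero_apply]
  rw [real_inner_comm v]; exact mul_self_nonneg _

lemma cov_le (hφc : Continuous φ) (hφ1 : ∀ x, ‖φ x‖ = 1) (μ : ℝ) (hμ : 0 < μ) (hpq : p ≪ q)
    (hratio : ∀ᵐ x ∂q, p.rnDeriv q x ≤ ENNReal.ofReal (1 / μ)) (v : H) :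
    μ * ⟪v, covOp φ p v⟫ ≤ ⟪v, covOp φ q v⟫ := by
  have hle : p ≤ ENNReal.ofReal (1 / μ) • q := by
    haveI : p.HaveLebesgueDecomposition q := Measure.haveLebesgueDecomposition_of_sigmaFinite p q
    have h1 := Measure.withDensity_rnDeriv_eq p q hpq
    calc p = q.withDensity (p.rnDeriv q) := h1.symm
      _ ≤ q.withDensity (fun _ => ENNReal.ofReal (1 / μ)) := withDensity_mono hratio
      _ = _ := withDensity_const _
  have hi := sq_int φ q hφc hφ1 v v
  have hi2 : Integrable (fun x => ⟪v, φ x⟫ * ⟪φ x, v⟫) (ENNReal.ofReal (1 / μ) • q) :=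
    hi.smul_measure ENNReal.ofReal_ne_top
  have := integral_mono_measure hle (Filter.Eventually.of_forall fun x => by
    simp only [Pi.zero_apply]
    rw [real_inner_comm v]; exact mul_self_nonneg _) hi2
  rw [integral_smul_measure, ENNReal.toReal_ofReal (by positivity), smul_eq_mul] at this
  rw [inner_cov φ p hφc hφ1, inner_cov φ q hφc hφ1]
  calc _ ≤ μ * (1 / μ * ∫ x, ⟪v, φ x⟫ * ⟪φ x, v⟫ ∂q) := by gcongr
    _ = _ := by field_simp

end oper

end LMC

/-- **Concentration of sums of random self-adjoint operators.**
With `Γ = αΣ_p + (1-α)Σ_q`, `Γ̂` its empirical counterpart,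
`D = (Γ+βI)^{-1/2}(Γ̂-Γ)(Γ+βI)^{-1/2}` (here `S` denotes the positive square root of
`(Γ+βI)⁻¹`), `C(β) = sup_x ⟪φ(x), (Σ_p+βI)⁻¹ φ(x)⟫`, for any `0 < u < 1`,
`P(λ_max(D) > u) ≤ (2/μ) C(β) (1 + 48/(u⁴(m∧n)) (C(β)/μ + u/6)²)
  exp(-(m∧n)u²/(8(C(β)/μ + u/6)))`, where `λ_max(D)` (the largest eigenvalue of
`(D²)^{1/2}`) is the operator norm of the (compact, self-adjoint) operator `D`. -/
theorem lambda_max_concentration {d n m : ℕ} (hn : 0 < n) (hm : 0 < m)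
    {H : Type*} [NormedAddCommGroup H] [InnerProductSpace ℝ H] [CompleteSpace H]
    (k : EuclideanSpace ℝ (Fin d) → EuclideanSpace ℝ (Fin d) → ℝ)
    (φ : EuclideanSpace ℝ (Fin d) → H) (hφc : Continuous φ)
    (hk : ∀ x y, k x y = ⟪φ x, φ y⟫) (hk1 : ∀ x, k x x = 1)
    (p q : Measure (EuclideanSpace ℝ (Fin d)))
    [IsProbabilityMeasure p] [IsProbabilityMeasure q]
    (μ α : ℝ) (hμ : 0 < μ) (hμ1 : μ ≤ 1) (hα : 0 < α) (hα2 : α ≤ 1 / 2)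
    (hpq : p ≪ q) (hratio : ∀ᵐ x ∂q, p.rnDeriv q x ≤ ENNReal.ofReal (1 / μ))
    (β : ℝ) (hβ : 0 < β)
    -- `S` is the positive square root of `(Γ + βI)⁻¹`, `Γ = αΣ_p + (1-α)Σ_q`:
    (S : H →L[ℝ] H) (hSsa : IsSelfAdjoint S) (hSpos : ∀ w : H, 0 ≤ ⟪w, S w⟫)
    (hS : (S ∘L S) ∘L ((α • covOp φ p + (1 - α) • covOp φ q) + β • 1) = 1)
    (hS' : ((α • covOp φ p + (1 - α) • covOp φ q) + β • 1) ∘L (S ∘L S) = 1)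
    -- `Rp` is the resolvent `(Σ_p + βI)⁻¹` and `C = C(β)` :
    (Rp : H →L[ℝ] H) (hRp : Rp ∘L (covOp φ p + β • 1) = 1)
    (hRp' : (covOp φ p + β • 1) ∘L Rp = 1)
    (C : ℝ) (hC : C = ⨆ x : EuclideanSpace ℝ (Fin d), ⟪φ x, Rp (φ x)⟫)
    (u : ℝ) (hu : 0 < u) (hu1 : u < 1) :
    ((Measure.pi fun _ : Fin n => p).prod (Measure.pi fun _ : Fin m => q))
        {ω : (Fin n → EuclideanSpace ℝ (Fin d)) × (Fin m → EuclideanSpace ℝ (Fin d)) |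
          u < ‖S ∘L (((α • empCov φ ω.1 + (1 - α) • empCov φ ω.2)
                - (α • covOp φ p + (1 - α) • covOp φ q)) ∘L S)‖}
      ≤ ENNReal.ofReal
          ((2 / μ) * C * (1 + 48 / (u ^ 4 * (min m n : ℕ)) * (C / μ + u / 6) ^ 2)
            * Real.exp (-((min m n : ℕ) * u ^ 2 / (8 * (C / μ + u / 6))))) := by
  have hφ1 : ∀ x, ‖φ x‖ = 1 := by
    intro x
    have h1 := hk1 x
    rw [hk, real_inner_self_eq_norm_sq] at h1
    nlinarith [norm_nonneg (φ x)]
  have hSs : ∀ v w : H, ⟪S v, w⟫ = ⟪v, S w⟫ := fun v w => hSsa.isSymmetric v w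
  set G : H →L[ℝ] H := (α • covOp φ p + (1 - α) • covOp φ q) + β • 1 with hG
  have hGq : ∀ w, ⟪w, G w⟫ = α * ⟪w, covOp φ p w⟫ + (1 - α) * ⟪w, covOp φ q w⟫ + β * ‖w‖ ^ 2 := by
    intro w
    simp [hG, inner_add_right, inner_smul_right]
  set A : H →L[ℝ] H := covOp φ p + β • 1 with hA
  have hAq : ∀ w, ⟪w, A w⟫ = ⟪w, covOp φ p w⟫ + β * ‖w‖ ^ 2 := by
    intro w
    simp [hA, inner_add_right, inner_smul_right]
  have hAs : ∀ v w, ⟪A v, w⟫ = ⟪v, A w⟫ := by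
    intro v w
    simp [hA, inner_add_right, inner_smul_right, inner_add_left, inner_smul_left, LMC.cov_symm φ p hφc hφ1]
  have hcp := LMC.cov_nonneg φ p hφc hφ1
  have hcq := LMC.cov_nonneg φ q hφc hφ1
  have hAG : ∀ w, μ * ⟪w, A w⟫ ≤ ⟪w, G w⟫ := by
    intro w
    rw [hGq, hAq]
    have h1 := LMC.cov_le φ p q hφc hφ1 μ hμ hpq hratio w
    have h2 := hcp w
    have h3 : 0 ≤ β * ‖w‖ ^ 2 := by positivity
    have h4 : (1 - α) * (μ * ⟪w, covOp φ p w⟫) ≤ (1 - α) * ⟪w, covOp φ q w⟫ :=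
      mul_le_mul_of_nonneg_left h1 (by linarith)
    have h5 : μ * (α * ⟪w, covOp φ p w⟫) ≤ 1 * (α * ⟪w, covOp φ p w⟫) :=
      mul_le_mul_of_nonneg_right hμ1 (by positivity)
    have h6 : μ * (β * ‖w‖ ^ 2) ≤ 1 * (β * ‖w‖ ^ 2) := mul_le_mul_of_nonneg_right hμ1 h3
    nlinarith
  have hA0 : ∀ w, 0 ≤ ⟪w, A w⟫ := fun w => by
    rw [hAq]; have := hcp w; positivity
  have hbdd : BddAbove (Set.range fun x : EuclideanSpace ℝ (Fin d) => ⟪φ x, Rp (φ x)⟫) := by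
    refine ⟨‖Rp‖, ?_⟩
    rintro _ ⟨x, rfl⟩
    refine (real_inner_le_norm _ _).trans ?_
    have := Rp.le_opNorm (φ x)
    simp only [hφ1, mul_one, one_mul] at this ⊢
    exact this
  have hCx : ∀ x, ⟪φ x, Rp (φ x)⟫ ≤ C := fun x => hC ▸ le_ciSup hbdd x
  have hAR : ∀ w, A (Rp w) = w := fun w => by
    have := congrArg (fun T : H →L[ℝ] H => T w) hRp'
    simpa using this
  have hGS : ∀ w, G (S (S w)) = w := fun w => by
    have := congrArg (fun T : H →L[ℝ] H => T w) hS'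
    simpa using this
  have hSSG : ∀ w, S (S (G w)) = w := fun w => by
    have := congrArg (fun T : H →L[ℝ] H => T w) hS
    simpa using this
  have hSGS : ∀ w, S (G (S w)) = w := fun w => by
    have h1 : S (G (S w)) = S (G (S (G (S (S w))))) := by rw [hGS]
    have h2 : S (S (S (G (S w)))) = S (S w) := by rw [hSSG]
    have h3 := hGS (S (G (S w)))
    rw [h2, hGS] at h3
    exact h3.symm
  have hSK : ∀ x, ‖S (φ x)‖ ^ 2 ≤ C / μ := by
    intro x
    rw [le_div_iff₀ hμ]
    refine le_trans ?_ (hCx x)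
    set r := Rp (φ x) with hr
    set g := S (S (φ x)) with hg
    have h1 : ‖S (φ x)‖ ^ 2 = ⟪φ x, g⟫ := by
      rw [← real_inner_self_eq_norm_sq, hSs]
    have h0 := hA0 (r - μ • g)
    have e1 : A r = φ x := hAR _
    have e2 : G g = φ x := hGS _
    have h2 : ⟪r, A g⟫ = ⟪φ x, g⟫ := by rw [← hAs, e1]
    have h3 := hAG g
    rw [e2, real_inner_comm (φ x) g] at h3
    simp only [map_sub, map_smul, inner_sub_left, inner_sub_right, inner_smul_left, inner_smul_right, e1, h2] at h0
    rw [real_inner_comm (φ x) r, real_inner_comm (φ x) g] at h0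
    simp only [conj_trivial] at h0
    rw [h1]
    nlinarith
  have hC0 : 0 < C := by
    refine lt_of_lt_of_le ?_ (hCx 0)
    have h1 := hAq (Rp (φ 0))
    rw [hAR, real_inner_comm] at h1
    rw [h1]
    have h2 : Rp (φ 0) ≠ 0 := by
      intro h
      have h3 := hAR (φ 0)
      rw [h, map_zero] at h3
      have h4 := hφ1 0
      rw [← h3, norm_zero] at h4
      exact zero_ne_one h4
    have h3 := hcp (Rp (φ 0))
    have h4 : 0 < ‖Rp (φ 0)‖ := norm_pos_iff.2 h2
    positivity
  have hcovS : ∀ (ν : Measure (EuclideanSpace ℝ (Fin d))) [IsProbabilityMeasure ν] (v : H),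
      ⟪S v, covOp φ ν (S v)⟫ = ∫ x, ⟪v, S (φ x)⟫ ^ 2 ∂ν := by
    intro ν _ v
    rw [LMC.inner_cov φ ν hφc hφ1]
    refine integral_congr_ae (Filter.Eventually.of_forall fun x => ?_)
    simp only
    rw [real_inner_comm (S v) (φ x), hSs, sq]
  have hempS : ∀ (r : ℕ) (xs : Fin r → EuclideanSpace ℝ (Fin d)) (v : H),
      ⟪S v, empCov φ xs (S v)⟫ = (r : ℝ)⁻¹ * ∑ i, ⟪v, S (φ (xs i))⟫ ^ 2 := by
    intro r xs v
    rw [LMC.inner_emp]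
    congr 1
    refine Finset.sum_congr rfl fun i _ => ?_
    rw [real_inner_comm (S v) (φ (xs i)), hSs, sq]
  have hM : ∀ v : H, α * (∫ x, ⟪v, S (φ x)⟫ ^ 2 ∂p) + (1 - α) * (∫ x, ⟪v, S (φ x)⟫ ^ 2 ∂q) ≤ ‖v‖ ^ 2 := by
    intro v
    rw [← hcovS, ← hcovS]
    have h1 := hGq (S v)
    rw [hSs, hSGS, real_inner_self_eq_norm_sq] at h1
    have h2 : 0 ≤ β * ‖S v‖ ^ 2 := by positivity
    linarith
  set D : (Fin n → EuclideanSpace ℝ (Fin d)) × (Fin m → EuclideanSpace ℝ (Fin d)) → H →L[ℝ] H := fun ω =>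
    S ∘L (((α • empCov φ ω.1 + (1 - α) • empCov φ ω.2) - (α • covOp φ p + (1 - α) • covOp φ q)) ∘L S) with hD
  have hDq : ∀ ω v, ⟪v, D ω v⟫ =
      α * ((n : ℝ)⁻¹ * ∑ i, ⟪v, S (φ (ω.1 i))⟫ ^ 2 - ∫ x, ⟪v, S (φ x)⟫ ^ 2 ∂p) +
        (1 - α) * ((m : ℝ)⁻¹ * ∑ j, ⟪v, S (φ (ω.2 j))⟫ ^ 2 - ∫ x, ⟪v, S (φ x)⟫ ^ 2 ∂q) := by
    intro ω v
    rw [← hcovS, ← hcovS, ← hempS, ← hempS, hD]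
    simp only [ContinuousLinearMap.comp_apply]
    rw [← hSs]
    simp only [ContinuousLinearMap.sub_apply, ContinuousLinearMap.add_apply, ContinuousLinearMap.smul_apply,
      inner_sub_right, inner_add_right, inner_smul_right]
    ring
  have hDs : ∀ ω v w, ⟪D ω v, w⟫ = ⟪v, D ω w⟫ := by
    intro ω v w
    rw [hD]
    simp only [ContinuousLinearMap.comp_apply]
    rw [hSs, ← hSs v]
    simp only [ContinuousLinearMap.sub_apply, ContinuousLinearMap.add_apply, ContinuousLinearMap.smul_apply,
      inner_sub_right, inner_add_right, inner_smul_right, inner_sub_left, inner_add_left, inner_smul_left,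
      conj_trivial, LMC.cov_symm φ p hφc hφ1, LMC.cov_symm φ q hφc hφ1, LMC.emp_symm]
  have hNpos : 0 < min m n := lt_min hm hn
  have key := LMC.tail_all p q (fun x => S (φ x)) (by fun_prop) (C / μ) (by positivity) hSK α hα (by linarith) hM
    n m (min m n) hNpos (min_le_right _ _) (min_le_left _ _) u hu hu1 (fun ω v => ⟪v, D ω v⟫)
    (fun ω => by fun_prop) hDq
  have hconst : (2 / μ) * C = 2 * (C / μ) := by ring
  rw [hconst]
  refine le_trans (measure_mono ?_) key
  intro ω hω
  simp only [Set.mem_ofPred_eq] at hω ⊢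
  change u < ‖D ω‖ at hω
  by_contra hcon
  push Not at hcon
  have hsym : (D ω : H →ₗ[ℝ] H).IsSymmetric := fun v w => hDs ω v w
  have hnorm := ContinuousLinearMap.norm_eq_iSup_rayleighQuotient (D ω) hsym
  rw [hnorm] at hω
  refine absurd hω (not_lt.2 (ciSup_le fun v => ?_))
  rw [ContinuousLinearMap.rayleighQuotient, ContinuousLinearMap.reApplyInnerSelf_apply]
  simp only [RCLike.re_to_real]
  rw [abs_div, abs_sq]
  refine div_le_of_le_mul₀ (by positivity) hu.le ?_
  rw [real_inner_comm]
  exact hcon v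
end
end
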